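/- arXiv:1708.02819 — 2 statements merged into one kernel-verified Lean document; each statement's English description precedes it below -/
import Mathlib

section
/- Let f be a function in the Eremenko–Lyubich class B and suppose that there exists R > 0 such that liminf_{r→∞} [logarea(f^{-1}(D(0,R)) ∩ D(0,r) ∩ Δ)] / log r > 0. Then area I(f) = 0. -/
open MeasureTheory Filter Metric Set Topology ENNReal

/-- Logarithmic area of a subset of the plane. -/
noncomputable def logArea (A : Set ℂ) : ℝ≥0∞ :=
  ∫⁻ z in A, ENNReal.ofReal ((‖z‖ ^ 2)⁻¹)

/-- The set Δ = {z : |z| ≥ 1}. -/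
def Delta : Set ℂ := {z : ℂ | 1 ≤ ‖z‖}

/-- Chordal (spherical) distance on the Riemann sphere ℂ ∪ {∞}, with ∞ encoded as `none`. -/
noncomputable def chordalDist : Option ℂ → Option ℂ → ℝ
  | none, none => 0
  | none, some w => 2 / Real.sqrt (1 + ‖w‖ ^ 2)
  | some z, none => 2 / Real.sqrt (1 + ‖z‖ ^ 2)
  | some z, some w =>
      2 * ‖z - w‖ / (Real.sqrt (1 + ‖z‖ ^ 2) * Real.sqrt (1 + ‖w‖ ^ 2))

/-- Locally uniform convergence on `U` of a sequence of ℂ-valued functions towards a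
function with values in the Riemann sphere, with respect to the spherical metric. -/
def SphLocUnifConvOn (F : ℕ → ℂ → ℂ) (g : ℂ → Option ℂ) (U : Set ℂ) : Prop :=
  ∀ K : Set ℂ, K ⊆ U → IsCompact K → ∀ ε : ℝ, 0 < ε →
    ∀ᶠ n in atTop, ∀ z ∈ K, chordalDist (some (F n z)) (g z) < ε

/-- The Fatou set: points having a neighborhood on which every sequence of iterates has a
subsequence converging locally uniformly with respect to the spherical metric. -/
def fatouSet (f : ℂ → ℂ) : Set ℂ :=
  {z | ∃ U ∈ 𝓝 z, ∀ φ : ℕ → ℕ, StrictMono φ →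
    ∃ ψ : ℕ → ℕ, StrictMono ψ ∧ ∃ g : ℂ → Option ℂ,
      SphLocUnifConvOn (fun n => f^[φ (ψ n)]) g U}

/-- The Julia set. -/
def juliaSet (f : ℂ → ℂ) : Set ℂ := (fatouSet f)ᶜ

/-- The escaping set. -/
def escapingSet (f : ℂ → ℂ) : Set ℂ :=
  {z | Tendsto (fun n => ‖f^[n] z‖) atTop atTop}

/-- The Fatou set has no multiply connected component. -/
def NoMultiplyConnectedFatouComponent (f : ℂ → ℂ) : Prop :=
  ∀ z ∈ fatouSet f, SimplyConnectedSpace (connectedComponentIn (fatouSet f) z)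

/-- Maximum modulus M(r,f). -/
noncomputable def maxMod (f : ℂ → ℂ) (r : ℝ) : ℝ :=
  sSup ((fun z => ‖f z‖) '' {z : ℂ | ‖z‖ = r})

/-- The order ρ(f) of an entire function, as an extended real number. -/
noncomputable def entireOrder (f : ℂ → ℂ) : EReal :=
  limsup (fun r : ℝ => ((Real.log (Real.log (maxMod f r)) / Real.log r : ℝ) : EReal)) atTop

/-- The fast escaping set A(f). -/
def fastEscapingSet (f : ℂ → ℂ) : Set ℂ :=
  {z | ∃ R : ℝ, 0 < R ∧ (∀ r : ℝ, R ≤ r → r < maxMod f r) ∧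
    ∃ L : ℕ, ∀ n : ℕ, L < n → (maxMod f)^[n - L] R ≤ ‖f^[n] z‖}

/-- `f` is a transcendental entire function. -/
def TranscendentalEntire (f : ℂ → ℂ) : Prop :=
  Differentiable ℂ f ∧ ¬ ∃ p : Polynomial ℂ, ∀ z, f z = p.eval z

/-- Order of vanishing of `g` at `z` (the least `k` with nonzero `k`-th derivative). -/
noncomputable def vanishingOrder (g : ℂ → ℂ) (z : ℂ) : ℕ :=
  sInf {k : ℕ | iteratedDeriv k g z ≠ 0}

/-- n(r,a): the number of solutions of f(z) = a with |z| ≤ r, counted with multiplicity. -/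
noncomputable def nCount (f : ℂ → ℂ) (a : ℂ) (r : ℝ) : ℕ :=
  ∑ᶠ z ∈ {z : ℂ | ‖z‖ ≤ r ∧ f z = a}, vanishingOrder (fun w => f w - a) z

/-- n(r) = max over a of n(r,a). -/
noncomputable def nMax (f : ℂ → ℂ) (r : ℝ) : ℕ := ⨆ a : ℂ, nCount f a r

/-- Critical values of `f`. -/
def criticalValues (f : ℂ → ℂ) : Set ℂ := {w | ∃ z, deriv f z = 0 ∧ f z = w}

/-- Finite asymptotic values of `f`. -/
def asymptoticValues (f : ℂ → ℂ) : Set ℂ :=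
  {w | ∃ γ : ℝ → ℂ, Continuous γ ∧ Tendsto (fun t => ‖γ t‖) atTop atTop ∧
    Tendsto (fun t => f (γ t)) atTop (𝓝 w)}

/-- The Eremenko–Lyubich class B. -/
def ELClass (f : ℂ → ℂ) : Prop :=
  TranscendentalEntire f ∧ Bornology.IsBounded (criticalValues f ∪ asymptoticValues f)

/-- Semihyperbolic polynomial. -/
def SemiHyperbolic (p : Polynomial ℂ) : Prop :=
  ∃ ε : ℝ, 0 < ε ∧ ∃ N : ℕ, ∀ z ∈ juliaSet (fun w => p.eval w), ∀ n : ℕ, 1 ≤ n →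
    ∀ V : Set ℂ, (∃ u ∈ (fun w => p.eval w)^[n] ⁻¹' ball z ε,
        V = connectedComponentIn ((fun w => p.eval w)^[n] ⁻¹' ball z ε) u) →
      ∀ w ∈ ball z ε,
        (∑ᶠ u ∈ {u : ℂ | u ∈ V ∧ (fun v => p.eval v)^[n] u = w},
          vanishingOrder (fun ζ => (fun v => p.eval v)^[n] ζ - w) u) ≤ N

/-- Differentiability of a continuous lift through a locally biholomorphic map. -/
theorem differentiableAt_of_comp {p g : ℂ → ℂ} {a : ℂ} (hg : ContinuousAt g a)
    (hp : AnalyticAt ℂ p (g a)) (hp' : deriv p (g a) ≠ 0)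
    (hpg : DifferentiableAt ℂ (fun z => p (g z)) a) : DifferentiableAt ℂ g a := by
  have hs : HasStrictDerivAt p (deriv p (g a)) (g a) := hp.hasStrictDerivAt
  have hinv := hs.to_localInverse hp'
  have hev := hs.hasStrictFDerivAt_equiv hp'|>.eventually_left_inverse
  have h1 : ∀ᶠ z in 𝓝 a, g z = hs.localInverse p (deriv p (g a)) (g a) hp' (p (g z)) :=
    (hg.eventually hev).mono fun z hz => hz.symm
  have h2 : DifferentiableAt ℂ (hs.localInverse p (deriv p (g a)) (g a) hp') (p (g a)) :=
    hinv.hasDerivAt.differentiableAt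
  exact (h2.comp a hpg).congr_of_eventuallyEq h1

theorem Convex.exists_differentiableOn_exp_eq {U : Set ℂ} (hU : Convex ℝ U) (hUo : IsOpen U)
    (hne : U.Nonempty) {g : ℂ → ℂ} (hg : DifferentiableOn ℂ g U) (h0 : ∀ z ∈ U, g z ≠ 0) :
    ∃ l : ℂ → ℂ, DifferentiableOn ℂ l U ∧ ∀ z ∈ U, Complex.exp (l z) = g z := by
  have hsc : IsSimplyConnected U := by
    have := hU.contractibleSpace hne
    exact (inferInstance : SimplyConnectedSpace U)
  obtain ⟨l, hlc, hl⟩ := Complex.exists_continuousOn_eqOn_exp_comp hsc hUo hg.continuousOn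
    (by rintro ⟨z, hz, h⟩; exact h0 z hz h)
  refine ⟨l, fun z hz => ?_, fun z hz => hl hz⟩
  have hlz : ContinuousAt l z := hlc.continuousAt (hUo.mem_nhds hz)
  refine (differentiableAt_of_comp (p := Complex.exp) hlz (by fun_prop) (by simp) ?_).differentiableWithinAt
  exact (hg.differentiableAt (hUo.mem_nhds hz)).congr_of_eventuallyEq
    (eventually_of_mem (hUo.mem_nhds hz) hl)

theorem volume_image_eq_lintegral_norm_deriv_sq {s : Set ℂ} (hs : MeasurableSet s) {g g' : ℂ → ℂ}
    (hg : ∀ x ∈ s, HasDerivAt g (g' x) x) (hinj : InjOn g s) :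
    volume (g '' s) = ∫⁻ x in s, ENNReal.ofReal (‖g' x‖ ^ 2) := by
  rw [← lintegral_abs_det_fderiv_eq_addHaar_image volume hs
    (fun x hx => (hg x hx).complexToReal_fderiv.hasFDerivWithinAt) hinj]
  refine lintegral_congr fun x => ?_
  have : (g' x • (1 : ℂ →L[ℝ] ℂ)).det = Algebra.norm ℝ (g' x) := by
    rw [Algebra.norm_apply]; rfl
  rw [this, Algebra.norm_complex_eq]
  simp [Complex.normSq_eq_norm_sq]

theorem two_pi_mul_le_integral_norm_sq {p : ℂ → ℂ} (hp : DifferentiableOn ℂ p (ball 0 1))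
    (h0 : p 0 = -1) {r : ℝ} (hr0 : 0 < r) (hr1 : r < 1) :
    2 * Real.pi * (1 + ‖deriv p 0‖ ^ 2 * r ^ 4) ≤
      ∫ θ in (-Real.pi)..Real.pi, ‖p (circleMap 0 r θ ^ 2)‖ ^ 2 := by
  set b := deriv p 0 with hb
  set D := dslope p 0 with hD
  have hDd : DifferentiableOn ℂ D (ball 0 1) :=
    (Complex.differentiableOn_dslope (ball_mem_nhds 0 one_pos)).2 hp
  set Φ : ℂ → ℂ := fun z => -2 * p (z ^ 2) + 2 * (starRingEnd ℂ b) * r ^ 4 * D (z ^ 2)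
    - 1 - ‖b‖ ^ 2 * r ^ 4 with hΦ
  have hmaps : ∀ z : ℂ, z ∈ ball (0 : ℂ) 1 → z ^ 2 ∈ ball (0 : ℂ) 1 := by
    intro z hz
    simp only [mem_ball_zero_iff, norm_pow] at hz ⊢
    exact pow_lt_one₀ (norm_nonneg _) hz two_ne_zero
  have hsq : DifferentiableOn ℂ (fun z : ℂ => z ^ 2) (ball 0 1) := by fun_prop
  have hp2 : DifferentiableOn ℂ (fun z => p (z ^ 2)) (ball 0 1) := hp.comp hsq hmaps
  have hD2 : DifferentiableOn ℂ (fun z => D (z ^ 2)) (ball 0 1) := hDd.comp hsq hmaps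
  have hΦd : DifferentiableOn ℂ Φ (ball 0 1) := by
    rw [hΦ]
    exact (((hp2.const_mul _).add (hD2.const_mul _)).sub_const _).sub_const _
  have hcb : closedBall (0 : ℂ) r ⊆ ball 0 1 := closedBall_subset_ball hr1
  have hΦ0 : Φ 0 = ((1 + ‖b‖ ^ 2 * r ^ 4 : ℝ) : ℂ) := by
    have hbb : (starRingEnd ℂ b) * b = ((‖b‖ ^ 2 : ℝ) : ℂ) := by
      rw [mul_comm, Complex.mul_conj, Complex.normSq_eq_norm_sq]
    have h1 : D 0 = b := dslope_same p 0
    have : Φ 0 = 1 + 2 * ((starRingEnd ℂ b) * b) * r ^ 4 - ‖b‖ ^ 2 * r ^ 4 := by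
      simp only [hΦ]; norm_num [h0, h1]; ring
    rw [this, hbb]; push_cast; ring
  have havg : Real.circleAverage Φ 0 r = Φ 0 := by
    apply DiffContOnCl.circleAverage
    rw [abs_of_pos hr0]
    refine DifferentiableOn.diffContOnCl (hΦd.mono ?_)
    rw [closure_ball _ hr0.ne']; exact hcb
  have hcm : ∀ θ, circleMap 0 r θ ∈ ball (0 : ℂ) 1 := fun θ =>
    hcb (circleMap_mem_closedBall 0 hr0.le θ)
  have hcΦ : Continuous fun θ => Φ (circleMap 0 r θ) :=
    hΦd.continuousOn.comp_continuous (continuous_circleMap 0 r) hcm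
  have hcp : Continuous fun θ => p (circleMap 0 r θ ^ 2) :=
    hp2.continuousOn.comp_continuous (continuous_circleMap 0 r) hcm
  have hinteg : ∫ θ in (-Real.pi)..Real.pi, Φ (circleMap 0 r θ) = 2 * Real.pi * Φ 0 := by
    have hper : Function.Periodic (fun θ => Φ (circleMap 0 r θ)) (2 * Real.pi) := fun θ => by
      simp [periodic_circleMap 0 r θ]
    have := hper.intervalIntegral_add_eq (-Real.pi) 0
    rw [show -Real.pi + 2 * Real.pi = Real.pi by ring, zero_add] at this
    rw [this, ← havg, Real.circleAverage_def, Complex.real_smul]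
    have : (Real.pi : ℂ) ≠ 0 := by exact_mod_cast Real.pi_ne_zero
    push_cast
    field_simp
  have hre : ∫ θ in (-Real.pi)..Real.pi, (Φ (circleMap 0 r θ)).re
      = 2 * Real.pi * (1 + ‖b‖ ^ 2 * r ^ 4) := by
    have h := Complex.reCLM.intervalIntegral_comp_comm
      (hcΦ.intervalIntegrable (μ := volume) (-Real.pi) Real.pi)
    simp only [Complex.reCLM_apply] at h
    rw [h, hinteg, hΦ0, ← Complex.ofReal_ofNat, ← Complex.ofReal_mul, ← Complex.ofReal_mul,
      Complex.ofReal_re]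
  rw [← hre]
  refine intervalIntegral.integral_mono (by linarith [Real.pi_pos])
    ((Complex.continuous_re.comp hcΦ).intervalIntegrable _ _)
    ((hcp.norm.pow 2).intervalIntegrable _ _) fun θ => ?_
  set z := circleMap 0 r θ with hz
  have hz0 : z ≠ 0 := by simp [hz, hr0.ne']
  have hzn : ‖z‖ = r := by simp [hz, abs_of_pos hr0]
  have hDz : z ^ 2 * D (z ^ 2) = p (z ^ 2) + 1 := by
    have := sub_smul_dslope p 0 (z ^ 2)
    simpa [h0] using this
  have key : (Φ z).re = ‖p (z ^ 2)‖ ^ 2 - ‖p (z ^ 2) - (-1 + b * z ^ 2)‖ ^ 2 := by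
    have hzz : z * starRingEnd ℂ z = ((r ^ 2 : ℝ) : ℂ) := by
      rw [Complex.mul_conj, Complex.normSq_eq_norm_sq, hzn]
    have e1 : (starRingEnd ℂ b) * r ^ 4 * D (z ^ 2)
        = (starRingEnd ℂ b) * (starRingEnd ℂ z) ^ 2 * (p (z ^ 2) + 1) := by
      rw [← hDz]
      have : ((r : ℂ)) ^ 4 = z ^ 2 * (starRingEnd ℂ z) ^ 2 := by
        rw [← mul_pow, hzz]; push_cast; ring
      rw [this]; ring
    have e2 : Φ z = -2 * p (z ^ 2) + 2 * ((starRingEnd ℂ (b * z ^ 2)) * (p (z ^ 2) + 1))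
        - 1 - ((‖b * z ^ 2‖ ^ 2 : ℝ) : ℂ) := by
      have : ‖b * z ^ 2‖ ^ 2 = ‖b‖ ^ 2 * r ^ 4 := by rw [norm_mul, norm_pow, hzn]; ring
      rw [this]
      simp only [hΦ, map_mul, map_pow]
      rw [← e1]; push_cast; ring
    rw [e2]
    generalize b * z ^ 2 = w
    generalize p (z ^ 2) = q
    rw [← Complex.normSq_eq_norm_sq, ← Complex.normSq_eq_norm_sq, ← Complex.normSq_eq_norm_sq]
    simp [Complex.normSq_apply]
    ring
  show (Φ z).re ≤ ‖p (z ^ 2)‖ ^ 2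
  rw [key]
  nlinarith [sq_nonneg ‖p (z ^ 2) - (-1 + b * z ^ 2)‖]

theorem setLIntegral_reProdIm_ge {a b c d : ℝ} (hcd : c ≤ d) {φ : ℂ → ℝ}
    (hφ : ContinuousOn φ {z | z.re ∈ Ioo a b}) (hφ0 : ∀ z, 0 ≤ φ z) {h : ℝ → ℝ}
    (hh : ∀ x ∈ Ioo a b, h x ≤ ∫ y in c..d, φ (x + y * Complex.I)) :
    ∫⁻ x in Ioo a b, ENNReal.ofReal (h x) ≤
      ∫⁻ z in Ioo a b ×ℂ Ioo c d, ENNReal.ofReal (φ z) := by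
  have hS : MeasurableSet (Ioo a b ×ℂ Ioo c d) :=
    (Complex.measurable_re measurableSet_Ioo).inter (Complex.measurable_im measurableSet_Ioo)
  have hm := Complex.volume_preserving_equiv_real_prod.symm
  have e : Complex.measurableEquivRealProd.symm ⁻¹' (Ioo a b ×ℂ Ioo c d) = Ioo a b ×ˢ Ioo c d := by
    ext ⟨x, y⟩; simp [Complex.mem_reProdIm, Complex.measurableEquivRealProd_symm_apply]
  rw [← hm.setLIntegral_comp_preimage_emb (MeasurableEquiv.measurableEmbedding _), e,
    Measure.volume_eq_prod, ← Measure.prod_restrict, lintegral_prod]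
  · refine setLIntegral_mono' measurableSet_Ioo fun x hx => ?_
    refine (ENNReal.ofReal_le_ofReal (hh x hx)).trans ?_
    have hc : Continuous fun y : ℝ => φ (x + y * Complex.I) :=
      hφ.comp_continuous (by fun_prop) fun y => by simpa using hx
    rw [intervalIntegral.integral_of_le hcd, ofReal_integral_eq_lintegral_ofReal
      (hc.integrableOn_Ioc) (ae_of_all _ fun y => hφ0 _), ← restrict_Ioo_eq_restrict_Ioc]
    refine le_of_eq (lintegral_congr fun y => ?_)
    rw [Complex.measurableEquivRealProd_symm_apply, Complex.mk_eq_add_mul_I]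
  · rw [Measure.prod_restrict]
    have hc : ContinuousOn (fun q : ℝ × ℝ => φ (Complex.measurableEquivRealProd.symm q))
        (Ioo a b ×ˢ Ioo c d) := by
      refine hφ.comp (Continuous.continuousOn ?_) ?_
      · exact Complex.equivRealProdCLM.symm.continuous
      · rintro ⟨x, y⟩ ⟨hx, hy⟩
        simpa [Complex.measurableEquivRealProd_symm_apply] using hx
    exact (hc.aemeasurable (measurableSet_Ioo.prod measurableSet_Ioo)).ennreal_ofReal

theorem area_inequality {u : ℂ → ℂ} (hu : DifferentiableOn ℂ u (ball 0 1)) (h0 : u 0 = 1)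
    (hinj : InjOn (fun z => z⁻¹ * u (z ^ 2)) (ball 0 1 \ {0})) {t m : ℝ} (ht : 0 < t)
    (ht2 : t < 1 / 2)
    (hm : ∀ z : ℂ, t ≤ ‖z‖ → ‖z‖ < 1 → ‖z⁻¹ * u (z ^ 2)‖ ≤ m) :
    (t ^ 2)⁻¹ - 4 + ‖deriv u 0‖ ^ 2 * (1 / 4 - t ^ 2) ≤ m ^ 2 := by
  set b := deriv u 0 with hb
  have hm0 : 0 ≤ m := (norm_nonneg _).trans (hm ((1 / 2 : ℝ) : ℂ) (by
    rw [Complex.norm_real]; norm_num; linarith) (by rw [Complex.norm_real]; norm_num))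
  have hudiff : ∀ w ∈ ball (0 : ℂ) 1, DifferentiableAt ℂ u w := fun w hw =>
    hu.differentiableAt (isOpen_ball.mem_nhds hw)
  have hu' : DifferentiableOn ℂ (deriv u) (ball 0 1) := hu.deriv isOpen_ball
  set p : ℂ → ℂ := fun w => -u w + 2 * w * deriv u w with hp
  have hpd : DifferentiableOn ℂ p (ball 0 1) :=
    hu.neg.add (((differentiableOn_const 2).mul differentiableOn_id).mul hu')
  have hp0 : p 0 = -1 := by simp [hp, h0]
  have hp' : deriv p 0 = b := by
    have h1 : HasDerivAt u b 0 := (hudiff 0 (mem_ball_self one_pos)).hasDerivAt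
    have h2 : HasDerivAt (deriv u) (deriv (deriv u) 0) 0 :=
      (hu'.differentiableAt (ball_mem_nhds 0 one_pos)).hasDerivAt
    have h3 := h1.neg.add (((hasDerivAt_id (0 : ℂ)).const_mul 2).mul h2)
    have : deriv p 0 = _ := h3.deriv
    rw [this]; simp; rw [← hb]; ring
  set la := Real.log t with hla
  set lb := Real.log (1 / 2) with hlb
  have hlab : la < lb := Real.log_lt_log ht ht2
  set S : Set ℂ := Ioo la lb ×ℂ Ioo (-Real.pi) Real.pi with hS
  have hSm : MeasurableSet S :=
    (Complex.measurable_re measurableSet_Ioo).inter (Complex.measurable_im measurableSet_Ioo)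
  have hexp : ∀ ω : ℂ, ω.re ∈ Ioo la lb → t ≤ ‖Complex.exp ω‖ ∧ ‖Complex.exp ω‖ < 1 := by
    intro ω hω
    rw [Complex.norm_exp]
    constructor
    · rw [← Real.log_le_iff_le_exp ht]; exact hω.1.le
    · rw [Real.exp_lt_one_iff]
      exact hω.2.trans (Real.log_neg (by norm_num) (by norm_num))
  have hexp2 : ∀ ω : ℂ, ω.re ∈ Ioo la lb → Complex.exp ω ^ 2 ∈ ball (0 : ℂ) 1 := by
    intro ω hω
    rw [mem_ball_zero_iff, norm_pow]
    exact pow_lt_one₀ (norm_nonneg _) (hexp ω hω).2 two_ne_zero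
  set F : ℂ → ℂ := fun ω => (Complex.exp ω)⁻¹ * u (Complex.exp ω ^ 2) with hF
  set F' : ℂ → ℂ := fun ω => (Complex.exp ω)⁻¹ * p (Complex.exp ω ^ 2) with hF'
  have hderiv : ∀ ω ∈ S, HasDerivAt F (F' ω) ω := by
    intro ω hω
    have h1 : HasDerivAt (fun ω => (Complex.exp ω)⁻¹) (-(Complex.exp ω)⁻¹) ω := by
      refine ((Complex.hasDerivAt_exp ω).inv (Complex.exp_ne_zero ω)).congr_deriv ?_
      have := Complex.exp_ne_zero ω
      field_simp
    have h2 := (hudiff _ (hexp2 ω hω.1)).hasDerivAt.comp ω ((Complex.hasDerivAt_exp ω).pow 2)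
    refine (h1.mul h2).congr_deriv ?_
    have := Complex.exp_ne_zero ω
    simp only [hF', hp, Function.comp, Pi.pow_apply]
    field_simp
    push_cast
    ring
  have hFinj : InjOn F S := by
    intro ω₁ h₁ ω₂ h₂ h
    have : Complex.exp ω₁ = Complex.exp ω₂ :=
      hinj ⟨by simpa using (hexp _ h₁.1).2, Complex.exp_ne_zero _⟩
        ⟨by simpa using (hexp _ h₂.1).2, Complex.exp_ne_zero _⟩ h
    exact Complex.exp_inj_of_neg_pi_lt_of_le_pi h₁.2.1 h₁.2.2.le h₂.2.1 h₂.2.2.le this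
  have hvol := volume_image_eq_lintegral_norm_deriv_sq hSm hderiv hFinj
  have hsub : F '' S ⊆ closedBall 0 m := by
    rintro _ ⟨ω, hω, rfl⟩
    rw [mem_closedBall_zero_iff]
    exact hm _ (hexp ω hω.1).1 (hexp ω hω.1).2
  have hub : ∫⁻ ω in S, ENNReal.ofReal (‖F' ω‖ ^ 2) ≤ ENNReal.ofReal (Real.pi * m ^ 2) := by
    rw [← hvol]
    refine (measure_mono hsub).trans (le_of_eq ?_)
    rw [Complex.volume_closedBall, ENNReal.ofReal_mul Real.pi_pos.le, ENNReal.ofReal_pow hm0,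
      mul_comm]
    congr 1
    rw [← NNReal.coe_real_pi, ENNReal.ofReal_coe_nnreal]
  have hcont : ContinuousOn (fun ω => ‖F' ω‖ ^ 2) {z | z.re ∈ Ioo la lb} := by
    have : ContinuousOn (fun ω => p (Complex.exp ω ^ 2)) {z | z.re ∈ Ioo la lb} :=
      hpd.continuousOn.comp (by fun_prop) hexp2
    have h1 : Continuous fun ω => (Complex.exp ω)⁻¹ :=
      Complex.continuous_exp.inv₀ Complex.exp_ne_zero
    exact ((h1.continuousOn.mul this).norm).pow 2
  set h : ℝ → ℝ := fun x =>
    2 * Real.pi * (Real.exp (-2 * x) + ‖b‖ ^ 2 * Real.exp (2 * x)) with hh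
  have hlow := setLIntegral_reProdIm_ge (a := la) (b := lb) (c := -Real.pi) (d := Real.pi)
    (by linarith [Real.pi_pos]) hcont (fun _ => by positivity) (h := h) (by
      intro x hx
      have hx1 : Real.exp x < 1 := by
        rw [Real.exp_lt_one_iff]
        exact hx.2.trans (Real.log_neg (by norm_num) (by norm_num))
      have key := two_pi_mul_le_integral_norm_sq hpd hp0 (Real.exp_pos x) hx1
      have e1 : ∀ y : ℝ, ‖F' (x + y * Complex.I)‖ ^ 2
          = Real.exp (-2 * x) * ‖p (circleMap 0 (Real.exp x) y ^ 2)‖ ^ 2 := by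
        intro y
        have : Complex.exp (x + y * Complex.I) = circleMap 0 (Real.exp x) y := by
          rw [Complex.exp_add, circleMap, zero_add, Complex.ofReal_exp]
        simp only [hF', this, norm_mul, norm_inv, mul_pow]
        congr 1
        rw [norm_circleMap_zero, abs_of_pos (Real.exp_pos x), inv_pow, ← Real.exp_nat_mul,
          ← Real.exp_neg]
        congr 1; push_cast; ring
      simp_rw [e1]
      rw [intervalIntegral.integral_const_mul]
      refine le_trans (le_of_eq ?_) (mul_le_mul_of_nonneg_left key (Real.exp_pos _).le)
      rw [hp', ← Real.exp_nat_mul]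
      have : Real.exp (2 * x) = Real.exp (-2 * x) * Real.exp ((4 : ℕ) * x) := by
        rw [← Real.exp_add]; congr 1; push_cast; ring
      simp only [hh]
      rw [this]; ring)
  have hinteg : ∫ x in la..lb, h x
      = Real.pi * ((t ^ 2)⁻¹ - 4 + ‖b‖ ^ 2 * (1 / 4 - t ^ 2)) := by
    have hd : ∀ x ∈ uIcc la lb, HasDerivAt
        (fun x => Real.pi * (- Real.exp (-2 * x) + ‖b‖ ^ 2 * Real.exp (2 * x))) (h x) x := by
      intro x _
      have h1 := ((hasDerivAt_id x).const_mul (-2)).exp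
      have h2 := ((hasDerivAt_id x).const_mul 2).exp
      refine ((h1.neg.add (h2.const_mul (‖b‖ ^ 2))).const_mul Real.pi).congr_deriv ?_
      simp only [hh, id, mul_one]
      ring
    rw [intervalIntegral.integral_eq_sub_of_hasDerivAt hd
      ((by fun_prop : Continuous h).intervalIntegrable _ _)]
    have ea : ∀ s : ℝ, 0 < s → Real.exp (2 * Real.log s) = s ^ 2 := fun s hs => by
      rw [mul_comm, Real.exp_mul, Real.exp_log hs]; norm_num
    have eb : ∀ s : ℝ, 0 < s → Real.exp (-2 * Real.log s) = (s ^ 2)⁻¹ := fun s hs => by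
      rw [← ea s hs, ← Real.exp_neg]; congr 1; ring
    rw [hla, hlb, ea t ht, ea _ (by norm_num), eb t ht, eb _ (by norm_num)]
    norm_num
    ring
  have hfin : ENNReal.ofReal (∫ x in la..lb, h x) ≤ ENNReal.ofReal (Real.pi * m ^ 2) := by
    refine le_trans (le_of_eq ?_) (hlow.trans hub)
    rw [intervalIntegral.integral_of_le hlab.le, ofReal_integral_eq_lintegral_ofReal
      (by fun_prop : Continuous h).integrableOn_Ioc (ae_of_all _ fun y => by positivity),
      restrict_Ioo_eq_restrict_Ioc]
  rw [ENNReal.ofReal_le_ofReal_iff (by positivity), hinteg] at hfin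
  exact le_of_mul_le_mul_left hfin Real.pi_pos

theorem isOpen_image_of_injOn {g : ℂ → ℂ} {U V : Set ℂ} (hU : IsOpen U) (hUc : IsPreconnected U)
    (hg : DifferentiableOn ℂ g U) (hinj : InjOn g U) (hV : IsOpen V) (hVU : V ⊆ U) :
    IsOpen (g '' V) := by
  rcases (hg.analyticOnNhd hU).is_constant_or_isOpen hUc with ⟨w, hw⟩ | h
  · have : V = ∅ := by
      by_contra hne
      obtain ⟨x, hx⟩ := nonempty_iff_ne_empty.2 hne
      have hn : (𝓝[≠] x).NeBot := inferInstance
      have h1 : ∀ᶠ y in 𝓝[≠] x, y ∈ V := nhdsWithin_le_nhds (hV.mem_nhds hx)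
      obtain ⟨y, hy, hyx⟩ := (h1.and self_mem_nhdsWithin).exists
      exact hyx (hinj (hVU hy) (hVU hx) ((hw y (hVU hy)).trans (hw x (hVU hx)).symm))
    simp [this]
  · exact h V hVU hV

theorem le_norm_of_le_norm_sphere {h : ℂ → ℂ} (hd : DifferentiableOn ℂ h (ball 0 1))
    (hinj : InjOn h (ball 0 1)) (h0 : h 0 = 0) {t μ : ℝ} (ht : 0 < t) (ht1 : t < 1) 
    (hμ : ∀ z : ℂ, ‖z‖ = t → μ ≤ ‖h z‖) {z : ℂ} (hz : t ≤ ‖z‖) (hz1 : ‖z‖ < 1) : μ ≤ ‖h z‖ := by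
  rcases le_or_gt μ 0 with hμ0 | hμ0
  · exact hμ0.trans (norm_nonneg _)
  by_contra! hlt
  have hO : IsOpen (h '' ball 0 t) := isOpen_image_of_injOn isOpen_ball
    (convex_ball 0 1).isPreconnected hd hinj isOpen_ball (ball_subset_ball ht1.le)
  have hK : IsCompact (h '' closedBall 0 t) :=
    (isCompact_closedBall 0 t).image_of_continuousOn
      (hd.continuousOn.mono (closedBall_subset_ball ht1))
  have hsub : ball 0 μ ⊆ h '' ball 0 t := by
    refine (convex_ball (0 : ℂ) μ).isPreconnected.subset_left_of_subset_union hO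
      hK.isClosed.isOpen_compl ?_ ?_ ⟨0, mem_ball_self hμ0, 0, mem_ball_self ht, h0⟩
    · rw [disjoint_compl_right_iff_subset]
      exact image_mono ball_subset_closedBall
    · intro w hw
      by_cases hw' : w ∈ h '' closedBall 0 t
      · obtain ⟨x, hx, rfl⟩ := hw'
        refine Or.inl ⟨x, ?_, rfl⟩
        rw [mem_closedBall_zero_iff] at hx
        rcases hx.lt_or_eq with hx | hx
        · exact mem_ball_zero_iff.2 hx
        · exact absurd (hμ x hx) (not_le.2 (mem_ball_zero_iff.1 hw))
      · exact Or.inr hw'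
  obtain ⟨x, hx, hxz⟩ := hsub (mem_ball_zero_iff.2 hlt)
  have := hinj (ball_subset_ball ht1.le hx) (mem_ball_zero_iff.2 hz1) hxz
  rw [mem_ball_zero_iff, this] at hx
  linarith

theorem norm_deriv_le_eleven {u : ℂ → ℂ} (hu : DifferentiableOn ℂ u (ball 0 1)) (h0 : u 0 = 1)
    (hne : ∀ z ∈ ball (0 : ℂ) 1, u z ≠ 0)
    (hinj : InjOn (fun z => z⁻¹ * u (z ^ 2)) (ball 0 1 \ {0})) : ‖deriv u 0‖ ≤ 11 := by
  set b := deriv u 0 with hb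
  have hd : HasDerivAt u b 0 := (hu.differentiableAt (ball_mem_nhds 0 one_pos)).hasDerivAt
  have hev := hd.isLittleO.def one_pos
  obtain ⟨δ, hδ, hδ'⟩ := Metric.eventually_nhds_iff_ball.1 hev
  set B := ‖b‖ with hB
  have hB0 : 0 ≤ B := norm_nonneg _
  obtain ⟨t, ht0, ht1, ht2, ht3⟩ : ∃ t : ℝ, 0 < t ∧ t < 1 / 2 ∧ t < δ ∧
      t * ((B + 1) ^ 2 + B ^ 2) ≤ 1 := by
    have hc : 0 < (B + 1) ^ 2 + B ^ 2 := by positivity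
    refine ⟨min (1 / 4) (min (δ / 2) (((B + 1) ^ 2 + B ^ 2)⁻¹)), by positivity, ?_, ?_, ?_⟩
    · exact (min_le_left _ _).trans_lt (by norm_num)
    · exact ((min_le_right _ _).trans (min_le_left _ _)).trans_lt (by linarith)
    · rw [← le_div_iff₀ hc]
      simpa only [one_div] using (min_le_right _ _).trans (min_le_right _ _)
  have hsq : ∀ z : ℂ, z ∈ ball (0 : ℂ) 1 → z ^ 2 ∈ ball (0 : ℂ) 1 := by
    intro z hz
    simp only [mem_ball_zero_iff, norm_pow] at hz ⊢
    exact pow_lt_one₀ (norm_nonneg _) hz two_ne_zero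
  set h : ℂ → ℂ := fun z => z / u (z ^ 2) with hh
  have hhd : DifferentiableOn ℂ h (ball 0 1) :=
    differentiableOn_id.div (hu.comp (by fun_prop) hsq) fun z hz => hne _ (hsq z hz)
  have hFh : ∀ z, z⁻¹ * u (z ^ 2) = (h z)⁻¹ := fun z => by
    simp only [hh, inv_div]; rw [div_eq_mul_inv, mul_comm]
  have hhi : InjOn h (ball 0 1) := by
    intro z hz w hw hzw
    by_cases hz0 : z = 0
    · subst hz0
      have : w / u (w ^ 2) = 0 := by rw [← show h w = w / u (w ^ 2) from rfl, ← hzw]; simp [hh]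
      rcases div_eq_zero_iff.1 this with h | h
      · exact h.symm
      · exact absurd h (hne _ (hsq w hw))
    by_cases hw0 : w = 0
    · subst hw0
      have : z / u (z ^ 2) = 0 := by rw [← show h z = z / u (z ^ 2) from rfl, hzw]; simp [hh]
      rcases div_eq_zero_iff.1 this with h | h
      · exact h
      · exact absurd h (hne _ (hsq z hz))
    exact hinj ⟨hz, hz0⟩ ⟨hw, hw0⟩ (by simp only [hFh, hzw])
  set m := t⁻¹ * (1 + (B + 1) * t ^ 2) with hm
  have hm0 : 0 < m := by positivity
  have hb1 : ∀ z : ℂ, ‖z‖ = t → ‖z⁻¹ * u (z ^ 2)‖ ≤ m := by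
    intro z hz
    have hz2 : ‖z ^ 2‖ = t ^ 2 := by rw [norm_pow, hz]
    have h1 := hδ' (z ^ 2) (by rw [mem_ball_zero_iff, hz2]; nlinarith)
    simp only [sub_zero, h0, smul_eq_mul, one_mul, hz2] at h1
    rw [norm_mul, norm_inv, hz]
    refine mul_le_mul_of_nonneg_left ?_ (inv_nonneg.2 ht0.le)
    have : u (z ^ 2) = (u (z ^ 2) - 1 - z ^ 2 * b) + 1 + z ^ 2 * b := by ring
    rw [this]
    refine (norm_add₃_le).trans ?_
    rw [norm_mul, hz2, norm_one]
    linarith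
  have hb2 : ∀ z : ℂ, t ≤ ‖z‖ → ‖z‖ < 1 → ‖z⁻¹ * u (z ^ 2)‖ ≤ m := by
    intro z hz hz1
    have := le_norm_of_le_norm_sphere hhd hhi (by simp [hh]) ht0 (by linarith) (μ := m⁻¹)
      (fun w hw => by
        have h1 := hb1 w hw
        rw [hFh, norm_inv] at h1
        have h2 : 0 < ‖h w‖ := by
          refine norm_pos_iff.2 (div_ne_zero ?_ (hne _ (hsq w ?_)))
          · rintro rfl; simp at hw; linarith
          · rw [mem_ball_zero_iff, hw]; linarith
        exact inv_le_of_inv_le₀ h2 h1) hz hz1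
    rw [hFh, norm_inv]
    exact inv_le_of_inv_le₀ hm0 this
  have key := area_inequality hu h0 hinj ht0 ht1 hb2
  rw [← hb, ← hB] at key
  have e : m ^ 2 = (t ^ 2)⁻¹ + 2 * (B + 1) + (B + 1) ^ 2 * t ^ 2 := by
    rw [hm]; field_simp; ring
  rw [e] at key
  have : t ^ 2 * ((B + 1) ^ 2 + B ^ 2) ≤ 1 := by nlinarith
  by_contra! hlt
  nlinarith

theorem norm_deriv_dslope_le {g : ℂ → ℂ} (hg : DifferentiableOn ℂ g (ball 0 1))
    (hinj : InjOn g (ball 0 1)) (h0 : g 0 = 0) (h1 : deriv g 0 = 1) :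
    ‖deriv (dslope g 0) 0‖ ≤ 22 := by
  set q := dslope g 0 with hq
  have h0m : (0 : ℂ) ∈ ball (0 : ℂ) 1 := mem_ball_self one_pos
  have hqd : DifferentiableOn ℂ q (ball 0 1) :=
    (Complex.differentiableOn_dslope (ball_mem_nhds 0 one_pos)).2 hg
  have hq0 : q 0 = 1 := by rw [hq, dslope_same, h1]
  have hgq : ∀ z, z * q z = g z := fun z => by
    have := sub_smul_dslope g 0 z
    simpa [h0] using this
  have hqne : ∀ z ∈ ball (0 : ℂ) 1, q z ≠ 0 := by
    intro z hz h
    by_cases hz0 : z = 0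
    · subst hz0; rw [hq0] at h; exact one_ne_zero h
    · have : g z = g 0 := by rw [← hgq z, h, h0, mul_zero]
      exact hz0 (hinj hz h0m this)
  obtain ⟨l, hld, hl⟩ := (convex_ball (0 : ℂ) 1).exists_differentiableOn_exp_eq isOpen_ball
    ⟨0, h0m⟩ hqd hqne
  set u : ℂ → ℂ := fun z => Complex.exp (-(l z - l 0) / 2) with hu
  have hud : DifferentiableOn ℂ u (ball 0 1) := ((hld.sub_const _).neg.div_const _).cexp
  have hu0 : u 0 = 1 := by simp [hu]
  have huq : ∀ z ∈ ball (0 : ℂ) 1, u z ^ 2 * q z = 1 := by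
    intro z hz
    have e0 : Complex.exp (l 0) = 1 := (hl 0 h0m).trans hq0
    rw [← hl z hz, hu, ← Complex.exp_nat_mul, ← Complex.exp_add, ← e0]
    congr 1; push_cast; ring
  have hsq : ∀ z : ℂ, z ∈ ball (0 : ℂ) 1 → z ^ 2 ∈ ball (0 : ℂ) 1 := by
    intro z hz
    simp only [mem_ball_zero_iff, norm_pow] at hz ⊢
    exact pow_lt_one₀ (norm_nonneg _) hz two_ne_zero
  have hb := norm_deriv_le_eleven hud hu0 (fun z _ => Complex.exp_ne_zero _) (by
    rintro z ⟨hz, hz0⟩ w ⟨hw, hw0⟩ (hzw : z⁻¹ * u (z ^ 2) = w⁻¹ * u (w ^ 2))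
    replace hz0 : z ≠ 0 := hz0
    replace hw0 : w ≠ 0 := hw0
    have e1 := huq _ (hsq z hz)
    have e2 := huq _ (hsq w hw)
    have key : ∀ y : ℂ, y ≠ 0 → u (y ^ 2) ^ 2 * q (y ^ 2) = 1 →
        (y⁻¹ * u (y ^ 2)) ^ 2 = (g (y ^ 2))⁻¹ := by
      intro y hy he
      have hq' : q (y ^ 2) ≠ 0 := by rintro h; rw [h, mul_zero] at he; exact zero_ne_one he
      rw [← hgq (y ^ 2)]
      field_simp
      linear_combination he
    have e3 : g (z ^ 2) = g (w ^ 2) := by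
      rw [← inv_inj, ← key z hz0 e1, ← key w hw0 e2, hzw]
    have e4 := hinj (hsq z hz) (hsq w hw) e3
    rcases sq_eq_sq_iff_eq_or_eq_neg.1 e4 with h | h
    · exact h
    · exfalso
      subst h
      have hne : w⁻¹ * u (w ^ 2) ≠ 0 := mul_ne_zero (inv_ne_zero hw0) (Complex.exp_ne_zero _)
      apply hne
      rw [neg_sq, inv_neg] at hzw
      linear_combination (-1 / 2) * hzw)
  have hd1 : HasDerivAt u (deriv u 0) 0 :=
    (hud.differentiableAt (ball_mem_nhds 0 one_pos)).hasDerivAt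
  have hd2 : HasDerivAt q (deriv q 0) 0 :=
    (hqd.differentiableAt (ball_mem_nhds 0 one_pos)).hasDerivAt
  have hd3 : HasDerivAt (fun _ : ℂ => (1 : ℂ)) _ 0 := ((hd1.pow 2).mul hd2).congr_of_eventuallyEq
    (eventually_of_mem (ball_mem_nhds 0 one_pos) fun z hz => (huq z hz).symm)
  have e := hd3.unique (hasDerivAt_const 0 1)
  simp [hu0, hq0] at e
  have : deriv q 0 = -(2 * deriv u 0) := by linear_combination e
  rw [this, norm_neg, norm_mul]
  simp
  linarith

/-- A normalized injective function omits no value of small modulus. -/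
theorem ball_subset_image_of_normalized {g : ℂ → ℂ} (hg : DifferentiableOn ℂ g (ball 0 1))
    (hinj : InjOn g (ball 0 1)) (h0 : g 0 = 0) (h1 : deriv g 0 = 1) :
    ball 0 (1 / 44) ⊆ g '' ball 0 1 := by
  intro ω hω
  by_contra hno
  have h0m : (0 : ℂ) ∈ ball (0 : ℂ) 1 := mem_ball_self one_pos
  have hω0 : ω ≠ 0 := by rintro rfl; exact hno ⟨0, h0m, h0⟩
  have hne : ∀ z ∈ ball (0 : ℂ) 1, ω - g z ≠ 0 := fun z hz h =>
    hno ⟨z, hz, (sub_eq_zero.1 h).symm⟩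
  set k : ℂ → ℂ := fun z => ω / (ω - g z) with hk
  set g₂ : ℂ → ℂ := fun z => g z * k z with hg₂
  have hkd : DifferentiableOn ℂ k (ball 0 1) :=
    (differentiableOn_const ω).div ((differentiableOn_const ω).sub hg) hne
  have hd : HasDerivAt g 1 0 := by
    rw [← h1]; exact (hg.differentiableAt (ball_mem_nhds 0 one_pos)).hasDerivAt
  have hk0 : k 0 = 1 := by simp [hk, h0, hω0]
  have hk' : HasDerivAt k (1 / ω) 0 := by
    refine ((hasDerivAt_const 0 ω).div (hd.const_sub ω) (hne 0 h0m)).congr_deriv ?_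
    simp only [h0]; field_simp; ring
  have hdg₂ : HasDerivAt g₂ 1 0 := (hd.mul hk').congr_deriv (by simp [h0, hk0])
  have hinj₂ : InjOn g₂ (ball 0 1) := by
    intro z hz w hw h
    refine hinj hz hw ?_
    simp only [hg₂, hk] at h
    have := hne z hz
    have := hne w hw
    field_simp at h
    have : ω * (g z - g w) = 0 := by linear_combination h
    exact sub_eq_zero.1 ((mul_eq_zero.1 this).resolve_left hω0)
  have b1 := norm_deriv_dslope_le hg hinj h0 h1
  have b2 := norm_deriv_dslope_le (hg.mul hkd) hinj₂ (by simp [h0]) hdg₂.deriv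
  have hqd : HasDerivAt (dslope g 0) (deriv (dslope g 0) 0) 0 :=
    (((Complex.differentiableOn_dslope (ball_mem_nhds 0 one_pos)).2 hg).differentiableAt
      (ball_mem_nhds 0 one_pos)).hasDerivAt
  have e : dslope g₂ 0 = fun z => dslope g 0 z * k z := by
    funext z
    by_cases hz : z = 0
    · subst hz; rw [dslope_same, dslope_same, hdg₂.deriv, h1, hk0, one_mul]
    · rw [dslope_of_ne _ hz, dslope_of_ne _ hz, slope_def_field, slope_def_field]
      simp only [hg₂, h0]; ring
  have e2 : deriv (dslope g₂ 0) 0 = deriv (dslope g 0) 0 + 1 / ω := by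
    rw [e]
    refine (hqd.mul hk').deriv.trans ?_
    rw [hk0, dslope_same, h1]; ring
  have b3 : ‖1 / ω‖ ≤ 44 := by
    have : 1 / ω = deriv (dslope g₂ 0) 0 - deriv (dslope g 0) 0 := by rw [e2]; ring
    rw [this]
    exact (norm_sub_le _ _).trans (by
      have : ‖deriv (dslope g₂ 0) 0‖ ≤ 22 := b2
      linarith)
  rw [norm_div, norm_one, div_le_iff₀ (norm_pos_iff.2 hω0)] at b3
  rw [mem_ball_zero_iff] at hω
  linarith

section Normalize
variable {g : ℂ → ℂ} {c : ℂ} {r : ℝ}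

theorem normalize_univalent (hr : 0 < r) (hg : DifferentiableOn ℂ g (ball c r))
    (hinj : InjOn g (ball c r)) (h1 : deriv g c ≠ 0) :
    DifferentiableOn ℂ (fun z => (g (c + r * z) - g c) / (r * deriv g c)) (ball 0 1) ∧
    InjOn (fun z => (g (c + r * z) - g c) / (r * deriv g c)) (ball 0 1) ∧
    deriv (fun z => (g (c + r * z) - g c) / (r * deriv g c)) 0 = 1 := by
  have hr' : (r : ℂ) ≠ 0 := by exact_mod_cast hr.ne'
  have hmaps : ∀ z ∈ ball (0 : ℂ) 1, c + r * z ∈ ball c r := by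
    intro z hz
    rw [mem_ball_zero_iff] at hz
    rw [mem_ball_iff_norm, add_sub_cancel_left, norm_mul, Complex.norm_real, Real.norm_eq_abs,
      abs_of_pos hr]
    nlinarith
  refine ⟨?_, ?_, ?_⟩
  · exact ((hg.comp (by fun_prop) hmaps).sub_const _).div_const _
  · intro z hz w hw h
    have hne : (r : ℂ) * deriv g c ≠ 0 := mul_ne_zero hr' h1
    have h2 : g (c + r * z) = g (c + r * w) := by
      exact sub_left_injective ((div_left_inj' hne).1 h)
    have := hinj (hmaps z hz) (hmaps w hw) h2
    exact mul_left_cancel₀ hr' (add_left_cancel this)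
  · have hd : HasDerivAt g (deriv g c) (c + r * 0) := by
      rw [mul_zero, add_zero]
      exact (hg.differentiableAt (ball_mem_nhds c hr)).hasDerivAt
    have hl : HasDerivAt (fun z : ℂ => c + r * z) (r : ℂ) 0 := by
      simpa using ((hasDerivAt_id (0 : ℂ)).const_mul (r : ℂ)).const_add c
    have := ((hd.comp (0 : ℂ) hl).sub_const (g c)).div_const (r * deriv g c)
    refine HasDerivAt.deriv (this.congr_deriv ?_)
    field_simp

theorem ball_subset_image_of_injOn (hr : 0 < r) (hg : DifferentiableOn ℂ g (ball c r))
    (hinj : InjOn g (ball c r)) :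
    ball (g c) (r * ‖deriv g c‖ / 44) ⊆ g '' ball c r := by
  by_cases h1 : deriv g c = 0
  · simp [h1]
  obtain ⟨h2, h3, h4⟩ := normalize_univalent hr hg hinj h1
  have key := ball_subset_image_of_normalized h2 h3 (by simp) h4
  have hr' : (r : ℂ) ≠ 0 := by exact_mod_cast hr.ne'
  have hne : (r : ℂ) * deriv g c ≠ 0 := mul_ne_zero hr' h1
  intro w hw
  obtain ⟨z, hz, hzw⟩ := key (a := (w - g c) / (r * deriv g c)) (by
    rw [mem_ball_zero_iff, norm_div, norm_mul, Complex.norm_real, Real.norm_eq_abs, abs_of_pos hr,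
      div_lt_iff₀ (mul_pos hr (norm_pos_iff.2 h1))]
    rw [mem_ball_iff_norm] at hw
    linarith)
  refine ⟨c + r * z, ?_, ?_⟩
  · rw [mem_ball_zero_iff] at hz
    rw [mem_ball_iff_norm, add_sub_cancel_left, norm_mul, Complex.norm_real, Real.norm_eq_abs,
      abs_of_pos hr]
    nlinarith
  · exact sub_left_injective ((div_left_inj' hne).1 hzw)

theorem norm_deriv_deriv_le (hr : 0 < r) (hg : DifferentiableOn ℂ g (ball c r))
    (hinj : InjOn g (ball c r)) (h1 : deriv g c ≠ 0) :
    ‖deriv (deriv g) c‖ ≤ 44 / r * ‖deriv g c‖ := by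
  obtain ⟨h2, h3, h4⟩ := normalize_univalent hr hg hinj h1
  have key := norm_deriv_dslope_le h2 h3 (by simp) h4
  have hr' : (r : ℂ) ≠ 0 := by exact_mod_cast hr.ne'
  set k : ℂ → ℂ := fun z => (g (c + r * z) - g c) / (r * deriv g c) with hk
  set q := dslope k 0 with hq
  have hqd : DifferentiableOn ℂ q (ball 0 1) :=
    (Complex.differentiableOn_dslope (ball_mem_nhds 0 one_pos)).2 h2
  have hq1 : HasDerivAt q (deriv q 0) 0 :=
    (hqd.differentiableAt (ball_mem_nhds 0 one_pos)).hasDerivAt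
  have hq2 : HasDerivAt (deriv q) (deriv (deriv q) 0) 0 :=
    ((hqd.deriv isOpen_ball).differentiableAt (ball_mem_nhds 0 one_pos)).hasDerivAt
  have hkq : k = fun z => z * q z := by
    funext z
    have := sub_smul_dslope k 0 z
    simpa [hk] using this.symm
  have hk1 : ∀ z ∈ ball (0 : ℂ) 1, deriv k z = q z + z * deriv q z := by
    intro z hz
    have : HasDerivAt q (deriv q z) z :=
      (hqd.differentiableAt (isOpen_ball.mem_nhds hz)).hasDerivAt
    rw [hkq]
    refine ((hasDerivAt_id z).mul this).deriv.trans ?_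
    simp
  have e1 : deriv (deriv k) 0 = 2 * deriv q 0 := by
    have : deriv k =ᶠ[𝓝 0] fun z => q z + z * deriv q z :=
      eventually_of_mem (ball_mem_nhds 0 one_pos) hk1
    rw [this.deriv_eq]
    refine (hq1.add ((hasDerivAt_id 0).mul hq2)).deriv.trans ?_
    simp; ring
  have hmaps : ∀ z ∈ ball (0 : ℂ) 1, c + r * z ∈ ball c r := by
    intro z hz
    rw [mem_ball_zero_iff] at hz
    rw [mem_ball_iff_norm, add_sub_cancel_left, norm_mul, Complex.norm_real, Real.norm_eq_abs,
      abs_of_pos hr]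
    nlinarith
  have hl : ∀ z, HasDerivAt (fun z : ℂ => c + r * z) (r : ℂ) z := fun z => by
    simpa using ((hasDerivAt_id z).const_mul (r : ℂ)).const_add c
  have hk2 : ∀ z ∈ ball (0 : ℂ) 1, deriv k z = deriv g (c + r * z) / deriv g c := by
    intro z hz
    have : HasDerivAt g (deriv g (c + r * z)) (c + r * z) :=
      (hg.differentiableAt (isOpen_ball.mem_nhds (hmaps z hz))).hasDerivAt
    refine (((this.comp z (hl z)).sub_const (g c)).div_const (r * deriv g c)).deriv.trans ?_
    field_simp
  have e2 : deriv (deriv k) 0 = r * deriv (deriv g) c / deriv g c := by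
    have : deriv k =ᶠ[𝓝 0] fun z => deriv g (c + r * z) / deriv g c :=
      eventually_of_mem (ball_mem_nhds 0 one_pos) hk2
    rw [this.deriv_eq]
    have hd : HasDerivAt (deriv g) (deriv (deriv g) c) (c + r * 0) := by
      rw [mul_zero, add_zero]
      exact ((hg.deriv isOpen_ball).differentiableAt (ball_mem_nhds c hr)).hasDerivAt
    refine ((hd.comp (0 : ℂ) (hl 0)).div_const (deriv g c)).deriv.trans ?_
    ring
  have e3 : deriv (deriv g) c = 2 * deriv q 0 * deriv g c / r := by
    rw [← e1, e2]; field_simp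
  rw [e3, norm_div, norm_mul, norm_mul, Complex.norm_real, Real.norm_eq_abs, abs_of_pos hr,
    div_mul_eq_mul_div]
  gcongr
  simp
  linarith

end Normalize

theorem koebe_distortion {g : ℂ → ℂ} {c : ℂ} {r η : ℝ} (hr : 0 < r) (hη : 0 < η) (hη1 : η < 1)
    (hg : DifferentiableOn ℂ g (ball c r)) (hinj : InjOn g (ball c r))
    (hne : ∀ z ∈ ball c r, deriv g z ≠ 0) {z : ℂ} (hz : z ∈ ball c ((1 - η) * r)) :
    ‖deriv g z‖ ≤ Real.exp (44 / η) * ‖deriv g c‖ ∧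
      ‖deriv g c‖ ≤ Real.exp (44 / η) * ‖deriv g z‖ := by
  have hcm : c ∈ ball c r := mem_ball_self hr
  have hd' : DifferentiableOn ℂ (deriv g) (ball c r) := hg.deriv isOpen_ball
  obtain ⟨l, hld, hl⟩ := (convex_ball c r).exists_differentiableOn_exp_eq isOpen_ball
    ⟨c, hcm⟩ hd' hne
  have hs : ball c ((1 - η) * r) ⊆ ball c r := ball_subset_ball (by nlinarith)
  have hb : ∀ w ∈ ball c ((1 - η) * r), ‖deriv l w‖ ≤ 44 / (η * r) := by
    intro w hw
    have hsub : ball w (η * r) ⊆ ball c r := by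
      refine ball_subset_ball' ?_
      rw [mem_ball] at hw
      linarith
    have h1 := norm_deriv_deriv_le (mul_pos hη hr) (hg.mono hsub) (hinj.mono hsub) (hne w (hs hw))
    have h2 : HasDerivAt (fun z => Complex.exp (l z)) (Complex.exp (l w) * deriv l w) w :=
      (hld.differentiableAt (isOpen_ball.mem_nhds (hs hw))).hasDerivAt.cexp
    have h3 : deriv (deriv g) w = deriv g w * deriv l w := by
      rw [← hl w (hs hw), ← h2.deriv]
      refine Filter.EventuallyEq.deriv_eq ?_
      exact eventually_of_mem (isOpen_ball.mem_nhds (hs hw)) fun y hy => (hl y hy).symm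
    rw [h3, norm_mul, mul_comm] at h1
    exact le_of_mul_le_mul_right h1 (norm_pos_iff.2 (hne w (hs hw)))
  have hc : c ∈ ball c ((1 - η) * r) := mem_ball_self (mul_pos (by linarith) hr)
  have hmv := (convex_ball c ((1 - η) * r)).norm_image_sub_le_of_norm_deriv_le
    (fun w hw => hld.differentiableAt (isOpen_ball.mem_nhds (hs hw))) hb hc hz
  have hle : ‖l z - l c‖ ≤ 44 / η := by
    refine hmv.trans ?_
    rw [mem_ball_iff_norm] at hz
    calc 44 / (η * r) * ‖z - c‖ ≤ 44 / (η * r) * r := by gcongr; nlinarith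
      _ = 44 / η := by field_simp
  have hre : |(l z).re - (l c).re| ≤ 44 / η := by
    rw [← Complex.sub_re]; exact (Complex.abs_re_le_norm _).trans hle
  rw [abs_le] at hre
  rw [← hl z (hs hz), ← hl c hcm, Complex.norm_exp, Complex.norm_exp, ← Real.exp_add,
    ← Real.exp_add, Real.exp_le_exp, Real.exp_le_exp]
  constructor <;> linarith

section PathLifting

variable {E X : Type*} [TopologicalSpace E] [TopologicalSpace X] {p : E → X} {γ : ℝ → X}

theorem IsLocalHomeomorph.extend_lift (hγ : Continuous γ) {Γ : ℝ → E}
    {s t : ℝ} (hs : 0 ≤ s) (hst : s ≤ t) (hΓc : ContinuousOn Γ (Icc 0 s))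
    (hΓ : ∀ x ∈ Icc 0 s, p (Γ x) = γ x) (ψ : OpenPartialHomeomorph E X)
    (hψ : p = ψ) (h1 : Γ s ∈ ψ.source) (h2 : ∀ x ∈ Icc s t, γ x ∈ ψ.target) :
    ∃ Γ' : ℝ → E, ContinuousOn Γ' (Icc 0 t) ∧ Γ' 0 = Γ 0 ∧ ∀ x ∈ Icc 0 t, p (Γ' x) = γ x := by
  have hagree : ψ.symm (γ s) = Γ s := by
    rw [← hΓ s ⟨hs, le_rfl⟩, hψ, ψ.left_inv h1]
  have hc2 : ContinuousOn (fun x => ψ.symm (γ x)) (Icc s t) :=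
    ψ.continuousOn_symm.comp hγ.continuousOn h2
  refine ⟨fun x => if x ≤ s then Γ x else ψ.symm (γ x), ?_, by simp [hs], ?_⟩
  · rw [← Icc_union_Icc_eq_Icc hs hst]
    refine ContinuousOn.union_of_isClosed ?_ ?_ isClosed_Icc isClosed_Icc
    · exact hΓc.congr fun x hx => by simp [hx.2]
    · refine hc2.congr fun x hx => ?_
      rcases hx.1.eq_or_lt with h | h
      · subst h; simp [hagree]
      · simp [not_le.2 h]
  · intro x hx
    by_cases hxs : x ≤ s
    · simp only [hxs, if_true]; exact hΓ x ⟨hx.1, hxs⟩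
    · simp only [hxs, if_false]
      rw [hψ]; exact ψ.right_inv (h2 x ⟨(not_le.1 hxs).le, hx.2⟩)

theorem IsLocalHomeomorph.exists_lift_Icc [T2Space E] [T2Space X] (hp : IsLocalHomeomorph p)
    (hγ : Continuous γ) {e₀ : E} (he₀ : p e₀ = γ 0)
    (hclus : ∀ T ∈ Ioc (0 : ℝ) 1, ∀ Γ : ℝ → E, ContinuousOn Γ (Ico 0 T) →
      (∀ x ∈ Ico 0 T, p (Γ x) = γ x) → ∃ e, MapClusterPt e (𝓝[<] T) Γ) :
    ∃ Γ : ℝ → E, ContinuousOn Γ (Icc 0 1) ∧ Γ 0 = e₀ ∧ ∀ x ∈ Icc (0 : ℝ) 1, p (Γ x) = γ x := by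
  set S : Set ℝ := {t | ∃ Γ : ℝ → E, ContinuousOn Γ (Icc 0 t) ∧ Γ 0 = e₀ ∧
    ∀ x ∈ Icc 0 t, p (Γ x) = γ x} with hS
  have hdown : ∀ t ∈ S, ∀ s ≤ t, s ∈ S := by
    rintro t ⟨Γ, h1, h2, h3⟩ s hs
    exact ⟨Γ, h1.mono (Icc_subset_Icc_right hs), h2, fun x hx => h3 x ⟨hx.1, hx.2.trans hs⟩⟩
  have h0 : (0 : ℝ) ∈ S := ⟨fun _ => e₀, continuousOn_const, rfl, fun x hx => by
    have : x = 0 := le_antisymm hx.2 hx.1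
    rw [this, he₀]⟩
  have hright : ∀ x ∈ S ∩ Ico (0 : ℝ) 1, ∀ y ∈ Ioi x, (S ∩ Ioc x y).Nonempty := by
    rintro x ⟨⟨Γ, h1, h2, h3⟩, hx0, hx1⟩ y (hxy : x < y)
    obtain ⟨ψ, hψ1, hψ2⟩ := hp (Γ x)
    have hγx : γ x ∈ ψ.target := by
      rw [← h3 x ⟨hx0, le_rfl⟩, hψ2]; exact ψ.map_source hψ1
    obtain ⟨δ, hδ, hδ'⟩ := Metric.isOpen_iff.1 (ψ.open_target.preimage hγ) x hγx
    set t := min y (x + δ / 2)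
    have hxt : x < t := lt_min hxy (by linarith)
    refine ⟨t, ?_, hxt, min_le_left _ _⟩
    obtain ⟨Γ', g1, g2, g3⟩ := IsLocalHomeomorph.extend_lift hγ hx0 hxt.le h1 h3 ψ hψ2 hψ1
      (fun s hs => hδ' (by
        have : t ≤ x + δ / 2 := min_le_right _ _
        rw [mem_ball, Real.dist_eq, abs_lt]
        constructor <;> linarith [hs.1, hs.2]))
    exact ⟨Γ', g1, g2.trans h2, g3⟩
  have hleft : ∀ T ∈ Ioc (0 : ℝ) 1, (∀ t < T, t ∈ S) → T ∈ S := by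
    intro T hT hTS
    have : Nonempty E := ⟨e₀⟩
    choose! Γ hΓ1 hΓ2 hΓ3 using hTS
    have huniq : ∀ s t, 0 ≤ s → s ≤ t → t < T → EqOn (Γ s) (Γ t) (Icc 0 s) := by
      intro s t hs hst htT
      refine (T2Space.isSeparatedMap p).eqOn_of_comp_eqOn hp.isLocallyInjective isPreconnected_Icc
        (hΓ1 s (hst.trans_lt htT)) ((hΓ1 t htT).mono (Icc_subset_Icc_right hst)) ?_
        (left_mem_Icc.2 hs) ?_
      · intro x hx
        simp only [Function.comp]
        rw [hΓ3 s (hst.trans_lt htT) x hx, hΓ3 t htT x ⟨hx.1, hx.2.trans hst⟩]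
      · rw [hΓ2 s (hst.trans_lt htT), hΓ2 t htT]
    set Θ : ℝ → E := fun s => Γ s s with hΘ
    have hΘeq : ∀ t, 0 ≤ t → t < T → EqOn Θ (Γ t) (Icc 0 t) := fun t ht htT x hx =>
      huniq x t hx.1 hx.2 htT ⟨hx.1, le_rfl⟩
    have hΘc : ContinuousOn Θ (Ico 0 T) := by
      intro x hx
      set t := (x + T) / 2
      have hxt : x < t := by show x < (x + T) / 2; linarith [hx.2]
      have htT : t < T := by show (x + T) / 2 < T; linarith [hx.2]
      have ht0 : 0 ≤ t := hx.1.trans hxt.le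
      have h1 : ContinuousWithinAt Θ (Icc 0 t) x :=
        (hΓ1 t htT x ⟨hx.1, hxt.le⟩).congr (fun y hy => hΘeq t ht0 htT hy)
          (hΘeq t ht0 htT ⟨hx.1, hxt.le⟩)
      refine h1.mono_of_mem_nhdsWithin ?_
      filter_upwards [self_mem_nhdsWithin, nhdsWithin_le_nhds (Iio_mem_nhds hxt)] with y hy hy'
      exact ⟨hy.1, le_of_lt hy'⟩
    have hΘp : ∀ x ∈ Ico 0 T, p (Θ x) = γ x := fun x hx => hΓ3 x hx.2 x ⟨hx.1, le_rfl⟩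
    obtain ⟨e, he⟩ := hclus T hT Θ hΘc hΘp
    have hpe : p e = γ T := by
      have h1 : MapClusterPt (p e) (𝓝[<] T) (p ∘ Θ) := he.continuousAt_comp hp.continuous.continuousAt
      have h2 : Tendsto (p ∘ Θ) (𝓝[<] T) (𝓝 (γ T)) := by
        refine (hγ.continuousAt.continuousWithinAt (s := Iio T)).tendsto.congr' ?_
        filter_upwards [self_mem_nhdsWithin, nhdsWithin_le_nhds (Ioi_mem_nhds hT.1)] with y hy hy'
        exact (hΘp y ⟨le_of_lt hy', hy⟩).symm
      exact eq_of_nhds_neBot (NeBot.mono h1 (inf_le_inf_left _ h2))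
    obtain ⟨ψ, hψ1, hψ2⟩ := hp e
    have hγT : γ T ∈ ψ.target := by rw [← hpe, hψ2]; exact ψ.map_source hψ1
    obtain ⟨δ, hδ, hδ'⟩ := Metric.isOpen_iff.1 (ψ.open_target.preimage hγ) T hγT
    have hfr : ∃ᶠ s in 𝓝[<] T, Θ s ∈ ψ.source :=
      he.frequently (ψ.open_source.mem_nhds hψ1)
    have hev : ∀ᶠ s in 𝓝[<] T, s ∈ Ico 0 T ∧ T - δ < s := by
      filter_upwards [self_mem_nhdsWithin, nhdsWithin_le_nhds (Ioi_mem_nhds hT.1),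
        nhdsWithin_le_nhds (Ioi_mem_nhds (show T - δ < T by linarith))] with y h1 h2 h3
      exact ⟨⟨le_of_lt h2, h1⟩, h3⟩
    obtain ⟨s, hs1, hs2, hs3⟩ := (hfr.and_eventually hev).exists
    obtain ⟨Γ', g1, g2, g3⟩ := IsLocalHomeomorph.extend_lift hγ hs2.1 hs2.2.le
      (hΘc.mono fun x hx => ⟨hx.1, hx.2.trans_lt hs2.2⟩)
      (fun x hx => hΘp x ⟨hx.1, hx.2.trans_lt hs2.2⟩) ψ hψ2 hs1
      (fun x hx => hδ' (by
        rw [mem_ball, Real.dist_eq, abs_lt]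
        constructor <;> linarith [hx.1, hx.2]))
    exact ⟨Γ', g1, g2.trans (hΓ2 0 hT.1), g3⟩
  have hclosed : IsClosed (S ∩ Icc (0 : ℝ) 1) := by
    refine isClosed_of_closure_subset fun T hT => ?_
    have hTI : T ∈ Icc (0 : ℝ) 1 := by
      have := closure_mono inter_subset_right hT
      rwa [isClosed_Icc.closure_eq] at this
    refine ⟨?_, hTI⟩
    rcases hTI.1.eq_or_lt with h | h
    · rw [← h]; exact h0
    refine hleft T ⟨h, hTI.2⟩ fun t ht => ?_
    obtain ⟨y, hy, hy'⟩ := mem_closure_iff.1 hT (Ioi t) isOpen_Ioi ht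
    exact hdown y hy'.1 t (le_of_lt hy)
  exact hclosed.Icc_subset_of_forall_exists_gt h0 hright ⟨zero_le_one, le_rfl⟩

end PathLifting

/-- `R₀` is so large that all the singular behaviour of `f` happens over the disc of radius `R₀`. -/
structure IsSingularBound (f : ℂ → ℂ) (R₀ : ℝ) : Prop where
  one_le : 1 ≤ R₀
  differentiable : Differentiable ℂ f
  deriv_ne_zero : ∀ z, R₀ < ‖f z‖ → deriv f z ≠ 0
  norm_asymptoticValue_le : ∀ w ∈ asymptoticValues f, ‖w‖ ≤ R₀
  norm_zero_le : ‖f 0‖ ≤ R₀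
  unbounded : ∀ r : ℝ, ∃ z, r ≤ ‖z‖ ∧ ‖f z‖ ≤ R₀

namespace IsSingularBound

variable {f : ℂ → ℂ} {R₀ : ℝ} (hf : IsSingularBound f R₀)
include hf

theorem isOpen_preimage : IsOpen {z | R₀ < ‖f z‖} :=
  isOpen_lt continuous_const hf.differentiable.continuous.norm

theorem isLocalHomeomorph : IsLocalHomeomorph (fun z : {z | R₀ < ‖f z‖} => f z) := by
  have h1 : IsLocalHomeomorphOn f {z | R₀ < ‖f z‖} := by
    refine IsLocalHomeomorphOn.mk _ _ fun z hz => ?_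
    have hs : HasStrictDerivAt f (deriv f z) z :=
      (hf.differentiable.analyticAt z).hasStrictDerivAt
    have h := hs.hasStrictFDerivAt_equiv (hf.deriv_ne_zero z hz)
    exact ⟨h.toOpenPartialHomeomorph f, h.mem_toOpenPartialHomeomorph_source, fun _ _ => rfl⟩
  have h2 : IsLocalHomeomorphOn (Subtype.val : {z | R₀ < ‖f z‖} → ℂ) univ :=
    hf.isOpen_preimage.isOpenEmbedding_subtypeVal.isLocalHomeomorph.isLocalHomeomorphOn
  exact isLocalHomeomorph_iff_isLocalHomeomorphOn_univ.2 (h1.comp h2 fun z _ => z.2)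

theorem exists_path_lift {γ : ℝ → ℂ} (hγ : Continuous γ) (hγR : ∀ t, R₀ < ‖γ t‖)
    (e₀ : {z | R₀ < ‖f z‖}) (he₀ : f e₀ = γ 0) :
    ∃ Γ : ℝ → {z | R₀ < ‖f z‖}, ContinuousOn Γ (Icc 0 1) ∧ Γ 0 = e₀ ∧
      ∀ x ∈ Icc (0 : ℝ) 1, f (Γ x) = γ x := by
  refine hf.isLocalHomeomorph.exists_lift_Icc hγ he₀ fun T hT Γ hΓc hΓ => ?_
  by_cases hlim : Tendsto (fun s => ‖(Γ s : ℂ)‖) (𝓝[<] T) atTop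
  · exfalso
    set θ : ℝ → ℝ := fun s => T - T / (1 + max s 0) with hθ
    have hpos : ∀ s : ℝ, 0 < 1 + max s 0 := fun s => by positivity
    have hθc : Continuous θ :=
      continuous_const.sub (continuous_const.div (by fun_prop) fun s => (hpos s).ne')
    have hθI : ∀ s, θ s ∈ Ico 0 T := by
      intro s
      have h1 : 0 < T / (1 + max s 0) := div_pos hT.1 (hpos s)
      have h2 : T / (1 + max s 0) ≤ T :=
        div_le_self hT.1.le (by linarith [le_max_right s 0])
      exact ⟨by simp only [hθ]; linarith, by simp only [hθ]; linarith⟩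
    have hθt : Tendsto θ atTop (𝓝[<] T) := by
      refine tendsto_nhdsWithin_iff.2 ⟨?_, Eventually.of_forall fun s => (hθI s).2⟩
      have h1 : Tendsto (fun s : ℝ => 1 + max s 0) atTop atTop :=
        tendsto_atTop_mono (fun s => by linarith [le_max_left s 0] : ∀ s : ℝ, s ≤ 1 + max s 0)
          tendsto_id
      simpa using tendsto_const_nhds.sub ((tendsto_const_nhds (x := T)).div_atTop h1)
    have hmem : γ T ∈ asymptoticValues f := by
      refine ⟨fun s => Γ (θ s), ?_, hlim.comp hθt, ?_⟩
      · exact continuous_subtype_val.comp (hΓc.comp_continuous hθc hθI)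
      · have h1 : Tendsto (fun s => γ (θ s)) atTop (𝓝 (γ T)) :=
          (hγ.tendsto T).comp (hθt.mono_right nhdsWithin_le_nhds)
        exact h1.congr fun s => (hΓ _ (hθI s)).symm
    exact absurd (hf.norm_asymptoticValue_le _ hmem) (not_le.2 (hγR T))
  · rw [Filter.tendsto_atTop] at hlim
    push Not at hlim
    obtain ⟨r, hr⟩ := hlim
    obtain ⟨e, -, he⟩ := (isCompact_closedBall (0 : ℂ) r).exists_mapClusterPt_of_frequently
      (l := 𝓝[<] T) (f := fun s => (Γ s : ℂ)) (hr.mono fun s hs => by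
        rw [mem_closedBall_zero_iff]; exact hs.le)
    have hfe : f e = γ T := by
      have h1 := he.continuousAt_comp hf.differentiable.continuous.continuousAt
      have h2 : Tendsto (f ∘ fun s => (Γ s : ℂ)) (𝓝[<] T) (𝓝 (γ T)) := by
        refine (hγ.continuousAt.continuousWithinAt (s := Iio T)).tendsto.congr' ?_
        filter_upwards [self_mem_nhdsWithin, nhdsWithin_le_nhds (Ioi_mem_nhds hT.1)] with y hy hy'
        exact (hΓ y ⟨le_of_lt hy', hy⟩).symm
      exact eq_of_nhds_neBot (NeBot.mono h1 (inf_le_inf_left _ h2))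
    refine ⟨⟨e, by show R₀ < ‖f e‖; rw [hfe]; exact hγR T⟩, ?_⟩
    rw [mapClusterPt_iff_frequently] at he ⊢
    intro s hs
    obtain ⟨t, ht, hts⟩ := mem_nhds_subtype _ _ _ |>.1 hs
    exact (he t ht).mono fun a ha => hts ha

end IsSingularBound

theorem isOpen_rightHalfPlane (L : ℝ) : IsOpen {z : ℂ | L < z.re} :=
  isOpen_lt continuous_const Complex.continuous_re

namespace IsSingularBound

variable {f : ℂ → ℂ} {R₀ : ℝ} (hf : IsSingularBound f R₀)
include hf

theorem pos : 0 < R₀ := one_pos.trans_le hf.one_le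

theorem lt_norm_exp_iff {z : ℂ} : R₀ < ‖Complex.exp z‖ ↔ Real.log R₀ < z.re := by
  rw [Complex.norm_exp, Real.log_lt_iff_lt_exp hf.pos]

theorem exists_branch {w₀ ζ₀ : ℂ} (hζ₀ : Real.log R₀ < ζ₀.re)
    (h : f (Complex.exp w₀) = Complex.exp ζ₀) :
    ∃ G : ℂ → ℂ, DifferentiableOn ℂ G {z | Real.log R₀ < z.re} ∧ G ζ₀ = w₀ ∧
      ∀ ζ : ℂ, Real.log R₀ < ζ.re → f (Complex.exp (G ζ)) = Complex.exp ζ := by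
  set H : Set ℂ := {z | Real.log R₀ < z.re} with hH
  have hHo : IsOpen H := isOpen_rightHalfPlane _
  have hHc : Convex ℝ H := convex_halfSpace_re_gt _
  set E := {z | R₀ < ‖f z‖} with hE
  let e₀ : E := ⟨Complex.exp w₀, by
    show R₀ < ‖f (Complex.exp w₀)‖
    rw [h]; exact hf.lt_norm_exp_iff.2 hζ₀⟩
  set c : ℝ → ℝ := fun t => (projIcc (0 : ℝ) 1 zero_le_one t : ℝ) with hc
  have hcc : Continuous c := continuous_subtype_val.comp continuous_projIcc
  have hcI : ∀ t, c t ∈ Icc (0 : ℝ) 1 := fun t => (projIcc (0 : ℝ) 1 zero_le_one t).2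
  have hcid : ∀ t ∈ Icc (0 : ℝ) 1, c t = t := fun t ht => by
    simp only [hc, projIcc_of_mem zero_le_one ht]
  have hseg : ∀ ζ ∈ H, ∀ t ∈ Icc (0 : ℝ) 1, ζ₀ + t * (ζ - ζ₀) ∈ H := by
    intro ζ hζ t ht
    have := hHc.add_smul_sub_mem hζ₀ hζ ht
    simpa [Complex.real_smul] using this
  set γ : ℂ → ℝ → ℂ := fun ζ t => Complex.exp (ζ₀ + c t * (ζ - ζ₀)) with hγ
  have hlift : ∀ ζ : H, ∃ Γ : ℝ → E, ContinuousOn Γ (Icc 0 1) ∧ Γ 0 = e₀ ∧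
      ∀ x ∈ Icc (0 : ℝ) 1, f (Γ x) = γ ζ x := by
    intro ζ
    refine hf.exists_path_lift (γ := γ ζ) (by fun_prop) (fun t => ?_) e₀ ?_
    · exact hf.lt_norm_exp_iff.2 (hseg ζ ζ.2 _ (hcI t))
    · have : c 0 = 0 := hcid 0 ⟨le_rfl, zero_le_one⟩
      simp only [hγ, this]
      simp [e₀, h]
  choose Γ hΓc hΓ0 hΓ using hlift
  set g : unitInterval × H → E := fun q => Γ q.2 q.1 with hg
  have hsep := T2Space.isSeparatedMap (fun z : E => f z)
  have hgc : Continuous g := by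
    refine hf.isLocalHomeomorph.continuous_lift hsep
      (f := ⟨fun q : unitInterval × H => γ q.2 q.1, ?_⟩) ?_ ?_ ?_
    · simp only [hγ]
      exact Complex.continuous_exp.comp (by fun_prop)
    · ext q
      exact hΓ q.2 q.1 q.1.2
    · simp only [hg]
      have : (fun x : H => Γ x ((0 : unitInterval) : ℝ)) = fun _ => e₀ := by
        funext x; exact hΓ0 x
      rw [this]; exact continuous_const
    · intro a
      exact (hΓc a).comp_continuous continuous_subtype_val fun t => t.2
  have hconst : (Γ ⟨ζ₀, hζ₀⟩ 1) = e₀ := by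
    rw [← hΓ0 ⟨ζ₀, hζ₀⟩]
    refine hsep.constOn_of_comp hf.isLocalHomeomorph.isLocallyInjective isPreconnected_Icc
      (hΓc ⟨ζ₀, hζ₀⟩) ?_ (right_mem_Icc.2 zero_le_one) (left_mem_Icc.2 zero_le_one)
    intro a ha a' ha'
    simp only [hΓ _ _ ha, hΓ _ _ ha', hγ]
    simp
  classical
  set Gz : ℂ → ℂ := fun ζ => if hz : ζ ∈ H then (Γ ⟨ζ, hz⟩ 1 : ℂ) else 0 with hGz
  have hGzf : ∀ ζ ∈ H, f (Gz ζ) = Complex.exp ζ := by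
    intro ζ hζ
    simp only [hGz, hζ, dif_pos]
    rw [hΓ ⟨ζ, hζ⟩ 1 (right_mem_Icc.2 zero_le_one)]
    simp only [hγ, hcid 1 (right_mem_Icc.2 zero_le_one)]
    simp
  have hGzc : ContinuousOn Gz H := by
    rw [continuousOn_iff_continuous_domRestrict]
    have : H.domRestrict Gz = fun ζ : H => (g (1, ζ) : ℂ) := by
      funext ζ
      simp [hGz, hg]
    rw [this]
    exact continuous_subtype_val.comp (hgc.comp (by fun_prop))
  have hGzd : DifferentiableOn ℂ Gz H := by
    intro ζ hζ
    have hn := hHo.mem_nhds hζ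
    refine (differentiableAt_of_comp (hGzc.continuousAt hn) (hf.differentiable.analyticAt _)
      (hf.deriv_ne_zero _ ?_) ?_).differentiableWithinAt
    · rw [hGzf ζ hζ]; exact hf.lt_norm_exp_iff.2 hζ
    · exact Complex.differentiableAt_exp.congr_of_eventuallyEq (eventually_of_mem hn hGzf)
  have hGz0 : ∀ ζ ∈ H, Gz ζ ≠ 0 := by
    intro ζ hζ h0
    have h1 := hGzf ζ hζ
    rw [h0] at h1
    have h2 := hf.lt_norm_exp_iff.2 hζ
    rw [← h1] at h2
    exact absurd hf.norm_zero_le (not_le.2 h2)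
  obtain ⟨l, hld, hl⟩ := hHc.exists_differentiableOn_exp_eq hHo ⟨ζ₀, hζ₀⟩ hGzd hGz0
  have hl0 : Complex.exp (l ζ₀) = Complex.exp w₀ := by
    rw [hl ζ₀ hζ₀]
    simp only [hGz, show ζ₀ ∈ H from hζ₀, dif_pos, hconst]
    rfl
  obtain ⟨n, hn⟩ := Complex.exp_eq_exp_iff_exists_int.1 hl0
  refine ⟨fun ζ => l ζ - n * (2 * Real.pi * Complex.I), hld.sub_const _, by simp only [hn]; ring, ?_⟩
  intro ζ hζ
  rw [Complex.exp_sub, Complex.exp_int_mul_two_pi_mul_I, div_one, hl ζ hζ, hGzf ζ hζ]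

end IsSingularBound

namespace IsSingularBound

variable {f : ℂ → ℂ} {R₀ : ℝ} (hf : IsSingularBound f R₀)
include hf

theorem eqOn_of_lifts {g₁ g₂ : ℂ → ℂ} (h₁ : ContinuousOn g₁ {z | Real.log R₀ < z.re})
    (h₂ : ContinuousOn g₂ {z | Real.log R₀ < z.re})
    (e₁ : ∀ ζ : ℂ, Real.log R₀ < ζ.re → f (g₁ ζ) = Complex.exp ζ)
    (e₂ : ∀ ζ : ℂ, Real.log R₀ < ζ.re → f (g₂ ζ) = Complex.exp ζ)
    {a : ℂ} (ha : Real.log R₀ < a.re) (hag : g₁ a = g₂ a) :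
    ∀ ζ : ℂ, Real.log R₀ < ζ.re → g₁ ζ = g₂ ζ := by
  set H : Set ℂ := {z | Real.log R₀ < z.re} with hH
  have hHc : Convex ℝ H := convex_halfSpace_re_gt _
  have : PreconnectedSpace H := isPreconnected_iff_preconnectedSpace.1 hHc.isPreconnected
  let k₁ : H → {z | R₀ < ‖f z‖} := fun ζ => ⟨g₁ ζ, by
    show R₀ < ‖f (g₁ ζ)‖
    rw [e₁ ζ ζ.2]; exact hf.lt_norm_exp_iff.2 ζ.2⟩
  let k₂ : H → {z | R₀ < ‖f z‖} := fun ζ => ⟨g₂ ζ, by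
    show R₀ < ‖f (g₂ ζ)‖
    rw [e₂ ζ ζ.2]; exact hf.lt_norm_exp_iff.2 ζ.2⟩
  have key : k₁ = k₂ := (T2Space.isSeparatedMap _).eq_of_comp_eq
    hf.isLocalHomeomorph.isLocallyInjective
    ((continuousOn_iff_continuous_domRestrict.1 h₁).subtype_mk _)
    ((continuousOn_iff_continuous_domRestrict.1 h₂).subtype_mk _)
    (by funext ζ; show f (g₁ ζ) = f (g₂ ζ); rw [e₁ ζ ζ.2, e₂ ζ ζ.2]) ⟨a, ha⟩ (Subtype.ext hag)
  intro ζ hζ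
  exact congrArg Subtype.val (congrFun key ⟨ζ, hζ⟩)

/-- A lift of the exponential through `f` has no period. -/
theorem not_periodic_lift {g : ℂ → ℂ} (hg : DifferentiableOn ℂ g {z | Real.log R₀ < z.re})
    (hg0 : ∀ ζ : ℂ, Real.log R₀ < ζ.re → g ζ ≠ 0)
    (hfg : ∀ ζ : ℂ, Real.log R₀ < ζ.re → f (g ζ) = Complex.exp ζ) {h : ℝ} (hh : 0 < h)
    (hper : ∀ ζ : ℂ, Real.log R₀ < ζ.re → g (ζ - h * Complex.I) = g ζ) : False := by
  classical
  set L := Real.log R₀ with hL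
  set F : ℂ → ℂ := fun τ => if L < τ.im then (g (-Complex.I * τ))⁻¹ else 0 with hF
  have hre : ∀ τ : ℂ, (-Complex.I * τ).re = τ.im := fun τ => by simp
  have hFper : Function.Periodic F h := by
    intro τ
    have h1 : (τ + h).im = τ.im := by simp
    simp only [hF, h1]
    split_ifs with hτ
    · rw [← hper (-Complex.I * τ) (by rwa [hre])]
      congr 2; ring
    · rfl
  have hev : ∀ A : ℝ, ∀ᶠ τ in comap Complex.im atTop, A < τ.im := fun A =>
    tendsto_comap.eventually (eventually_gt_atTop A)
  have hFd : ∀ᶠ τ in comap Complex.im atTop, DifferentiableAt ℂ F τ := by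
    filter_upwards [hev L] with τ hτ
    have ho : IsOpen {τ : ℂ | L < τ.im} := isOpen_lt continuous_const Complex.continuous_im
    have h1 : DifferentiableAt ℂ (fun τ => (g (-Complex.I * τ))⁻¹) τ := by
      refine DifferentiableAt.inv ?_ (hg0 _ (by rwa [hre]))
      exact DifferentiableAt.comp (g := g) τ
        (hg.differentiableAt ((isOpen_rightHalfPlane L).mem_nhds (by
          show L < (-Complex.I * τ).re; rwa [hre]))) (by fun_prop)
    refine h1.congr_of_eventuallyEq (eventually_of_mem (ho.mem_nhds hτ) fun τ' hτ' => ?_)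
    simp only [hF, show L < τ'.im from hτ', if_true]
  have hF0 : Tendsto F (comap Complex.im atTop) (𝓝 0) := by
    rw [tendsto_zero_iff_norm_tendsto_zero, Metric.tendsto_nhds]
    intro ε hε
    obtain ⟨B, hB⟩ := (isCompact_closedBall (0 : ℂ) (2 / ε)).exists_bound_of_continuousOn
      hf.differentiable.continuous.continuousOn
    filter_upwards [hev L, hev (Real.log (max B 1))] with τ hτ hτ2
    simp only [hF, hτ, if_true, norm_inv, dist_zero_right, norm_norm]
    have h1 : 2 / ε < ‖g (-Complex.I * τ)‖ := by
      by_contra! hle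
      have h2 := hB _ (mem_closedBall_zero_iff.2 hle)
      rw [hfg _ (by rwa [hre]), Complex.norm_exp, hre] at h2
      rw [Real.log_lt_iff_lt_exp (by positivity)] at hτ2
      exact absurd h2 (not_le.2 ((le_max_left _ _).trans_lt hτ2))
    have h3 : 0 < 2 / ε := by positivity
    rw [inv_lt_comm₀ (h3.trans h1) hε]
    refine lt_trans ?_ h1
    rw [inv_eq_one_div]
    gcongr
    norm_num
  set C := Function.Periodic.cuspFunction h F with hC
  have hC0 : C 0 = 0 := Function.Periodic.cuspFunction_zero_of_zero_at_inf hh hF0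
  have hCd0 : DifferentiableAt ℂ C 0 :=
    Function.Periodic.differentiableAt_cuspFunction_zero hh hFper hFd (hF0.isBigO_one ℝ)
  have hCd : ∀ᶠ q in 𝓝 (0 : ℂ), DifferentiableAt ℂ C q := by
    have h1 := Function.Periodic.eventually_differentiableAt_cuspFunction_nhds_ne_zero hh hFper hFd
    rw [eventually_nhdsWithin_iff] at h1
    filter_upwards [h1] with q hq
    by_cases h0 : q = 0
    · rw [h0]; exact hCd0
    · exact hq h0
  have hCa : AnalyticAt ℂ C 0 := Complex.analyticAt_iff_eventually_differentiableAt.2 hCd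
  have hinv : ∀ᶠ q in 𝓝[≠] (0 : ℂ), L < (Function.Periodic.invQParam h q).im :=
    (Function.Periodic.invQParam_tendsto hh).eventually (hev L)
  have hCq : ∀ q : ℂ, q ≠ 0 → L < (Function.Periodic.invQParam h q).im →
      C q = (g (-Complex.I * Function.Periodic.invQParam h q))⁻¹ := by
    intro q hq hq2
    rw [hC, Function.Periodic.cuspFunction_eq_of_nonzero _ _ hq]
    simp only [hF, hq2, if_true]
  rcases hCa.eventually_constant_or_nhds_le_map_nhds with hcon | hmap
  · have h1 : ∀ᶠ q in 𝓝[≠] (0 : ℂ), C q = C 0 := nhdsWithin_le_nhds hcon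
    obtain ⟨q, ⟨hq1, hq2⟩, hq3⟩ := ((h1.and hinv).and self_mem_nhdsWithin).exists
    rw [hCq q hq3 hq2, hC0] at hq1
    exact hg0 _ (by rwa [hre]) (inv_eq_zero.1 hq1)
  · rw [hC0] at hmap
    have h1 : {q : ℂ | q ≠ 0 → L < (Function.Periodic.invQParam h q).im} ∈ 𝓝 (0 : ℂ) :=
      eventually_nhdsWithin_iff.1 hinv
    have h2 := hmap (image_mem_map h1)
    obtain ⟨ε, hε, hε'⟩ := Metric.mem_nhds_iff.1 h2
    obtain ⟨z, hz, hzf⟩ := hf.unbounded (2 / ε)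
    have hz0 : 0 < ‖z‖ := lt_of_lt_of_le (by positivity) hz
    obtain ⟨q, hq, hqz⟩ := hε' (a := z⁻¹) (by
      rw [mem_ball_zero_iff, norm_inv, inv_lt_comm₀ hz0 hε]
      refine lt_of_lt_of_le ?_ hz
      rw [inv_eq_one_div]
      gcongr
      norm_num)
    have hq0 : q ≠ 0 := by
      rintro rfl
      rw [hC0] at hqz
      exact (inv_ne_zero (norm_pos_iff.1 hz0)) hqz.symm
    rw [hCq q hq0 (hq hq0), inv_inj] at hqz
    have hH : L < (-Complex.I * Function.Periodic.invQParam h q).re := by rw [hre]; exact hq hq0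
    rw [← hqz, hfg _ hH] at hzf
    exact absurd (hf.lt_norm_exp_iff.2 hH) (not_lt.2 hzf)

theorem exp_branch_injective {G : ℂ → ℂ} (hG : DifferentiableOn ℂ G {z | Real.log R₀ < z.re})
    (hfG : ∀ ζ : ℂ, Real.log R₀ < ζ.re → f (Complex.exp (G ζ)) = Complex.exp ζ)
    {a b : ℂ} (ha : Real.log R₀ < a.re) (hb : Real.log R₀ < b.re)
    (hab : Complex.exp (G a) = Complex.exp (G b)) : a = b := by
  have main : ∀ a b : ℂ, Real.log R₀ < a.re → ∀ h : ℝ, 0 < h → b = a - h * Complex.I →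
      Complex.exp (G a) = Complex.exp (G b) → Complex.exp a = Complex.exp b → False := by
    rintro a b ha h hh rfl hab heab
    have hsub : ∀ ζ : ℂ, Real.log R₀ < ζ.re → Real.log R₀ < (ζ - h * Complex.I).re := by
      intro ζ hζ; simpa using hζ
    have hper : ∀ ζ : ℂ, Complex.exp (ζ - h * Complex.I) = Complex.exp ζ := by
      intro ζ
      rw [Complex.exp_sub] at heab ⊢
      have h1 := Complex.exp_ne_zero a
      have h2 := Complex.exp_ne_zero (h * Complex.I)
      have : Complex.exp (h * Complex.I) = 1 := by
        field_simp at heab; exact heab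
      rw [this, div_one]
    refine hf.not_periodic_lift hG.cexp (fun ζ _ => Complex.exp_ne_zero _) hfG hh ?_
    refine hf.eqOn_of_lifts (g₁ := fun ζ => Complex.exp (G (ζ - h * Complex.I)))
      (g₂ := fun ζ => Complex.exp (G ζ)) ?_ hG.continuousOn.cexp ?_ hfG ha hab.symm
    · exact (hG.continuousOn.comp (by fun_prop) hsub).cexp
    · intro ζ hζ
      rw [hfG _ (hsub ζ hζ), hper]
  have heab : Complex.exp a = Complex.exp b := by rw [← hfG a ha, hab, hfG b hb]
  obtain ⟨n, hn⟩ := Complex.exp_eq_exp_iff_exists_int.1 heab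
  rcases lt_trichotomy n 0 with h | h | h
  · exfalso
    have hn' : (n : ℝ) < 0 := by exact_mod_cast h
    refine main b a hb (-n * (2 * Real.pi)) (by nlinarith [Real.pi_pos]) ?_ hab.symm heab.symm
    rw [hn]; push_cast; ring
  · rw [hn, h]; simp
  · exfalso
    have hn' : (0 : ℝ) < n := by exact_mod_cast h
    refine main a b ha (n * (2 * Real.pi)) (by nlinarith [Real.pi_pos]) ?_ hab heab
    rw [hn]; push_cast; ring

end IsSingularBound

theorem deriv_ne_zero_of_exp_lift {F φ : ℂ → ℂ} {U : Set ℂ} (hU : IsOpen U)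
    (hF : Differentiable ℂ F) (hφ : DifferentiableOn ℂ φ U)
    (h : ∀ ζ ∈ U, F (Complex.exp (φ ζ)) = Complex.exp ζ) {ζ : ℂ} (hζ : ζ ∈ U) :
    deriv φ ζ ≠ 0 := by
  intro h0
  have hd : HasDerivAt φ 0 ζ := h0 ▸ (hφ.differentiableAt (hU.mem_nhds hζ)).hasDerivAt
  have h1 : HasDerivAt (fun z => F (Complex.exp (φ z))) _ ζ :=
    (hF (Complex.exp (φ ζ))).hasDerivAt.comp ζ hd.cexp
  have h2 : HasDerivAt Complex.exp _ ζ := h1.congr_of_eventuallyEq <|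
    Filter.eventually_of_mem (hU.mem_nhds hζ) fun z hz => (h z hz).symm
  have h3 := h2.unique (Complex.hasDerivAt_exp ζ)
  simp only [mul_zero] at h3
  exact Complex.exp_ne_zero ζ h3.symm

namespace IsSingularBound

variable {f : ℂ → ℂ} {R₀ : ℝ} (hf : IsSingularBound f R₀) {G : ℂ → ℂ}
  (hG : DifferentiableOn ℂ G {z | Real.log R₀ < z.re})
  (hfG : ∀ ζ : ℂ, Real.log R₀ < ζ.re → f (Complex.exp (G ζ)) = Complex.exp ζ)
include hf hG hfG

theorem injOn_branch : InjOn G {z | Real.log R₀ < z.re} := fun _ ha _ hb hab =>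
  hf.exp_branch_injective hG hfG ha hb (by rw [hab])

theorem norm_deriv_branch_le {ζ : ℂ} (hζ : Real.log R₀ < ζ.re) :
    ‖deriv G ζ‖ ≤ 176 / (ζ.re - Real.log R₀) := by
  have hr : 0 < ζ.re - Real.log R₀ := sub_pos.2 hζ
  have hsub : ball ζ (ζ.re - Real.log R₀) ⊆ {z | Real.log R₀ < z.re} := by
    intro z hz
    rw [mem_ball, dist_eq_norm] at hz
    have h1 := (abs_lt.1 ((Complex.abs_re_le_norm (z - ζ)).trans_lt hz)).1
    rw [Complex.sub_re] at h1
    show Real.log R₀ < z.re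
    linarith
  have himg := ball_subset_image_of_injOn hr (hG.mono hsub)
    ((hf.injOn_branch hG hfG).mono hsub)
  rw [le_div_iff₀ hr]
  by_contra! hlt
  have hpi : Real.pi < (ζ.re - Real.log R₀) * ‖deriv G ζ‖ / 44 := by
    have := Real.pi_lt_four
    linarith
  have hnorm : ‖(Real.pi : ℂ) * Complex.I‖ = Real.pi := by
    simp [abs_of_pos Real.pi_pos]
  obtain ⟨a, ha, haG⟩ := himg (a := G ζ + Real.pi * Complex.I) (by
    rwa [mem_ball, dist_eq_norm, add_sub_cancel_left, hnorm])
  obtain ⟨b, hb, hbG⟩ := himg (a := G ζ - Real.pi * Complex.I) (by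
    rwa [mem_ball, dist_eq_norm, sub_sub_cancel_left, norm_neg, hnorm])
  have hab : a = b := by
    refine hf.exp_branch_injective hG hfG (hsub ha) (hsub hb) ?_
    rw [haG, hbG, Complex.exp_eq_exp_iff_exists_int]
    exact ⟨1, by push_cast; ring⟩
  rw [hab, hbG] at haG
  have : (Real.pi : ℂ) * Complex.I = 0 := by linear_combination haG / (-2)
  rw [← norm_eq_zero, hnorm] at this
  exact Real.pi_ne_zero this

end IsSingularBound

theorem volume_reProdIm {s t : Set ℝ} (hs : MeasurableSet s) (ht : MeasurableSet t) :
    volume (s ×ℂ t) = volume s * volume t := by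
  have h : s ×ℂ t = Complex.measurableEquivRealProd ⁻¹' (s ×ˢ t) := by
    ext z
    simp [Complex.mem_reProdIm, Complex.measurableEquivRealProd]
  rw [h, Complex.volume_preserving_equiv_real_prod.measure_preimage
    (hs.prod ht).nullMeasurableSet, Measure.volume_eq_prod, Measure.prod_prod]

theorem measurableSet_reProdIm {s t : Set ℝ} (hs : MeasurableSet s) (ht : MeasurableSet t) :
    MeasurableSet (s ×ℂ t) :=
  (Complex.measurable_re hs).inter (Complex.measurable_im ht)

theorem logArea_eq_volume_exp_preimage {A : Set ℂ} (hA : MeasurableSet A) (t : ℝ) :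
    logArea (A ∩ ball 0 (Real.exp t) ∩ Delta) =
      volume (Complex.exp ⁻¹' A ∩ (Ico 0 t ×ℂ Ioc (-Real.pi) Real.pi)) := by
  set S := Complex.exp ⁻¹' A ∩ (Ico 0 t ×ℂ Ioc (-Real.pi) Real.pi) with hS
  have hSm : MeasurableSet S := (Complex.measurable_exp hA).inter
    (measurableSet_reProdIm measurableSet_Ico measurableSet_Ioc)
  have himg : A ∩ ball 0 (Real.exp t) ∩ Delta = Complex.exp '' S := by
    ext z
    constructor
    · rintro ⟨⟨hzA, hzb⟩, hz1⟩
      have hz1 : 1 ≤ ‖z‖ := hz1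
      have hz0 : z ≠ 0 := by rintro rfl; simp at hz1; linarith
      rw [mem_ball_zero_iff] at hzb
      refine ⟨Complex.log z, ⟨?_, ⟨?_, ?_⟩, ?_, ?_⟩, Complex.exp_log hz0⟩
      · rwa [mem_preimage, Complex.exp_log hz0]
      · rw [Complex.log_re]; exact Real.log_nonneg hz1
      · rw [Complex.log_re]; exact (Real.log_lt_iff_lt_exp (by linarith)).2 hzb
      · exact Complex.neg_pi_lt_log_im z
      · exact Complex.log_im_le_pi z
    · rintro ⟨w, ⟨hwA, hw, -⟩, rfl⟩
      refine ⟨⟨hwA, ?_⟩, ?_⟩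
      · rw [mem_ball_zero_iff, Complex.norm_exp]; exact Real.exp_lt_exp.2 hw.2
      · show 1 ≤ ‖Complex.exp w‖
        rw [Complex.norm_exp]; exact Real.one_le_exp hw.1
  have hinj : InjOn Complex.exp S := by
    rintro a ⟨-, -, ha⟩ b ⟨-, -, hb⟩ hab
    exact Complex.exp_inj_of_neg_pi_lt_of_le_pi ha.1 ha.2 hb.1 hb.2 hab
  rw [logArea, himg, lintegral_image_eq_lintegral_abs_det_fderiv_mul volume hSm
    (fun x _ => ((Complex.hasDerivAt_exp x).complexToReal_fderiv.hasFDerivWithinAt)) hinj,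
    ← setLIntegral_one]
  refine lintegral_congr fun x => ?_
  have : (Complex.exp x • (1 : ℂ →L[ℝ] ℂ)).det = Algebra.norm ℝ (Complex.exp x) := by
    rw [Algebra.norm_apply]; rfl
  rw [this, Algebra.norm_complex_eq]
  have h0 : ‖Complex.exp x‖ ^ 2 ≠ 0 := pow_ne_zero _ (norm_ne_zero_iff.2 (Complex.exp_ne_zero x))
  have h1 : |Complex.normSq (Complex.exp x)| = ‖Complex.exp x‖ ^ 2 := by
    rw [Complex.normSq_eq_norm_sq, abs_of_nonneg (by positivity)]
  show ENNReal.ofReal |Complex.normSq (Complex.exp x)| * _ = _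
  rw [h1, ← ENNReal.ofReal_mul (by positivity), mul_inv_cancel₀ h0, ENNReal.ofReal_one]

theorem exists_le_volume_strip_of_liminf_pos {f : ℂ → ℂ} (hf : Continuous f) {R : ℝ}
    (hli : 0 < liminf (fun r : ℝ =>
      (logArea (f ⁻¹' ball (0 : ℂ) R ∩ ball (0 : ℂ) r ∩ Delta)).toReal / Real.log r) atTop) :
    ∃ c > 0, ∀ᶠ t : ℝ in atTop, ENNReal.ofReal (c * t) ≤
      volume ({w | ‖f (Complex.exp w)‖ < R} ∩ (Ico 0 t ×ℂ Ioc (-Real.pi) Real.pi)) := by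
  obtain ⟨c, hc0, hc⟩ := exists_between hli
  refine ⟨c, hc0, ?_⟩
  have hbdd : IsBoundedUnder (· ≥ ·) atTop (fun r : ℝ =>
      (logArea (f ⁻¹' ball (0 : ℂ) R ∩ ball (0 : ℂ) r ∩ Delta)).toReal / Real.log r) := by
    refine ⟨0, eventually_map.2 ?_⟩
    filter_upwards [eventually_ge_atTop 1] with r hr
    exact div_nonneg ENNReal.toReal_nonneg (Real.log_nonneg hr)
  filter_upwards [Real.tendsto_exp_atTop.eventually (eventually_lt_of_lt_liminf hc hbdd),
    eventually_gt_atTop 0] with t ht ht0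
  rw [Real.log_exp, lt_div_iff₀ ht0,
    logArea_eq_volume_exp_preimage (isOpen_ball.preimage hf).measurableSet] at ht
  refine ENNReal.ofReal_le_of_le_toReal (ht.le.trans (le_of_eq ?_))
  congr 3
  ext w
  simp

theorem exists_norm_lt_of_volume_strip {f : ℂ → ℂ} {R c : ℝ} (hc : 0 < c)
    (h : ∀ᶠ t : ℝ in atTop, ENNReal.ofReal (c * t) ≤
      volume ({w | ‖f (Complex.exp w)‖ < R} ∩ (Ico 0 t ×ℂ Ioc (-Real.pi) Real.pi))) (r : ℝ) :
    ∃ z, r ≤ ‖z‖ ∧ ‖f z‖ < R := by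
  by_contra! hcon
  set s := Real.log (max r 1) with hs
  have hs0 : 0 ≤ s := Real.log_nonneg (le_max_right _ _)
  have hpi := Real.pi_pos
  obtain ⟨t, ht, ht2⟩ := (h.and (eventually_gt_atTop (s * (2 * Real.pi) / c))).exists
  rw [div_lt_iff₀ hc] at ht2
  have hsub : {w | ‖f (Complex.exp w)‖ < R} ∩ (Ico 0 t ×ℂ Ioc (-Real.pi) Real.pi) ⊆
      Ico 0 s ×ℂ Ioc (-Real.pi) Real.pi := by
    rintro w ⟨hw, hw1, hw2⟩
    refine ⟨⟨hw1.1, ?_⟩, hw2⟩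
    show w.re < s
    by_contra! hle
    refine absurd hw (not_lt.2 (hcon _ ?_))
    rw [Complex.norm_exp]
    exact (le_max_left _ _).trans ((Real.log_le_iff_le_exp (by positivity)).1 hle)
  have h2 := ht.trans (measure_mono hsub)
  rw [volume_reProdIm measurableSet_Ico measurableSet_Ioc, Real.volume_Ico, Real.volume_Ioc,
    ← ENNReal.ofReal_mul (by linarith), ENNReal.ofReal_le_ofReal_iff (by nlinarith)] at h2
  nlinarith

theorem le_volume_band {E : Set ℂ} {c η t : ℝ} (hη : 0 ≤ η) (hηc : 8 * Real.pi * η ≤ c / 2)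
    (ht : 0 ≤ t) (h : ENNReal.ofReal (c * t) ≤
      volume (E ∩ (Ico 0 t ×ℂ Ioc (-Real.pi) Real.pi))) :
    ENNReal.ofReal (c / 2 * t) ≤
      volume (E ∩ (Ico (4 * η * t) t ×ℂ Ioc (-Real.pi) Real.pi)) := by
  have hpi := Real.pi_pos
  have hsub : E ∩ (Ico 0 t ×ℂ Ioc (-Real.pi) Real.pi) ⊆
      (E ∩ (Ico (4 * η * t) t ×ℂ Ioc (-Real.pi) Real.pi)) ∪
        (Ico 0 (4 * η * t) ×ℂ Ioc (-Real.pi) Real.pi) := by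
    rintro w ⟨hw, hw1, hw2⟩
    rcases lt_or_ge w.re (4 * η * t) with h | h
    · exact Or.inr ⟨⟨hw1.1, h⟩, hw2⟩
    · exact Or.inl ⟨hw, ⟨h, hw1.2⟩, hw2⟩
  have h2 := h.trans ((measure_mono hsub).trans (measure_union_le _ _))
  have h3 : volume (Ico 0 (4 * η * t) ×ℂ Ioc (-Real.pi) Real.pi) ≤ ENNReal.ofReal (c / 2 * t) := by
    rw [volume_reProdIm measurableSet_Ico measurableSet_Ioc, Real.volume_Ico, Real.volume_Ioc,
      ← ENNReal.ofReal_mul (by simp only [sub_zero]; positivity)]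
    exact ENNReal.ofReal_le_ofReal (by nlinarith)
  have h4 := h2.trans (add_le_add_right h3 _)
  have hc : 0 ≤ c / 2 * t := by
    have : 0 ≤ 8 * Real.pi * η := by positivity
    exact mul_nonneg (this.trans hηc) ht
  rw [show c * t = c / 2 * t + c / 2 * t by ring, ENNReal.ofReal_add hc hc] at h4
  exact (ENNReal.add_le_add_iff_right ENNReal.ofReal_ne_top).1 h4

theorem nat_mul_le_volume_of_periodic {E : Set ℂ} (hE : MeasurableSet E)
    (hper : ∀ (w : ℂ) (m : ℤ), w + m * (2 * Real.pi * Complex.I) ∈ E ↔ w ∈ E) {I : Set ℝ}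
    (hI : MeasurableSet I) {V : ℝ≥0∞} (hV : V ≤ volume (E ∩ (I ×ℂ Ioc (-Real.pi) Real.pi)))
    (m₀ : ℤ) (N : ℕ) :
    N * V ≤ volume (E ∩ (I ×ℂ Ioc ((2 * m₀ - 1) * Real.pi) ((2 * (m₀ + N) - 1) * Real.pi))) := by
  have hpi := Real.pi_pos
  induction N with
  | zero => simp
  | succ N ih =>
    set B := E ∩ (I ×ℂ Ioc ((2 * (m₀ + N) - 1) * Real.pi) ((2 * (m₀ + N) + 1) * Real.pi)) with hB
    have hBm : MeasurableSet B := hE.inter (measurableSet_reProdIm hI measurableSet_Ioc)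
    have hBV : V ≤ volume B := by
      refine hV.trans (le_of_eq ?_)
      rw [← measure_preimage_add_right volume ((m₀ + N : ℤ) * (2 * Real.pi * Complex.I)) B]
      congr 1
      ext w
      simp only [hB, mem_inter_iff, mem_preimage, hper, Complex.mem_reProdIm]
      have h1 : (w + (m₀ + N : ℤ) * (2 * Real.pi * Complex.I)).re = w.re := by simp
      have h2 : (w + (m₀ + N : ℤ) * (2 * Real.pi * Complex.I)).im =
          w.im + (m₀ + N) * (2 * Real.pi) := by simp
      rw [h1, h2, mem_Ioc, mem_Ioc]
      refine and_congr_right fun _ => and_congr_right fun _ => and_congr ?_ ?_ <;>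
        constructor <;> intro h <;> linarith
    have hdisj : Disjoint
        (E ∩ (I ×ℂ Ioc ((2 * m₀ - 1) * Real.pi) ((2 * (m₀ + N) - 1) * Real.pi))) B := by
      rw [Set.disjoint_left]
      rintro w ⟨-, -, h1⟩ ⟨-, -, h2⟩
      exact absurd h1.2 (not_le.2 h2.1)
    push_cast
    rw [add_mul, one_mul]
    refine (add_le_add ih hBV).trans ?_
    rw [← measure_union hdisj hBm]
    refine measure_mono (union_subset ?_ ?_)
    · rintro w ⟨h0, h1, h2⟩
      exact ⟨h0, h1, h2.1, h2.2.trans (by nlinarith)⟩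
    · rintro w ⟨h0, h1, h2⟩
      have h3 : (0 : ℝ) ≤ N := N.cast_nonneg
      exact ⟨h0, h1, lt_of_le_of_lt (by nlinarith) h2.1, h2.2.trans (by nlinarith)⟩

theorem le_volume_rectangle {E : Set ℂ} (hE : MeasurableSet E)
    (hper : ∀ (w : ℂ) (m : ℤ), w + m * (2 * Real.pi * Complex.I) ∈ E ↔ w ∈ E)
    {c η t : ℝ} (hη : 0 < η) (hηc : 8 * Real.pi * η ≤ c / 2)
    (ht : 4 * Real.pi ≤ η * t) (h : ENNReal.ofReal (c * t) ≤
      volume (E ∩ (Ico 0 t ×ℂ Ioc (-Real.pi) Real.pi))) (y : ℝ) :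
    ENNReal.ofReal (c * η / (4 * Real.pi) * t ^ 2) ≤
      volume (E ∩ (Ico (4 * η * t) t ×ℂ Icc (y - η * t) (y + η * t))) := by
  have hpi := Real.pi_pos
  have ht0 : 0 < t := by
    by_contra! hle
    nlinarith
  have hc : 0 < c := by
    have : 0 < 8 * Real.pi * η := by positivity
    linarith
  have hV := le_volume_band hη.le hηc ht0.le h
  set m₀ := ⌈(y - η * t + Real.pi) / (2 * Real.pi)⌉ with hm
  have hm1 : (y - η * t + Real.pi) ≤ m₀ * (2 * Real.pi) := by
    rw [← div_le_iff₀ (by positivity)]; exact Int.le_ceil _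
  have hm2 : m₀ * (2 * Real.pi) ≤ y - η * t + Real.pi + 2 * Real.pi := by
    have h1 := (Int.ceil_lt_add_one ((y - η * t + Real.pi) / (2 * Real.pi))).le
    have h2 := mul_le_mul_of_nonneg_right h1 (show 0 ≤ 2 * Real.pi by positivity)
    rwa [add_mul, div_mul_cancel₀ _ (by positivity), one_mul] at h2
  have hx0 : 4 ≤ η * t / Real.pi := by rwa [le_div_iff₀ hpi]
  set N := ⌊η * t / Real.pi - 1⌋₊ with hN
  have hN1 : (N : ℝ) ≤ η * t / Real.pi - 1 := Nat.floor_le (by linarith)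
  have hN2 : η * t / Real.pi - 2 ≤ N := by
    have := Nat.lt_floor_add_one (η * t / Real.pi - 1)
    linarith
  have hN3 : N * Real.pi ≤ η * t - Real.pi := by
    have := mul_le_mul_of_nonneg_right hN1 hpi.le
    rwa [sub_mul, div_mul_cancel₀ _ hpi.ne', one_mul] at this
  have hmain := nat_mul_le_volume_of_periodic hE hper measurableSet_Ico hV m₀ N
  refine le_trans ?_ (hmain.trans (measure_mono ?_))
  · rw [← ENNReal.ofReal_natCast, ← ENNReal.ofReal_mul N.cast_nonneg]
    refine ENNReal.ofReal_le_ofReal ?_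
    have h1 : η * t / Real.pi / 2 ≤ N := by linarith
    calc c * η / (4 * Real.pi) * t ^ 2 = η * t / Real.pi / 2 * (c / 2 * t) := by
          field_simp; ring
      _ ≤ _ := by gcongr
  · rintro w ⟨h0, h1, h2⟩
    exact ⟨h0, h1, le_trans (by nlinarith) h2.1.le, h2.2.trans (by nlinarith)⟩

theorem reProdIm_subset_ball {η L : ℝ} (hη : 0 < η) (hη1 : η < 1 / 4) {w : ℂ}
    (hw : 0 < w.re) (hL : L ≤ η * w.re) :
    Ico (4 * η * w.re) w.re ×ℂ Icc (w.im - η * w.re) (w.im + η * w.re) ⊆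
      ball w ((1 - η) * ((1 - η) * (w.re - L))) := by
  rintro z ⟨⟨h1, h2⟩, h3, h4⟩
  rw [mem_ball, dist_eq_norm]
  have h5 := Complex.norm_le_abs_re_add_abs_im (z - w)
  have h6 : |(z - w).re| ≤ (1 - 4 * η) * w.re := by
    rw [Complex.sub_re, abs_le]
    constructor <;> nlinarith
  have h7 : |(z - w).im| ≤ η * w.re := by
    rw [Complex.sub_im, abs_le]
    constructor <;> linarith
  have h8 : (1 - η) * ((1 - η) * ((1 - η) * w.re)) ≤ (1 - η) * ((1 - η) * (w.re - L)) := by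
    have : 0 ≤ 1 - η := by linarith
    gcongr
    linarith
  have h9 : (1 - 3 * η) * w.re < (1 - η) * ((1 - η) * ((1 - η) * w.re)) := by
    have : 0 < η ^ 2 * (3 - η) * w.re := by
      have : 0 < 3 - η := by linarith
      positivity
    nlinarith
  linarith

theorem exists_le_volume_inter_ball {E : Set ℂ} (hE : MeasurableSet E)
    (hper : ∀ (w : ℂ) (m : ℤ), w + m * (2 * Real.pi * Complex.I) ∈ E ↔ w ∈ E) {c : ℝ} (hc : 0 < c)
    (h : ∀ᶠ t : ℝ in atTop, ENNReal.ofReal (c * t) ≤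
      volume (E ∩ (Ico 0 t ×ℂ Ioc (-Real.pi) Real.pi))) (L : ℝ) :
    ∃ η > 0, η < 1 ∧ ∃ c' > 0, ∃ T : ℝ, ∀ w : ℂ, T ≤ w.re →
      ENNReal.ofReal (c' * w.re ^ 2) ≤ volume (E ∩ ball w ((1 - η) * ((1 - η) * (w.re - L)))) := by
  have hpi := Real.pi_pos
  set η := min (c / (16 * Real.pi)) (1 / 8) with hη
  have hη0 : 0 < η := by positivity
  have hη1 : η ≤ 1 / 8 := min_le_right _ _
  have hηc : 8 * Real.pi * η ≤ c / 2 := by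
    have h1 : η ≤ c / (16 * Real.pi) := min_le_left _ _
    rw [le_div_iff₀ (by positivity)] at h1
    linarith
  obtain ⟨T, hT⟩ := eventually_atTop.1 (h.and ((eventually_ge_atTop (4 * Real.pi / η)).and
    ((eventually_ge_atTop (L / η)).and (eventually_gt_atTop 0))))
  refine ⟨η, hη0, by linarith, c * η / (4 * Real.pi), by positivity, T, fun w hw => ?_⟩
  obtain ⟨h1, h2, h3, h4⟩ := hT _ hw
  rw [div_le_iff₀' hη0] at h2 h3
  exact (le_volume_rectangle hE hper hη0 hηc h2 h1 w.im).trans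
    (measure_mono (inter_subset_inter_right _ (reProdIm_subset_ball hη0 (by linarith) h4 h3)))

namespace IsSingularBound

variable {f : ℂ → ℂ} {R₀ : ℝ} (hf : IsSingularBound f R₀)
include hf

/-- A branch of `log ∘ f⁻¹ ∘ exp` on a disc in the right half-plane, with a Lipschitz bound. -/
theorem exists_branch_ball {w₀ w₁ : ℂ} {r d : ℝ} (hd : 0 < d)
    (hr : 0 < r) (hrd : Real.log R₀ + d + r ≤ w₁.re)
    (h : f (Complex.exp w₀) = Complex.exp w₁) :
    ∃ G : ℂ → ℂ, DifferentiableOn ℂ G (ball w₁ r) ∧ InjOn G (ball w₁ r) ∧ G w₁ = w₀ ∧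
      (∀ ζ ∈ ball w₁ r, f (Complex.exp (G ζ)) = Complex.exp ζ) ∧
      ∀ ζ ∈ ball w₁ r, ‖G ζ - w₀‖ ≤ 176 / d * ‖ζ - w₁‖ := by
  obtain ⟨G, hG, hG1, hfG⟩ := hf.exists_branch (by linarith) h
  have hre : ∀ z ∈ ball w₁ r, Real.log R₀ + d < z.re := by
    intro z hz
    rw [mem_ball, dist_eq_norm] at hz
    have h1 := (abs_lt.1 ((Complex.abs_re_le_norm (z - w₁)).trans_lt hz)).1
    rw [Complex.sub_re] at h1
    linarith
  have hsub : ball w₁ r ⊆ {z | Real.log R₀ < z.re} := fun z hz => by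
    show Real.log R₀ < z.re
    linarith [hre z hz]
  refine ⟨G, hG.mono hsub, (hf.injOn_branch hG hfG).mono hsub, hG1,
    fun ζ hζ => hfG ζ (hsub hζ), fun ζ hζ => ?_⟩
  have h2 : ∀ z ∈ ball w₁ r, ‖deriv G z‖ ≤ 176 / d := fun z hz =>
    (hf.norm_deriv_branch_le hG hfG (hsub hz)).trans <| by
      have := hre z hz
      gcongr
      linarith
  rw [← hG1]
  exact (convex_ball w₁ r).norm_image_sub_le_of_norm_deriv_le
    (fun z hz => hG.differentiableAt ((isOpen_rightHalfPlane _).mem_nhds (hsub hz)))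
    h2 (mem_ball_self hr) hζ

theorem exists_pullback_contracting {C : ℝ} (hC : 0 < C) (n : ℕ) (w : ℕ → ℂ)
    (hw : ∀ k, f (Complex.exp (w k)) = Complex.exp (w (k + 1)))
    (hre : ∀ k, Real.log R₀ + 352 + C ≤ (w k).re) :
    ∃ φ : ℂ → ℂ, DifferentiableOn ℂ φ (ball (w n) C) ∧ InjOn φ (ball (w n) C) ∧ φ (w n) = w 0 ∧
      (∀ ζ ∈ ball (w n) C, f^[n] (Complex.exp (φ ζ)) = Complex.exp ζ) ∧
      MapsTo φ (ball (w n) C) (ball (w 0) (C / 2 ^ n)) := by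
  induction n generalizing w with
  | zero =>
    refine ⟨id, differentiableOn_id, injOn_id _, rfl, fun ζ _ => rfl, ?_⟩
    simpa using mapsTo_id _
  | succ n ih =>
    obtain ⟨ψ, hψ1, hψ2, hψ3, hψ4, hψ5⟩ := ih (fun k => w (k + 1)) (fun k => hw (k + 1))
      fun k => hre (k + 1)
    obtain ⟨G, hG1, hG2, hG3, hG4, hG5⟩ := hf.exists_branch_ball (d := 352) (by norm_num) hC
      (hre 1) (hw 0)
    have hmaps : MapsTo ψ (ball (w (n + 1)) C) (ball (w 1) C) :=
      hψ5.mono_right (ball_subset_ball (div_le_self hC.le (one_le_pow₀ one_le_two)))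
    refine ⟨G ∘ ψ, hG1.comp hψ1 hmaps, hG2.comp hψ2 hmaps, ?_, fun ζ hζ => ?_, fun ζ hζ => ?_⟩
    · rw [Function.comp_apply, hψ3, hG3]
    · rw [Function.iterate_succ_apply, Function.comp_apply, hG4 _ (hmaps hζ), hψ4 ζ hζ]
    · have h1 := hG5 _ (hmaps hζ)
      have h2 := hψ5 hζ
      rw [mem_ball, dist_eq_norm] at h2 ⊢
      refine h1.trans_lt ?_
      rw [pow_succ, ← div_div]
      simp only [zero_add] at h2
      linarith

theorem exists_pullback {η : ℝ} (hη : 0 < η) (hη1 : η < 1) (n : ℕ) (w : ℕ → ℂ)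
    (hw : ∀ k, f (Complex.exp (w k)) = Complex.exp (w (k + 1)))
    (hre : ∀ k, Real.log R₀ + 352 + 176 / η ≤ (w k).re) {r : ℝ}
    (hr : r = (1 - η) * ((w (n + 1)).re - Real.log R₀)) :
    ∃ φ : ℂ → ℂ, DifferentiableOn ℂ φ (ball (w (n + 1)) r) ∧ InjOn φ (ball (w (n + 1)) r) ∧
      φ (w (n + 1)) = w 0 ∧
      (∀ ζ ∈ ball (w (n + 1)) r, f^[n + 1] (Complex.exp (φ ζ)) = Complex.exp ζ) ∧
      MapsTo φ (ball (w (n + 1)) r) (ball (w 0) (176 / η / 2 ^ n)) := by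
  have hC : 0 < 176 / η := by positivity
  have hx : 0 < (w (n + 1)).re - Real.log R₀ := by linarith [hre (n + 1)]
  have hr0 : 0 < r := hr ▸ mul_pos (by linarith) hx
  obtain ⟨ψ, hψ1, hψ2, hψ3, hψ4, hψ5⟩ := hf.exists_pullback_contracting hC n w hw hre
  obtain ⟨G, hG1, hG2, hG3, hG4, hG5⟩ := hf.exists_branch_ball
    (d := η * ((w (n + 1)).re - Real.log R₀)) (by positivity) hr0
    (by rw [hr]; linarith) (hw n)
  have hmaps : MapsTo G (ball (w (n + 1)) r) (ball (w n) (176 / η)) := by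
    intro ζ hζ
    have h1 := hG5 ζ hζ
    rw [mem_ball, dist_eq_norm] at hζ ⊢
    refine h1.trans_lt ?_
    have h2 : ‖ζ - w (n + 1)‖ < (w (n + 1)).re - Real.log R₀ := by nlinarith
    rw [div_mul_eq_mul_div, div_lt_div_iff₀ (by positivity) hη]
    nlinarith
  refine ⟨ψ ∘ G, hψ1.comp hG1 hmaps, hψ2.comp hG2 hmaps, ?_, fun ζ hζ => ?_, hψ5.comp hmaps⟩
  · rw [Function.comp_apply, hG3, hψ3]
  · rw [Function.iterate_succ_apply', Function.comp_apply, hψ4 _ (hmaps hζ), hG4 ζ hζ]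

end IsSingularBound

/-- The density of `E` in a disc is transported by a univalent function. -/
theorem le_volume_image_of_koebe {φ : ℂ → ℂ} {c : ℂ} {r η κ : ℝ} (hr : 0 < r) (hη : 0 < η)
    (hη1 : η < 1) (hφ : DifferentiableOn ℂ φ (ball c r)) (hinj : InjOn φ (ball c r))
    (hne : ∀ z ∈ ball c r, deriv φ z ≠ 0) {E : Set ℂ} (hE : MeasurableSet E)
    (hvol : ENNReal.ofReal (κ * ((1 - η) * r) ^ 2) ≤ volume (E ∩ ball c ((1 - η) * r)))
    {s : ℝ} (hs : s = Real.exp (44 / η) * ‖deriv φ c‖ * ((1 - η) * r)) :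
    φ '' (E ∩ ball c ((1 - η) * r)) ⊆ closedBall (φ c) s ∧
      ENNReal.ofReal (κ / Real.exp (44 / η) ^ 4 * s ^ 2) ≤
        volume (φ '' (E ∩ ball c ((1 - η) * r))) := by
  set K := Real.exp (44 / η) with hK
  set ρ := (1 - η) * r with hρ
  have hK0 : 0 < K := Real.exp_pos _
  have hρ0 : 0 < ρ := mul_pos (by linarith) hr
  have hsub : ball c ρ ⊆ ball c r := ball_subset_ball (by nlinarith)
  have hd : ∀ z ∈ ball c ρ, DifferentiableAt ℂ φ z := fun z hz =>
    hφ.differentiableAt (isOpen_ball.mem_nhds (hsub hz))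
  have hkoebe : ∀ z ∈ ball c ρ, ‖deriv φ z‖ ≤ K * ‖deriv φ c‖ ∧ ‖deriv φ c‖ ≤ K * ‖deriv φ z‖ :=
    fun z hz => koebe_distortion hr hη hη1 hφ hinj hne hz
  constructor
  · rintro _ ⟨z, ⟨-, hz⟩, rfl⟩
    rw [mem_closedBall, dist_eq_norm]
    refine ((convex_ball c ρ).norm_image_sub_le_of_norm_deriv_le hd (fun z hz => (hkoebe z hz).1)
      (mem_ball_self hρ0) hz).trans ?_
    rw [hs]
    gcongr
    exact (mem_ball_iff_norm.1 hz).le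
  · rw [volume_image_eq_lintegral_norm_deriv_sq (hE.inter measurableSet_ball)
      (fun z hz => (hd z hz.2).hasDerivAt) (hinj.mono (inter_subset_right.trans hsub))]
    calc ENNReal.ofReal (κ / K ^ 4 * s ^ 2)
        = ENNReal.ofReal ((‖deriv φ c‖ / K) ^ 2) * ENNReal.ofReal (κ * ρ ^ 2) := by
          rw [← ENNReal.ofReal_mul (by positivity), hs]
          congr 1
          field_simp
      _ ≤ ENNReal.ofReal ((‖deriv φ c‖ / K) ^ 2) * volume (E ∩ ball c ρ) := by gcongr
      _ = ∫⁻ _ in E ∩ ball c ρ, ENNReal.ofReal ((‖deriv φ c‖ / K) ^ 2) := by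
          rw [setLIntegral_const]
      _ ≤ _ := by
          refine setLIntegral_mono' (hE.inter measurableSet_ball) fun z hz => ?_
          refine ENNReal.ofReal_le_ofReal ?_
          have : ‖deriv φ c‖ / K ≤ ‖deriv φ z‖ := by
            rw [div_le_iff₀' hK0]; exact (hkoebe z hz.2).2
          gcongr

/-- A set all of whose points see, at arbitrarily small scales, a definite proportion of the
complement is a null set. -/
theorem volume_eq_zero_of_porous {S : Set ℂ} (hS : MeasurableSet S) {β : ℝ} (hβ : 0 < β)
    (h : ∀ w ∈ S, ∀ ε > 0, ∃ s > 0, s ≤ ε ∧ ∃ A ⊆ closedBall w s, Disjoint A S ∧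
      ENNReal.ofReal (β * s ^ 2) ≤ volume A) : volume S = 0 := by
  have hpi := Real.pi_pos
  have hae := IsUnifLocDoublingMeasure.ae_tendsto_measure_inter_div (volume : Measure ℂ) S 1
  rw [← Measure.restrict_eq_zero, ← ae_eq_bot, ← Filter.eventually_false_iff_eq_bot]
  filter_upwards [hae, ae_restrict_mem hS] with w hw hwS
  choose s hs0 hsle A hA hAS hAv using fun n : ℕ =>
    h w hwS (1 / (n + 1 : ℝ)) (by positivity)
  have hslim : Tendsto s atTop (𝓝[>] 0) := tendsto_nhdsWithin_iff.2
    ⟨squeeze_zero (fun n => (hs0 n).le) hsle tendsto_one_div_add_atTop_nhds_zero_nat,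
      Eventually.of_forall hs0⟩
  have hlim := hw (fun _ : ℕ => w) s hslim
    (Eventually.of_forall fun n => mem_closedBall_self (by simpa using (hs0 n).le))
  have hle : ∀ n, volume (S ∩ closedBall w (s n)) / volume (closedBall w (s n)) +
      ENNReal.ofReal (β / Real.pi) ≤ 1 := by
    intro n
    have hball : volume (closedBall w (s n)) = ENNReal.ofReal (Real.pi * s n ^ 2) := by
      rw [Complex.volume_closedBall, mul_comm, ENNReal.ofReal_mul hpi.le,
        ENNReal.ofReal_pow (hs0 n).le]
      congr 1
      exact (ENNReal.ofReal_eq_coe_nnreal hpi.le).symm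
    have hpos : 0 < Real.pi * s n ^ 2 := by have := hs0 n; positivity
    have h1 : volume (S ∩ closedBall w (s n)) + ENNReal.ofReal (β * s n ^ 2) ≤
        volume (closedBall w (s n)) := by
      rw [← measure_inter_add_sdiff (closedBall w (s n)) hS, inter_comm S]
      gcongr
      exact (hAv n).trans (measure_mono (subset_sdiff.2 ⟨hA n, hAS n⟩))
    have h2 : ENNReal.ofReal (β / Real.pi) =
        ENNReal.ofReal (β * s n ^ 2) / volume (closedBall w (s n)) := by
      rw [hball, ← ENNReal.ofReal_div_of_pos hpos]
      congr 1
      have := (hs0 n).ne'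
      field_simp
    rw [h2, ← ENNReal.add_div]
    exact ENNReal.div_le_of_le_mul (by rwa [one_mul])
  have h3 := le_of_tendsto (hlim.add_const (ENNReal.ofReal (β / Real.pi))) (Eventually.of_forall hle)
  have h4 : 0 < ENNReal.ofReal (β / Real.pi) := ENNReal.ofReal_pos.2 (by positivity)
  exact absurd h3 (not_le.2 (ENNReal.lt_add_right ENNReal.one_ne_top h4.ne'))

namespace IsSingularBound

variable {f : ℂ → ℂ} {R₀ : ℝ} (hf : IsSingularBound f R₀)
include hf

theorem exists_volume_exp_preimage_eq_zero {R c : ℝ} (hR : R ≤ R₀) (hc : 0 < c)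
    (h : ∀ᶠ t : ℝ in atTop, ENNReal.ofReal (c * t) ≤
      volume ({w | ‖f (Complex.exp w)‖ < R} ∩ (Ico 0 t ×ℂ Ioc (-Real.pi) Real.pi))) :
    ∃ M : ℝ, ∀ M' ≥ M, volume {w : ℂ | ∀ n : ℕ, M' ≤ ‖f^[n] (Complex.exp w)‖} = 0 := by
  have hcont := hf.differentiable.continuous
  set E := {w : ℂ | ‖f (Complex.exp w)‖ < R} with hE
  have hEm : MeasurableSet E := (isOpen_lt
    (hcont.comp Complex.continuous_exp).norm continuous_const).measurableSet
  have hper : ∀ (w : ℂ) (m : ℤ), w + m * (2 * Real.pi * Complex.I) ∈ E ↔ w ∈ E := by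
    intro w m
    simp only [hE, Set.mem_ofPred]
    rw [Complex.exp_periodic.int_mul m w]
  obtain ⟨η, hη, hη1, κ, hκ, T, hT⟩ := exists_le_volume_inter_ball hEm hper hc h (Real.log R₀)
  set Λ := max (Real.log R₀ + 352 + 176 / η) T with hΛ
  refine ⟨Real.exp Λ, fun M hM => ?_⟩
  have hlog : 0 ≤ Real.log R₀ := Real.log_nonneg hf.one_le
  have hη' : 0 < 176 / η := by positivity
  have hRM : R₀ ≤ M := by
    refine le_trans ?_ hM
    rw [← Real.log_le_iff_le_exp hf.pos]
    exact le_trans (by linarith) (le_max_left _ _)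
  set K := Real.exp (44 / η) with hK
  have hK0 : 0 < K := Real.exp_pos _
  refine volume_eq_zero_of_porous (β := κ / K ^ 4) ?_ (by positivity) fun w₀ hw₀ ε hε => ?_
  · have : {w : ℂ | ∀ n : ℕ, M ≤ ‖f^[n] (Complex.exp w)‖} =
        ⋂ n : ℕ, {w : ℂ | M ≤ ‖f^[n] (Complex.exp w)‖} := by ext; simp
    rw [this]
    exact MeasurableSet.iInter fun n => (isClosed_le continuous_const
      ((hcont.iterate n).comp Complex.continuous_exp).norm).measurableSet
  have hw₀ : ∀ n : ℕ, M ≤ ‖f^[n] (Complex.exp w₀)‖ := hw₀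
  set w : ℕ → ℂ := fun k => if k = 0 then w₀ else Complex.log (f^[k] (Complex.exp w₀)) with hw
  have hwexp : ∀ k, Complex.exp (w k) = f^[k] (Complex.exp w₀) := by
    intro k
    by_cases hk : k = 0
    · simp [hw, hk]
    · simp only [hw, hk, if_false]
      exact Complex.exp_log (norm_pos_iff.1 (hf.pos.trans_le (hRM.trans (hw₀ k))))
  have hwf : ∀ k, f (Complex.exp (w k)) = Complex.exp (w (k + 1)) := by
    intro k
    rw [hwexp, hwexp, Function.iterate_succ_apply']
  have hwre : ∀ k, Λ ≤ (w k).re := by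
    intro k
    rw [← Real.exp_le_exp, ← Complex.norm_exp, hwexp]
    exact hM.trans (hw₀ k)
  have hw0 : w 0 = w₀ := by simp [hw]
  obtain ⟨n, hn⟩ : ∃ n : ℕ, K * (176 / η) / 2 ^ n ≤ ε := by
    have h1 : Tendsto (fun n : ℕ => K * (176 / η) / 2 ^ n) atTop (𝓝 0) :=
      tendsto_const_nhds.div_atTop (tendsto_pow_atTop_atTop_of_one_lt one_lt_two)
    exact (h1.eventually (ge_mem_nhds hε)).exists
  set x := (w (n + 1)).re with hx
  set r := (1 - η) * (x - Real.log R₀) with hr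
  have hxL : 0 < x - Real.log R₀ := by
    have h1 := (le_max_left _ _).trans (hwre (n + 1))
    linarith
  have hr0 : 0 < r := mul_pos (by linarith) hxL
  obtain ⟨φ, hφ1, hφ2, hφ3, hφ4, hφ5⟩ := hf.exists_pullback hη hη1 n w hwf
    (fun k => (le_max_left _ _).trans (hwre k)) hr
  have hne : ∀ z ∈ ball (w (n + 1)) r, deriv φ z ≠ 0 := fun z hz =>
    deriv_ne_zero_of_exp_lift isOpen_ball (hf.differentiable.iterate (n + 1)) hφ1 hφ4 hz
  set δ := ‖deriv φ (w (n + 1))‖ with hδ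
  have hδ0 : 0 < δ := norm_pos_iff.2 (hne _ (mem_ball_self hr0))
  have hδr : δ * r ≤ 176 / η / 2 ^ n := by
    rw [← le_div_iff₀ hr0]
    refine Complex.norm_deriv_le_div_of_mapsTo_ball hφ1 ?_ hr0
    rw [hφ3]
    exact hφ5.mono_right ball_subset_closedBall
  have hvol : ENNReal.ofReal (κ * ((1 - η) * r) ^ 2) ≤
      volume (E ∩ ball (w (n + 1)) ((1 - η) * r)) := by
    refine le_trans (ENNReal.ofReal_le_ofReal ?_)
      (hT (w (n + 1)) ((le_max_right _ _).trans (hwre (n + 1))))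
    have h1 : r ≤ x := by nlinarith
    have h2 : (1 - η) * r ≤ x := by nlinarith
    have h3 : 0 ≤ (1 - η) * r := mul_nonneg (by linarith) hr0.le
    gcongr
  obtain ⟨hA1, hA2⟩ := le_volume_image_of_koebe hr0 hη hη1 hφ1 hφ2 hne hEm hvol rfl
  rw [hφ3, hw0] at hA1
  refine ⟨_, ?_, ?_, _, hA1, ?_, hA2⟩
  · exact mul_pos (mul_pos hK0 hδ0) (mul_pos (by linarith) hr0)
  · refine le_trans ?_ hn
    calc K * δ * ((1 - η) * r) ≤ K * δ * (1 * r) := by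
          gcongr; linarith
      _ = K * (δ * r) := by ring
      _ ≤ K * (176 / η / 2 ^ n) := by gcongr
      _ = _ := by ring
  · rw [Set.disjoint_left]
    rintro _ ⟨ζ, ⟨hζE, hζ⟩, rfl⟩ hmem
    have h1 : M ≤ ‖f^[n + 1 + 1] (Complex.exp (φ ζ))‖ := hmem (n + 1 + 1)
    have hζr : ζ ∈ ball (w (n + 1)) r := ball_subset_ball (by nlinarith) hζ
    rw [Function.iterate_succ_apply', hφ4 ζ hζr] at h1
    exact absurd hζE (not_lt.2 ((hR.trans hRM).trans h1))

end IsSingularBound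

theorem volume_preimage_eq_zero {f : ℂ → ℂ} (hf : Differentiable ℂ f)
    (hne : ∃ z, deriv f z ≠ 0) {N : Set ℂ} (hN : volume N = 0) : volume (f ⁻¹' N) = 0 := by
  set N' := toMeasurable volume N with hN'
  have hN'm : MeasurableSet N' := measurableSet_toMeasurable _ _
  have hN'0 : volume N' = 0 := by rw [hN', measure_toMeasurable, hN]
  refine measure_mono_null (preimage_mono (subset_toMeasurable volume N)) ?_
  have hreg : volume (f ⁻¹' N' ∩ {z | deriv f z ≠ 0}) = 0 := by
    refine measure_null_of_locally_null _ fun z hz => ?_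
    have h := (hf.analyticAt z).hasStrictDerivAt.hasStrictFDerivAt_equiv hz.2
    set e := h.toOpenPartialHomeomorph f with he
    set S := f ⁻¹' N' ∩ {z | deriv f z ≠ 0} with hS
    have hSm : MeasurableSet S := (hf.continuous.measurable hN'm).inter
      ((isOpen_ne.preimage hf.deriv.continuous).measurableSet)
    refine ⟨S ∩ e.source, inter_mem self_mem_nhdsWithin
      (mem_nhdsWithin_of_mem_nhds (e.open_source.mem_nhds
        h.mem_toOpenPartialHomeomorph_source)), ?_⟩
    have hm := hSm.inter e.open_source.measurableSet
    have hvol := volume_image_eq_lintegral_norm_deriv_sq hm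
      (fun x _ => (hf x).hasDerivAt) (e.injOn.mono inter_subset_right)
    have hsub : f '' (S ∩ e.source) ⊆ N' := by
      rintro _ ⟨x, hx, rfl⟩; exact hx.1.1
    rw [measure_mono_null hsub hN'0, eq_comm, setLIntegral_eq_zero_iff hm
      (by have := hf.deriv.continuous; fun_prop)] at hvol
    refine measure_mono_null (fun x hx => ?_) (ae_iff.1 hvol)
    intro hcon
    have h1 := ENNReal.ofReal_eq_zero.1 (hcon hx)
    have h2 : 0 < ‖deriv f x‖ := norm_pos_iff.2 hx.1.2
    exact absurd h1 (not_le.2 (by positivity))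
  have hcrit : volume {z | deriv f z = 0} = 0 := by
    refine measure_null_of_locally_null _ fun z hz => ?_
    rcases (hf.deriv.analyticAt z).eventually_eq_zero_or_eventually_ne_zero with h | h
    · obtain ⟨z₁, hz₁⟩ := hne
      refine absurd ?_ hz₁
      have hE := (Complex.analyticOnNhd_univ_iff_differentiable.2
        hf.deriv).eqOn_zero_of_preconnected_of_eventuallyEq_zero
        isPreconnected_univ (mem_univ z) h
      exact hE (mem_univ z₁)
    · refine ⟨{z}, ?_, measure_singleton z⟩
      rw [eventually_nhdsWithin_iff] at h
      rw [mem_nhdsWithin_iff_eventually]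
      filter_upwards [h] with x hx hx0
      by_contra hxz
      exact hx hxz hx0
  refine measure_mono_null (fun z hz => ?_) (measure_union_null hreg hcrit)
  by_cases h0 : deriv f z = 0
  · exact Or.inr h0
  · exact Or.inl ⟨hz, h0⟩

theorem TranscendentalEntire.exists_deriv_ne_zero {f : ℂ → ℂ} (hf : TranscendentalEntire f) :
    ∃ z, deriv f z ≠ 0 := by
  by_contra! h
  refine hf.2 ⟨Polynomial.C (f 0), fun z => ?_⟩
  rw [Polynomial.eval_C]
  exact is_const_of_deriv_eq_zero hf.1 h z 0

theorem volume_escapingSet_eq_zero {f : ℂ → ℂ} (hf : TranscendentalEntire f) {M : ℝ} (hM : 0 < M)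
    (h : volume {w : ℂ | ∀ n : ℕ, M ≤ ‖f^[n] (Complex.exp w)‖} = 0) :
    volume (escapingSet f) = 0 := by
  set J := {z : ℂ | ∀ n : ℕ, M ≤ ‖f^[n] z‖} with hJ
  have hJ0 : volume J = 0 := by
    have hexp : Differentiable ℝ Complex.exp :=
      (Complex.differentiable_exp (𝕜 := ℂ)).restrictScalars ℝ
    have h1 := addHaar_image_eq_zero_of_differentiableOn_of_addHaar_eq_zero (f := Complex.exp)
      volume hexp.differentiableOn h
    refine measure_mono_null (fun z hz => ?_) h1
    have hz0 : z ≠ 0 := norm_pos_iff.1 (hM.trans_le (hz 0))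
    exact ⟨Complex.log z, fun n => by rw [Complex.exp_log hz0]; exact hz n, Complex.exp_log hz0⟩
  have hpre : ∀ k : ℕ, volume (f^[k] ⁻¹' J) = 0 := by
    intro k
    induction k with
    | zero => simpa using hJ0
    | succ k ih =>
      rw [Function.iterate_succ, preimage_comp]
      exact volume_preimage_eq_zero hf.1 hf.exists_deriv_ne_zero ih
  refine measure_mono_null (fun z hz => ?_) (measure_iUnion_null hpre)
  obtain ⟨k, hk⟩ := Filter.eventually_atTop.1 ((Filter.tendsto_atTop.1 hz) M)
  refine mem_iUnion.2 ⟨k, fun n => ?_⟩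
  rw [← Function.iterate_add_apply]
  exact hk _ (Nat.le_add_left _ _)

theorem ELClass.exists_isSingularBound {f : ℂ → ℂ} (hf : ELClass f) {R : ℝ}
    (h : ∀ r : ℝ, ∃ z, r ≤ ‖z‖ ∧ ‖f z‖ < R) : ∃ R₀, R ≤ R₀ ∧ IsSingularBound f R₀ := by
  obtain ⟨B, hB⟩ := hf.2.exists_norm_le
  set R₀ := max (max R ‖f 0‖) (max B 1) with hR₀
  have h1 : R ≤ R₀ := (le_max_left _ _).trans (le_max_left _ _)
  have h2 : B ≤ R₀ := (le_max_left _ _).trans (le_max_right _ _)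
  refine ⟨R₀, h1, ⟨(le_max_right _ _).trans (le_max_right _ _), hf.1.1, fun z hz h0 => ?_,
    fun w hw => (hB w (Or.inr hw)).trans h2, (le_max_right _ _).trans (le_max_left _ _),
    fun r => ?_⟩⟩
  · exact absurd hz (not_lt.2 ((hB _ (Or.inl ⟨z, h0, rfl⟩)).trans h2))
  · obtain ⟨z, hz, hzR⟩ := h r
    exact ⟨z, hz, hzR.le.trans h1⟩

theorem escaping_measure_zero_of_liminf_logarea
    (f : ℂ → ℂ) (hf : ELClass f) (R : ℝ) (hR : 0 < R)
    (hli : 0 < liminf (fun r : ℝ =>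
      (logArea (f ⁻¹' ball (0 : ℂ) R ∩ ball (0 : ℂ) r ∩ Delta)).toReal / Real.log r) atTop) :
    volume (escapingSet f) = 0 := by
  obtain ⟨c, hc, hstrip⟩ := exists_le_volume_strip_of_liminf_pos hf.1.1.continuous hli
  obtain ⟨R₀, hRR, hR₀⟩ := hf.exists_isSingularBound (exists_norm_lt_of_volume_strip hc hstrip)
  obtain ⟨M, hM⟩ := hR₀.exists_volume_exp_preimage_eq_zero hRR hc hstrip
  exact volume_escapingSet_eq_zero hf.1 (lt_max_of_lt_right one_pos) (hM (max M 1) (le_max_left _ _))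
end

section
/- Let τ ∈ ℂ with Im τ > 0, Ω = {m + nτ : m,n ∈ ℤ}, and let σ, ζ, η₁ be the associated Weierstraß functions and constant. Write w_{m,n} = m + nτ, E = ⋃_{m,n∈ℤ} D(w_{m,n}, e^{-|w_{m,n}|}) and F = ⋃_{m,n∈ℤ} D(w_{m,n}, |w_{m,n}|^{-1/2}) (disks about lattice points, omitting the origin's degenerate disk), and V(z) = (π/(2 Im τ))|z|² + Re((η₁/2 − π/(2 Im τ)) z²). Then log|σ(z)| = V(z) + O(|z|) as |z| → ∞ with z ∉ E, and ζ(z) = η₁ z − (2πi/Im τ) Im z + O(√|z|) as |z| → ∞ with z ∉ F. -/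
open MeasureTheory Filter Metric Set Topology ENNReal

/-- The lattice point m + nτ. -/
noncomputable def latticePoint (τ : ℂ) (q : ℤ × ℤ) : ℂ := (q.1 : ℂ) + (q.2 : ℂ) * τ

/-- The Weierstraß σ-function of the lattice ℤ + ℤτ. -/
noncomputable def wSigma (τ : ℂ) (z : ℂ) : ℂ :=
  z * ∏' q : {q : ℤ × ℤ // q ≠ (0, 0)},
    (1 - z / latticePoint τ q.1) *
      Complex.exp (z / latticePoint τ q.1 + z ^ 2 / (2 * latticePoint τ q.1 ^ 2))

/-- The Weierstraß ζ-function ζ = σ'/σ. -/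
noncomputable def wZeta (τ : ℂ) (z : ℂ) : ℂ := deriv (wSigma τ) z / wSigma τ z

/-- The constant η₁ = 2ζ(1/2). -/
noncomputable def wEta1 (τ : ℂ) : ℂ := 2 * wZeta τ (1 / 2)

/-- The real coordinates of `a + b τ` are controlled by its norm. -/
lemma exists_coord_le_norm {τ : ℂ} (hτ : 0 < τ.im) :
    ∃ K : ℝ, 0 < K ∧ ∀ a b : ℝ, |a| ≤ K * ‖(a : ℂ) + b * τ‖ ∧ |b| ≤ K * ‖(a : ℂ) + b * τ‖ := by
  have hb : ∀ a b : ℝ, |b| ≤ ‖(a : ℂ) + b * τ‖ / τ.im := fun a b ↦ by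
    rw [le_div_iff₀ hτ]
    have h := Complex.abs_im_le_norm ((a : ℂ) + b * τ)
    simpa [abs_mul, abs_of_pos hτ] using h
  refine ⟨1 / τ.im + (1 + ‖τ‖ / τ.im), by positivity, fun a b ↦ ⟨?_, ?_⟩⟩
  · have h1 : |a| ≤ ‖(a : ℂ) + b * τ‖ + |b| * ‖τ‖ := by
      have h := norm_sub_le ((a : ℂ) + b * τ) (b * τ)
      simpa using h
    have h2 := mul_le_mul_of_nonneg_right (hb a b) (norm_nonneg τ)
    have h3 : 0 ≤ ‖(a : ℂ) + b * τ‖ / τ.im := by positivity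
    calc |a| ≤ ‖(a : ℂ) + b * τ‖ + ‖(a : ℂ) + b * τ‖ / τ.im * ‖τ‖ := by linarith
      _ ≤ ‖(a : ℂ) + b * τ‖ / τ.im +
          (‖(a : ℂ) + b * τ‖ + ‖(a : ℂ) + b * τ‖ / τ.im * ‖τ‖) := by linarith
      _ = _ := by ring
  · have h3 : 0 ≤ (1 + ‖τ‖ / τ.im) * ‖(a : ℂ) + b * τ‖ := by positivity
    calc |b| ≤ ‖(a : ℂ) + b * τ‖ / τ.im := hb a b
      _ ≤ ‖(a : ℂ) + b * τ‖ / τ.im + (1 + ‖τ‖ / τ.im) * ‖(a : ℂ) + b * τ‖ := by linarith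
      _ = _ := by ring

lemma exists_norm_le_latticePoint {τ : ℂ} (hτ : 0 < τ.im) :
    ∃ K : ℝ, 0 < K ∧ ∀ q : ℤ × ℤ, ‖q‖ ≤ K * ‖latticePoint τ q‖ := by
  obtain ⟨K, hK, h⟩ := exists_coord_le_norm hτ
  refine ⟨K, hK, fun q ↦ ?_⟩
  obtain ⟨h1, h2⟩ := h q.1 q.2
  rw [Prod.norm_def, Int.norm_eq_abs, Int.norm_eq_abs]
  exact max_le (by simpa [latticePoint] using h1) (by simpa [latticePoint] using h2)

lemma latticePoint_ne_zero {τ : ℂ} (hτ : 0 < τ.im) {q : ℤ × ℤ} (hq : q ≠ (0, 0)) :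
    latticePoint τ q ≠ 0 := fun h0 ↦ by
  obtain ⟨K, -, hK⟩ := exists_norm_le_latticePoint hτ
  have := hK q
  rw [h0, norm_zero, mul_zero] at this
  exact hq (norm_le_zero_iff.mp this)

lemma summable_inv_norm_int_prod_cube : Summable fun q : ℤ × ℤ ↦ (‖q‖ ^ 3)⁻¹ := by
  have h := EisensteinSeries.summable_one_div_norm_rpow (k := 3) (by norm_num)
  rw [← (finTwoArrowEquiv ℤ).symm.summable_iff] at h
  refine h.congr fun q ↦ ?_
  have : ‖(finTwoArrowEquiv ℤ).symm q‖ = ‖q‖ := by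
    rw [EisensteinSeries.norm_eq_max_natAbs, Prod.norm_def, Int.norm_eq_abs, Int.norm_eq_abs]
    simp
  rw [Function.comp_apply, this, Real.rpow_neg (norm_nonneg _)]
  norm_cast

lemma summable_inv_norm_latticePoint_cube {τ : ℂ} (hτ : 0 < τ.im) :
    Summable fun q : ℤ × ℤ ↦ (‖latticePoint τ q‖ ^ 3)⁻¹ := by
  obtain ⟨K, hK, h⟩ := exists_norm_le_latticePoint hτ
  refine (summable_inv_norm_int_prod_cube.mul_left (K ^ 3)).of_nonneg_of_le
    (fun q ↦ by positivity) fun q ↦ ?_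
  by_cases hq : q = (0, 0)
  · subst hq; simp [latticePoint]
  have h0 := norm_pos_iff.mpr (latticePoint_ne_zero hτ hq)
  have hq0 : 0 < ‖q‖ := norm_pos_iff.mpr hq
  rw [← div_eq_mul_inv, le_div_iff₀ (by positivity), inv_mul_le_iff₀ (by positivity), ← mul_pow,
    mul_comm]
  exact pow_le_pow_left₀ hq0.le (h q) 3

lemma eventually_le_norm_latticePoint {τ : ℂ} (hτ : 0 < τ.im) (r : ℝ) :
    ∀ᶠ q : ℤ × ℤ in cofinite, r ≤ ‖latticePoint τ q‖ := by
  obtain ⟨K, hK, h⟩ := exists_norm_le_latticePoint hτ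
  have hfin : (closedBall (0 : ℤ × ℤ) (K * r)).Finite :=
    (isCompact_closedBall _ _).finite_of_discrete
  refine hfin.subset fun q hq ↦ ?_
  have hq' : ‖latticePoint τ q‖ < r := by simpa using hq
  rw [mem_closedBall_zero_iff]
  exact (h q).trans (by gcongr)

/-- The summand of the Weierstrass ζ-function; with `1 / 0 = 0`, the term of index `0` is
`1 / z`. -/
noncomputable def zetaTerm (τ z : ℂ) (q : ℤ × ℤ) : ℂ :=
  1 / (z - latticePoint τ q) + 1 / latticePoint τ q + z / latticePoint τ q ^ 2

lemma zetaTerm_zero (τ z : ℂ) : zetaTerm τ z (0, 0) = 1 / z := by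
  simp [zetaTerm, latticePoint]

lemma zetaTerm_eq {τ z : ℂ} {q : ℤ × ℤ} (hq : latticePoint τ q ≠ 0) (hz : z ≠ latticePoint τ q) :
    zetaTerm τ z q = z ^ 2 / (latticePoint τ q ^ 2 * (z - latticePoint τ q)) := by
  have : z - latticePoint τ q ≠ 0 := sub_ne_zero.mpr hz
  rw [zetaTerm]
  field_simp
  ring

lemma norm_zetaTerm_le {τ z : ℂ} {q : ℤ × ℤ} {c : ℝ} (hc : 0 < c) (hq : latticePoint τ q ≠ 0)
    (h : c * ‖latticePoint τ q‖ ≤ ‖z - latticePoint τ q‖) :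
    ‖zetaTerm τ z q‖ ≤ ‖z‖ ^ 2 / c * (‖latticePoint τ q‖ ^ 3)⁻¹ := by
  have h0 := norm_pos_iff.mpr hq
  have hz : z ≠ latticePoint τ q := fun h' ↦ by
    rw [h', sub_self, norm_zero] at h
    exact absurd h (not_le.mpr (by positivity))
  rw [zetaTerm_eq hq hz, norm_div, norm_mul, norm_pow, norm_pow]
  calc ‖z‖ ^ 2 / (‖latticePoint τ q‖ ^ 2 * ‖z - latticePoint τ q‖)
      ≤ ‖z‖ ^ 2 / (‖latticePoint τ q‖ ^ 2 * (c * ‖latticePoint τ q‖)) := by gcongr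
    _ = _ := by field_simp

lemma summable_zetaTerm {τ : ℂ} (hτ : 0 < τ.im) (z : ℂ) : Summable (zetaTerm τ z) := by
  refine Summable.of_norm_bounded_eventually
    ((summable_inv_norm_latticePoint_cube hτ).mul_left (‖z‖ ^ 2 / (1 / 2))) ?_
  filter_upwards [eventually_le_norm_latticePoint hτ (2 * ‖z‖),
    eventually_le_norm_latticePoint hτ 1] with q hq hq1
  refine norm_zetaTerm_le (by norm_num) (norm_pos_iff.mp (by linarith)) ?_
  have := norm_sub_norm_le (latticePoint τ q) z
  rw [norm_sub_rev] at this
  linarith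

/-- The primary factor of the σ-product attached to the lattice point of index `q`. -/
noncomputable def sigmaFactor (τ : ℂ) (q : ℤ × ℤ) (z : ℂ) : ℂ :=
  (1 - z / latticePoint τ q) *
    Complex.exp (z / latticePoint τ q + z ^ 2 / (2 * latticePoint τ q ^ 2))

lemma norm_primaryFactor_sub_one_le {u : ℂ} (hu : ‖u‖ ≤ 1 / 2) :
    ‖(1 - u) * Complex.exp (u + u ^ 2 / 2) - 1‖ ≤ 2 * ‖u‖ ^ 3 := by
  have h1 : 1 - u ≠ 0 := fun h ↦ by
    rw [← sub_eq_zero.mp h] at hu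
    norm_num at hu
  have hlog := Complex.norm_log_sub_logTaylor_le 2 (z := -u) (by rw [norm_neg]; linarith)
  have hT : Complex.logTaylor (2 + 1) (-u) = -(u + u ^ 2 / 2) := by
    simp [Complex.logTaylor, Finset.sum_range_succ]
    ring
  rw [hT, sub_neg_eq_add, ← sub_eq_add_neg, norm_neg] at hlog
  set L := Complex.log (1 - u) + (u + u ^ 2 / 2)
  have hexp : (1 - u) * Complex.exp (u + u ^ 2 / 2) = Complex.exp L := by
    rw [Complex.exp_add (Complex.log (1 - u)), Complex.exp_log h1]
  have hinv : (1 - ‖u‖)⁻¹ ≤ 2 := by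
    rw [inv_le_comm₀ (by linarith) (by norm_num)]
    linarith
  have hL : ‖L‖ ≤ ‖u‖ ^ 3 := by
    refine hlog.trans ?_
    have : ‖u‖ ^ (2 + 1) * (1 - ‖u‖)⁻¹ ≤ ‖u‖ ^ 3 * 2 := by gcongr
    have h3 : 0 ≤ ‖u‖ ^ 3 := by positivity
    rw [div_le_iff₀ (by norm_num)]
    push_cast
    linarith
  have hu3 : ‖u‖ ^ 3 ≤ 1 := pow_le_one₀ (norm_nonneg _) (by linarith)
  rw [hexp]
  exact (Complex.norm_exp_sub_one_le (hL.trans hu3)).trans (by linarith)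

lemma norm_sigmaFactor_sub_one_le {τ : ℂ} {q : ℤ × ℤ} {z : ℂ} {r : ℝ} (hr : 0 < r) (hz : ‖z‖ ≤ r)
    (hq : 2 * r ≤ ‖latticePoint τ q‖) :
    ‖sigmaFactor τ q z - 1‖ ≤ 2 * r ^ 3 * (‖latticePoint τ q‖ ^ 3)⁻¹ := by
  have h0 : 0 < ‖latticePoint τ q‖ := by linarith
  have hu : ‖z / latticePoint τ q‖ ≤ r / ‖latticePoint τ q‖ := by
    rw [norm_div]
    gcongr
  have hu2 : ‖z / latticePoint τ q‖ ≤ 1 / 2 := by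
    refine hu.trans ?_
    rw [div_le_iff₀ h0]
    linarith
  have h := norm_primaryFactor_sub_one_le hu2
  have he : sigmaFactor τ q z = (1 - z / latticePoint τ q) *
      Complex.exp (z / latticePoint τ q + (z / latticePoint τ q) ^ 2 / 2) := by
    rw [sigmaFactor, div_pow, div_div, mul_comm (2 : ℂ)]
  rw [he]
  calc _ ≤ 2 * ‖z / latticePoint τ q‖ ^ 3 := h
    _ ≤ 2 * (r / ‖latticePoint τ q‖) ^ 3 := by gcongr
    _ = _ := by rw [div_pow]; ring

lemma differentiable_sigmaFactor (τ : ℂ) (q : ℤ × ℤ) : Differentiable ℂ (sigmaFactor τ q) := by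
  unfold sigmaFactor
  simp only [div_eq_mul_inv]
  fun_prop

lemma sigmaFactor_ne_zero {τ : ℂ} {q : ℤ × ℤ} {z : ℂ} (hz : z ≠ latticePoint τ q) :
    sigmaFactor τ q z ≠ 0 := by
  refine mul_ne_zero (fun h ↦ ?_) (Complex.exp_ne_zero _)
  have h1 : z / latticePoint τ q = 1 := (sub_eq_zero.mp h).symm
  have h0 : latticePoint τ q ≠ 0 := fun h0 ↦ by simp [h0] at h1
  exact hz ((div_eq_one_iff_eq h0).mp h1)

lemma logDeriv_sigmaFactor {τ : ℂ} {q : ℤ × ℤ} {z : ℂ} (hq : latticePoint τ q ≠ 0)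
    (hz : z ≠ latticePoint τ q) : logDeriv (sigmaFactor τ q) z = zetaTerm τ z q := by
  have h1 : HasDerivAt (fun z ↦ 1 - z / latticePoint τ q) (-(1 / latticePoint τ q)) z :=
    ((hasDerivAt_id z).div_const _).const_sub 1
  have h2 : HasDerivAt (fun z ↦ z / latticePoint τ q + z ^ 2 / (2 * latticePoint τ q ^ 2))
      (1 / latticePoint τ q + (2 * z) / (2 * latticePoint τ q ^ 2)) z := by
    have h := (((hasDerivAt_id z).pow 2).div_const (2 * latticePoint τ q ^ 2))
    simp only [id, Nat.cast_ofNat, Nat.add_one_sub_one, pow_one, mul_one] at h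
    exact ((hasDerivAt_id z).div_const _).add h
  have h3 : HasDerivAt (sigmaFactor τ q) _ z := h1.mul h2.cexp
  have hne : z - latticePoint τ q ≠ 0 := sub_ne_zero.mpr hz
  have hne' : latticePoint τ q - z ≠ 0 := sub_ne_zero.mpr hz.symm
  have hf : (1 - z / latticePoint τ q) ≠ 0 := by
    rw [one_sub_div hq]
    exact div_ne_zero hne' hq
  rw [logDeriv_apply, h3.deriv, sigmaFactor, zetaTerm]
  have hE := Complex.exp_ne_zero (z / latticePoint τ q + z ^ 2 / (2 * latticePoint τ q ^ 2))
  generalize Complex.exp (z / latticePoint τ q + z ^ 2 / (2 * latticePoint τ q ^ 2)) = E at hE ⊢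
  rw [one_sub_div hq]
  field_simp
  grind

/-- The entire function `σ(z) / z`. -/
noncomputable def sigmaProd (τ z : ℂ) : ℂ := ∏' q : {q : ℤ × ℤ // q ≠ (0, 0)}, sigmaFactor τ q.1 z

lemma wSigma_eq (τ z : ℂ) : wSigma τ z = z * sigmaProd τ z := rfl

lemma eventually_norm_sigmaFactor_sub_one_le {τ : ℂ} (hτ : 0 < τ.im) {r : ℝ} (hr : 0 < r) :
    ∀ᶠ q : {q : ℤ × ℤ // q ≠ (0, 0)} in cofinite, ∀ z ∈ ball (0 : ℂ) r,
      ‖sigmaFactor τ q.1 z - 1‖ ≤ 2 * r ^ 3 * (‖latticePoint τ q.1‖ ^ 3)⁻¹ := by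
  filter_upwards [Subtype.val_injective.tendsto_cofinite.eventually
    (eventually_le_norm_latticePoint hτ (2 * r))] with q hq z hz
  exact norm_sigmaFactor_sub_one_le hr (by simpa using (mem_ball_zero_iff.mp hz).le) hq

lemma multipliableLocallyUniformlyOn_sigmaFactor {τ : ℂ} (hτ : 0 < τ.im) {r : ℝ} (hr : 0 < r) :
    MultipliableLocallyUniformlyOn
      (fun (q : {q : ℤ × ℤ // q ≠ (0, 0)}) z ↦ sigmaFactor τ q.1 z) (ball (0 : ℂ) r) := by
  have h := Summable.multipliableLocallyUniformlyOn_one_add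
    (f := fun (q : {q : ℤ × ℤ // q ≠ (0, 0)}) z ↦ sigmaFactor τ q.1 z - 1) isOpen_ball
    (((summable_inv_norm_latticePoint_cube hτ).mul_left (2 * r ^ 3)).subtype _)
    (eventually_norm_sigmaFactor_sub_one_le hτ hr)
    (fun q ↦ ((differentiable_sigmaFactor τ q.1).sub_const 1).continuous.continuousOn)
  simpa using h

lemma differentiable_sigmaProd {τ : ℂ} (hτ : 0 < τ.im) : Differentiable ℂ (sigmaProd τ) := by
  intro z
  have hr : 0 < ‖z‖ + 1 := by positivity
  have h : DifferentiableOn ℂ (sigmaProd τ) (ball 0 (‖z‖ + 1)) :=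
    (multipliableLocallyUniformlyOn_sigmaFactor hτ hr).hasProdLocallyUniformlyOn.differentiableOn
      (.of_forall fun _ ↦ by
        simpa [Finset.prod_fn] using DifferentiableOn.finsetProd
          (fun q _ ↦ (differentiable_sigmaFactor τ q.1).differentiableOn)) isOpen_ball
  exact h.differentiableAt (isOpen_ball.mem_nhds (by simp))

lemma sigmaProd_ne_zero {τ : ℂ} (hτ : 0 < τ.im) {z : ℂ}
    (hz : ∀ q : ℤ × ℤ, q ≠ (0, 0) → z ≠ latticePoint τ q) : sigmaProd τ z ≠ 0 := by
  have h := tprod_one_add_ne_zero_of_summable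
    (f := fun q : {q : ℤ × ℤ // q ≠ (0, 0)} ↦ sigmaFactor τ q.1 z - 1)
    (fun q ↦ by simpa using sigmaFactor_ne_zero (hz q.1 q.2)) ?_
  · simpa [sigmaProd] using h
  · have hr : 0 < ‖z‖ + 1 := by positivity
    refine Summable.of_norm_bounded_eventually
      (((summable_inv_norm_latticePoint_cube hτ).mul_left (2 * (‖z‖ + 1) ^ 3)).subtype _) ?_
    filter_upwards [eventually_norm_sigmaFactor_sub_one_le hτ hr] with q hq
    simpa using hq z (by simp)

/-- The Mittag-Leffler series of the Weierstrass ζ-function. -/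
noncomputable def zetaSum (τ z : ℂ) : ℂ := ∑' q : ℤ × ℤ, zetaTerm τ z q

lemma zetaSum_eq {τ : ℂ} (hτ : 0 < τ.im) (z : ℂ) :
    zetaSum τ z = 1 / z + ∑' q : {q : ℤ × ℤ // q ≠ (0, 0)}, zetaTerm τ z q.1 := by
  have h := (summable_zetaTerm hτ z).sum_add_tsum_compl (s := {((0 : ℤ), (0 : ℤ))})
  rw [Finset.sum_singleton, zetaTerm_zero] at h
  rw [zetaSum, ← h]
  congr 1
  have e : ((({((0 : ℤ), (0 : ℤ))} : Finset (ℤ × ℤ)) : Set (ℤ × ℤ))ᶜ) = {q | q ≠ (0, 0)} := by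
    ext; simp
  rw [e]
  rfl

lemma logDeriv_sigmaProd {τ : ℂ} (hτ : 0 < τ.im) {z : ℂ}
    (hz : ∀ q : ℤ × ℤ, q ≠ (0, 0) → z ≠ latticePoint τ q) :
    logDeriv (sigmaProd τ) z = ∑' q : {q : ℤ × ℤ // q ≠ (0, 0)}, zetaTerm τ z q.1 := by
  have hr : 0 < ‖z‖ + 1 := by positivity
  have hlog : ∀ q : {q : ℤ × ℤ // q ≠ (0, 0)},
      logDeriv (sigmaFactor τ q.1) z = zetaTerm τ z q.1 := fun q ↦
    logDeriv_sigmaFactor (latticePoint_ne_zero hτ q.2) (hz q.1 q.2)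
  have h := logDeriv_tprod_eq_tsum (s := ball 0 (‖z‖ + 1)) (x := z)
    (f := fun q : {q : ℤ × ℤ // q ≠ (0, 0)} ↦ sigmaFactor τ q.1) isOpen_ball (by simp)
    (fun q ↦ sigmaFactor_ne_zero (hz q.1 q.2))
    (fun q ↦ (differentiable_sigmaFactor τ q.1).differentiableOn)
    (by simp only [hlog]; exact (summable_zetaTerm hτ z).subtype _)
    (multipliableLocallyUniformlyOn_sigmaFactor hτ hr) (sigmaProd_ne_zero hτ hz)
  simp only [hlog] at h
  exact h

lemma differentiable_wSigma {τ : ℂ} (hτ : 0 < τ.im) : Differentiable ℂ (wSigma τ) :=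
  differentiable_id.mul (differentiable_sigmaProd hτ)

lemma ne_zero_of_forall_ne_latticePoint {τ z : ℂ} (hz : ∀ q, z ≠ latticePoint τ q) : z ≠ 0 := by
  simpa [latticePoint] using hz (0, 0)

lemma wSigma_ne_zero {τ : ℂ} (hτ : 0 < τ.im) {z : ℂ} (hz : ∀ q, z ≠ latticePoint τ q) :
    wSigma τ z ≠ 0 :=
  mul_ne_zero (ne_zero_of_forall_ne_latticePoint hz) (sigmaProd_ne_zero hτ fun q _ ↦ hz q)

lemma wZeta_eq_zetaSum {τ : ℂ} (hτ : 0 < τ.im) {z : ℂ} (hz : ∀ q, z ≠ latticePoint τ q) :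
    wZeta τ z = zetaSum τ z := by
  have h := logDeriv_mul (f := id) (g := sigmaProd τ) z (ne_zero_of_forall_ne_latticePoint hz)
    (sigmaProd_ne_zero hτ fun q _ ↦ hz q) differentiableAt_id (differentiable_sigmaProd hτ z)
  rw [logDeriv_id, logDeriv_sigmaProd hτ fun q _ ↦ hz q] at h
  rw [zetaSum_eq hτ, ← h]
  rfl

lemma summable_inv_sq_sub_int (a : ℂ) : Summable fun m : ℤ ↦ ‖((a - m) ^ 2)⁻¹‖ := by
  have h := (EisensteinSeries.linear_right_summable a (-1) (k := 2) le_rfl).norm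
  refine h.congr fun m ↦ ?_
  congr 2
  push_cast
  norm_cast
  push_cast
  ring

lemma hasSum_inv_sub_int_sub_inv_sub_int {a b : ℂ} (ha : a ∈ Complex.integerComplement)
    (hb : b ∈ Complex.integerComplement) :
    HasSum (fun m : ℤ ↦ 1 / (a - m) - 1 / (b - m))
      (Real.pi * Complex.cot (Real.pi * a) - Real.pi * Complex.cot (Real.pi * b)) := by
  have hne : ∀ {c : ℂ}, c ∈ Complex.integerComplement → ∀ m : ℤ, c - m ≠ 0 := fun {c} hc m ↦ by
    simpa [sub_eq_add_neg] using Complex.integerComplement_add_ne_zero hc (-m)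
  have hs : Summable fun m : ℤ ↦ 1 / (a - m) - 1 / (b - m) := by
    refine Summable.of_norm_bounded (((summable_inv_sq_sub_int a).add
      (summable_inv_sq_sub_int b)).mul_left ‖b - a‖) fun m ↦ ?_
    have h1 := norm_pos_iff.mpr (hne ha m)
    have h2 := norm_pos_iff.mpr (hne hb m)
    have e : 1 / (a - m) - 1 / (b - m) = (b - a) * ((a - m)⁻¹ * (b - m)⁻¹) := by
      have := hne ha m
      have := hne hb m
      field_simp
      ring
    rw [e, norm_mul, norm_mul, norm_inv, norm_inv, norm_inv, norm_inv, norm_pow, norm_pow,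
      ← inv_pow, ← inv_pow]
    gcongr
    nlinarith [sq_nonneg (‖a - m‖⁻¹ - ‖b - m‖⁻¹), sq_nonneg (‖a - m‖⁻¹ + ‖b - m‖⁻¹)]
  have hsym := hs.hasSum.nat_add_neg
  have hshift := (hasSum_nat_add_iff' 1).mpr hsym
  have hcot := ((summable_cotTerm ha).hasSum.sub (summable_cotTerm hb).hasSum)
  rw [← cot_series_rep' ha, ← cot_series_rep' hb] at hcot
  have hu := hshift.unique (hcot.congr_fun fun n ↦ by
    simp only [cotTerm]
    push_cast
    ring)
  simp only [Finset.sum_range_one] at hu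
  convert hs.hasSum using 1
  push_cast at hu
  simp only [neg_zero, sub_zero] at hu
  linear_combination -hu

lemma tendsto_cot_pi_mul_add_nat_mul {τ : ℂ} (hτ : 0 < τ.im) (z : ℂ) :
    Tendsto (fun n : ℕ ↦ Complex.cot (Real.pi * (z + n * τ))) atTop (𝓝 (-Complex.I)) := by
  have hE : Tendsto (fun n : ℕ ↦ Complex.exp (2 * Real.pi * Complex.I * (z + n * τ))) atTop
      (𝓝 0) := by
    rw [tendsto_zero_iff_norm_tendsto_zero]
    have hn : ∀ n : ℕ, ‖Complex.exp (2 * Real.pi * Complex.I * (z + n * τ))‖ =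
        Real.exp (-(2 * Real.pi * z.im + n * (2 * Real.pi * τ.im))) := fun n ↦ by
      rw [Complex.norm_exp]
      congr 1
      simp
      ring
    simp only [hn]
    refine Real.tendsto_exp_neg_atTop_nhds_zero.comp (tendsto_atTop_add_const_left _ _ ?_)
    exact tendsto_natCast_atTop_atTop.atTop_mul_const (by positivity)
  have h : Tendsto (fun E : ℂ ↦ (E + 1) / (Complex.I * (1 - E))) (𝓝 0) (𝓝 (-Complex.I)) := by
    have hc : ContinuousAt (fun E : ℂ ↦ (E + 1) / (Complex.I * (1 - E))) 0 :=
      ContinuousAt.div (by fun_prop) (by fun_prop) (by simp)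
    simpa [ContinuousAt] using hc
  refine (h.comp hE).congr fun n ↦ ?_
  rw [Complex.cot_pi_eq_exp_ratio]
  rfl

lemma mem_integerComplement_sub_mul {τ z : ℂ} (hz : ∀ q, z ≠ latticePoint τ q) (n : ℤ) :
    z - n * τ ∈ Complex.integerComplement := by
  rintro ⟨m, hm⟩
  exact hz (m, n) (by simp only [latticePoint]; linear_combination -hm)

/-- The increment of the ζ-series under a translation, summed row by row. -/
lemma hasSum_zetaSum_add_sub {τ : ℂ} (hτ : 0 < τ.im) {z p : ℂ} (hz : ∀ q, z ≠ latticePoint τ q)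
    (hzp : ∀ q, z + p ≠ latticePoint τ q) :
    HasSum (fun n : ℤ ↦ (Real.pi * Complex.cot (Real.pi * (z + p - n * τ)) -
        Real.pi * Complex.cot (Real.pi * (z - n * τ))) +
        p * ∑' m : ℤ, (latticePoint τ (m, n) ^ 2)⁻¹)
      (zetaSum τ (z + p) - zetaSum τ z) := by
  have h := (summable_zetaTerm hτ (z + p)).hasSum.sub (summable_zetaTerm hτ z).hasSum
  rw [← (Equiv.prodComm ℤ ℤ).hasSum_iff] at h
  refine h.prod_fiberwise fun n ↦ ?_
  have h1 := hasSum_inv_sub_int_sub_inv_sub_int (mem_integerComplement_sub_mul hzp n)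
    (mem_integerComplement_sub_mul hz n)
  have h2 : Summable fun m : ℤ ↦ (latticePoint τ (m, n) ^ 2)⁻¹ := by
    refine (EisensteinSeries.linear_right_summable τ n (k := 2) le_rfl).congr fun m ↦ ?_
    rw [latticePoint, add_comm]
    norm_cast
  refine (h1.add (h2.hasSum.mul_left p)).congr_fun fun m ↦ ?_
  have e : ∀ x : ℂ, x - n * τ - m = x - latticePoint τ (m, n) := fun x ↦ by
    simp only [latticePoint]
    ring
  rw [e, e]
  simp only [Function.comp_apply, Equiv.prodComm_apply, Prod.swap_prod_mk, zetaTerm]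
  ring

lemma add_one_ne_latticePoint {τ z : ℂ} (hz : ∀ q, z ≠ latticePoint τ q) (q : ℤ × ℤ) :
    z + 1 ≠ latticePoint τ q := fun h ↦ hz (q.1 - 1, q.2) <| by
  simp only [latticePoint] at h ⊢
  push_cast
  linear_combination h

lemma add_tau_ne_latticePoint {τ z : ℂ} (hz : ∀ q, z ≠ latticePoint τ q) (q : ℤ × ℤ) :
    z + τ ≠ latticePoint τ q := fun h ↦ hz (q.1, q.2 - 1) <| by
  simp only [latticePoint] at h ⊢
  push_cast
  linear_combination h

lemma hasSum_zetaSum_add_one_sub {τ : ℂ} (hτ : 0 < τ.im) {z : ℂ}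
    (hz : ∀ q, z ≠ latticePoint τ q) :
    HasSum (fun n : ℤ ↦ ∑' m : ℤ, (latticePoint τ (m, n) ^ 2)⁻¹)
      (zetaSum τ (z + 1) - zetaSum τ z) := by
  refine (hasSum_zetaSum_add_sub hτ hz (add_one_ne_latticePoint hz)).congr_fun fun n ↦ ?_
  have hc : Complex.cot (Real.pi * (z + 1 - n * τ)) = Complex.cot (Real.pi * (z - n * τ)) := by
    have : (Real.pi * (z + 1 - n * τ) : ℂ) = Real.pi * (z - n * τ) + Real.pi := by ring
    rw [this, Complex.cot, Complex.cot, Complex.cos_add_pi, Complex.sin_add_pi, neg_div_neg_eq]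
  rw [hc]
  ring

/-- Legendre's relation in the form of the quasi-period along `τ`. -/
lemma zetaSum_add_tau_sub {τ : ℂ} (hτ : 0 < τ.im) {z : ℂ} (hz : ∀ q, z ≠ latticePoint τ q) :
    zetaSum τ (z + τ) - zetaSum τ z =
      τ * (zetaSum τ (z + 1) - zetaSum τ z) - 2 * Real.pi * Complex.I := by
  let C : ℤ → ℂ := fun n ↦ Real.pi * Complex.cot (Real.pi * (z - n * τ))
  have h := (hasSum_zetaSum_add_sub hτ hz (add_tau_ne_latticePoint hz)).sub
    ((hasSum_zetaSum_add_one_sub hτ hz).mul_left τ)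
  have h' : HasSum (fun n : ℤ ↦ C (n - 1) - C n) _ := h.congr_fun fun n ↦ by
    have : z + τ - n * τ = z - ((n - 1 : ℤ) : ℂ) * τ := by push_cast; ring
    simp only [C, this]
    ring
  have hlim := h'.nat_add_neg_add_one.tendsto_sum_nat
  have hsum : ∀ N : ℕ, ∑ i ∈ Finset.range N, (C (i - 1) - C i + (C (-(i + 1) - 1) - C (-(i + 1)))) =
      C (-N - 1) - C (N - 1) := fun N ↦ by
    induction N with
    | zero => simp
    | succ N ih =>
      rw [Finset.sum_range_succ, ih]
      push_cast
      rw [show (N : ℤ) + 1 - 1 = N by ring, show -((N : ℤ) + 1) - 1 = -(N + 1) - 1 by ring,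
        show -(N : ℤ) - 1 = -(N + 1) by ring]
      ring
  simp only [hsum] at hlim
  have hup : Tendsto (fun N : ℕ ↦ C (-N - 1)) atTop (𝓝 (Real.pi * -Complex.I)) := by
    refine ((tendsto_cot_pi_mul_add_nat_mul hτ (z + τ)).const_mul (Real.pi : ℂ)).congr fun N ↦ ?_
    simp only [C]
    congr 3
    push_cast
    ring
  have hdown : Tendsto (fun N : ℕ ↦ C (N - 1)) atTop (𝓝 (-(Real.pi * -Complex.I))) := by
    refine ((tendsto_cot_pi_mul_add_nat_mul hτ (-z - τ)).const_mul (Real.pi : ℂ)).neg.congr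
      fun N ↦ ?_
    have : (Real.pi * (-z - τ + N * τ) : ℂ) = -(Real.pi * (z - ((N - 1 : ℤ) : ℂ) * τ)) := by
      push_cast
      ring
    simp only [C]
    rw [this, Complex.cot, Complex.cot, Complex.cos_neg, Complex.sin_neg, div_neg, mul_neg, neg_neg]
  have := tendsto_nhds_unique hlim (hup.sub hdown)
  linear_combination this

lemma latticePoint_neg (τ : ℂ) (q : ℤ × ℤ) : latticePoint τ (-q) = -latticePoint τ q := by
  simp [latticePoint]
  ring

lemma zetaSum_neg (τ z : ℂ) : zetaSum τ (-z) = -zetaSum τ z := by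
  rw [zetaSum, zetaSum, ← tsum_neg, ← (Equiv.neg (ℤ × ℤ)).tsum_eq]
  refine tsum_congr fun q ↦ ?_
  simp only [zetaTerm, Equiv.neg_apply, latticePoint_neg]
  rw [show -z - -latticePoint τ q = -(z - latticePoint τ q) by ring]
  simp only [div_neg, neg_sq, neg_div]
  ring

lemma latticePoint_add (τ : ℂ) (q r : ℤ × ℤ) :
    latticePoint τ (q + r) = latticePoint τ q + latticePoint τ r := by
  simp only [latticePoint, Prod.fst_add, Prod.snd_add, Int.cast_add]
  ring

lemma latticePoint_injective {τ : ℂ} (hτ : 0 < τ.im) : Function.Injective (latticePoint τ) := by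
  intro q r h
  by_contra hne
  refine latticePoint_ne_zero hτ (q := q + -r) (fun h0 ↦ hne (add_neg_eq_zero.mp h0)) ?_
  rw [latticePoint_add, latticePoint_neg, h, add_neg_cancel]

lemma half_latticePoint_ne {τ : ℂ} (hτ : 0 < τ.im) {q : ℤ × ℤ} (hq : ∀ r, q ≠ r + r)
    (r : ℤ × ℤ) : latticePoint τ q / 2 ≠ latticePoint τ r := fun h ↦ by
  refine hq r (latticePoint_injective hτ ?_)
  rw [latticePoint_add]
  linear_combination 2 * h

lemma neg_ne_latticePoint {τ z : ℂ} (hz : ∀ q, z ≠ latticePoint τ q) (q : ℤ × ℤ) :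
    -z ≠ latticePoint τ q := fun h ↦ hz (-q) (by rw [latticePoint_neg, ← h, neg_neg])

lemma add_latticePoint_ne {τ z : ℂ} (hz : ∀ q, z ≠ latticePoint τ q) (r q : ℤ × ℤ) :
    z + latticePoint τ r ≠ latticePoint τ q := fun h ↦ hz (q + -r) <| by
  rw [latticePoint_add, latticePoint_neg]
  linear_combination h

lemma latticePoint_one_zero (τ : ℂ) : latticePoint τ (1, 0) = 1 := by simp [latticePoint]

lemma latticePoint_zero_one (τ : ℂ) : latticePoint τ (0, 1) = τ := by simp [latticePoint]

lemma half_ne_latticePoint {τ : ℂ} (hτ : 0 < τ.im) (q : ℤ × ℤ) :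
    (1 / 2 : ℂ) ≠ latticePoint τ q := by
  rw [← latticePoint_one_zero τ]
  refine half_latticePoint_ne hτ (fun r hr ↦ ?_) q
  have := congrArg Prod.fst hr
  simp only [Prod.fst_add] at this
  lia

lemma half_tau_ne_latticePoint {τ : ℂ} (hτ : 0 < τ.im) (q : ℤ × ℤ) : τ / 2 ≠ latticePoint τ q := by
  have h := half_latticePoint_ne hτ (q := (0, 1)) (fun r hr ↦ ?_) q
  · rwa [latticePoint_zero_one] at h
  have := congrArg Prod.snd hr
  simp only [Prod.snd_add] at this
  lia

lemma zetaSum_add_one {τ : ℂ} (hτ : 0 < τ.im) {z : ℂ} (hz : ∀ q, z ≠ latticePoint τ q) :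
    zetaSum τ (z + 1) = zetaSum τ z + wEta1 τ := by
  have h := (hasSum_zetaSum_add_one_sub hτ hz).unique
    (hasSum_zetaSum_add_one_sub hτ (neg_ne_latticePoint (half_ne_latticePoint hτ)))
  rw [show -(1 / 2 : ℂ) + 1 = 1 / 2 by norm_num, zetaSum_neg] at h
  rw [wEta1, wZeta_eq_zetaSum hτ (half_ne_latticePoint hτ)]
  linear_combination h

lemma zetaSum_add_tau {τ : ℂ} (hτ : 0 < τ.im) {z : ℂ} (hz : ∀ q, z ≠ latticePoint τ q) :
    zetaSum τ (z + τ) = zetaSum τ z + (τ * wEta1 τ - 2 * Real.pi * Complex.I) := by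
  have h := zetaSum_add_tau_sub hτ hz
  rw [zetaSum_add_one hτ hz] at h
  linear_combination h

lemma wSigma_neg (τ z : ℂ) : wSigma τ (-z) = -wSigma τ z := by
  have h : sigmaProd τ (-z) = sigmaProd τ z := by
    let e : {q : ℤ × ℤ // q ≠ (0, 0)} ≃ {q : ℤ × ℤ // q ≠ (0, 0)} :=
      (Equiv.neg (ℤ × ℤ)).subtypeEquiv fun q ↦ not_congr (neg_eq_zero (a := q)).symm
    rw [sigmaProd, sigmaProd, ← e.tprod_eq]
    refine tprod_congr fun q ↦ ?_
    have : (e q).1 = -q.1 := rfl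
    rw [this, sigmaFactor, sigmaFactor, latticePoint_neg, neg_div_neg_eq, neg_sq, neg_sq]
  rw [wSigma_eq, wSigma_eq, h, neg_mul]

lemma wSigma_latticePoint (τ : ℂ) (q : ℤ × ℤ) : wSigma τ (latticePoint τ q) = 0 := by
  rw [wSigma_eq, mul_eq_zero, or_iff_not_imp_left]
  intro h
  have hq : q ≠ (0, 0) := fun h0 ↦ h (by simp [h0, latticePoint])
  exact tprod_of_exists_eq_zero ⟨⟨q, hq⟩, by simp [sigmaFactor, div_self h]⟩

lemma isOpen_compl_range_latticePoint {τ : ℂ} (hτ : 0 < τ.im) :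
    IsOpen (range (latticePoint τ))ᶜ := by
  have : (range (latticePoint τ))ᶜ = wSigma τ ⁻¹' {0}ᶜ := by
    ext z
    refine ⟨fun hz ↦ wSigma_ne_zero hτ fun q hq ↦ hz ⟨q, hq.symm⟩, ?_⟩
    rintro hz ⟨q, rfl⟩
    exact hz (wSigma_latticePoint τ q)
  rw [this]
  exact isOpen_compl_singleton.preimage (differentiable_wSigma hτ).continuous

lemma mem_compl_range_latticePoint {τ z : ℂ} :
    z ∈ (range (latticePoint τ))ᶜ ↔ ∀ q, z ≠ latticePoint τ q := by
  simp [eq_comm]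

lemma logDeriv_wSigma {τ : ℂ} (hτ : 0 < τ.im) {z : ℂ} (hz : ∀ q, z ≠ latticePoint τ q) :
    logDeriv (wSigma τ) z = zetaSum τ z :=
  wZeta_eq_zetaSum hτ hz

/-- The quasi-periodicity of σ, deduced from that of ζ. -/
lemma norm_wSigma_add {τ : ℂ} (hτ : 0 < τ.im) {p e : ℂ}
    (hp : ∀ z, (∀ q, z ≠ latticePoint τ q) → ∀ q, z + p ≠ latticePoint τ q)
    (hhalf : ∀ q, p / 2 ≠ latticePoint τ q)
    (he : ∀ z, (∀ q, z ≠ latticePoint τ q) → zetaSum τ (z + p) = zetaSum τ z + e) {z : ℂ}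
    (hz : ∀ q, z ≠ latticePoint τ q) :
    ‖wSigma τ (z + p)‖ = Real.exp (e * (z + p / 2)).re * ‖wSigma τ z‖ := by
  have hd := differentiable_wSigma hτ
  have hf : Differentiable ℂ fun z ↦ wSigma τ (z + p) := hd.comp (differentiable_id.add_const p)
  have hE : Differentiable ℂ fun z ↦ Complex.exp (e * (z + p / 2)) := by fun_prop
  have hg : Differentiable ℂ fun z ↦ Complex.exp (e * (z + p / 2)) * wSigma τ z := hE.mul hd
  have hlog : EqOn (logDeriv fun z ↦ wSigma τ (z + p))
      (logDeriv fun z ↦ Complex.exp (e * (z + p / 2)) * wSigma τ z) (range (latticePoint τ))ᶜ := by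
    intro u hu
    rw [mem_compl_range_latticePoint] at hu
    have h1 : logDeriv (fun z ↦ wSigma τ (z + p)) u = zetaSum τ (u + p) := by
      rw [← logDeriv_wSigma hτ (hp u hu), logDeriv_apply, logDeriv_apply, deriv_comp_add_const]
    have h2 : logDeriv (fun z ↦ Complex.exp (e * (z + p / 2))) u = e := by
      have h : HasDerivAt (fun z ↦ Complex.exp (e * (z + p / 2)))
          (Complex.exp (e * (u + p / 2)) * (e * 1)) u :=
        (((hasDerivAt_id u).add_const (p / 2)).const_mul e).cexp
      rw [logDeriv_apply, h.deriv, mul_one, mul_div_cancel_left₀ _ (Complex.exp_ne_zero _)]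
    rw [h1, logDeriv_mul (f := fun z ↦ Complex.exp (e * (z + p / 2))) u
      (Complex.exp_ne_zero _) (wSigma_ne_zero hτ hu) (hE u) (hd u), h2, logDeriv_wSigma hτ hu,
      he u hu, add_comm]
  obtain ⟨c, -, hc⟩ := (logDeriv_eqOn_iff hf.differentiableOn hg.differentiableOn
    (isOpen_compl_range_latticePoint hτ)
    ((countable_range _).isConnected_compl_of_one_lt_rank (by simp)).isPreconnected
    (fun u hu ↦ mul_ne_zero (Complex.exp_ne_zero _)
      (wSigma_ne_zero hτ (mem_compl_range_latticePoint.mp hu)))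
    (fun u hu ↦ wSigma_ne_zero hτ (hp u (mem_compl_range_latticePoint.mp hu)))).mp hlog
  have h0 := hc (mem_compl_range_latticePoint.mpr (neg_ne_latticePoint hhalf))
  simp only [Pi.smul_apply, smul_eq_mul, neg_add_cancel, mul_zero, Complex.exp_zero, one_mul,
    wSigma_neg] at h0
  rw [show -(p / 2) + p = p / 2 by ring] at h0
  have hc1 : c = -1 := by
    have := wSigma_ne_zero hτ hhalf
    apply mul_right_cancel₀ this
    linear_combination h0
  have h1 := hc (mem_compl_range_latticePoint.mpr hz)
  simp only [Pi.smul_apply, smul_eq_mul, hc1] at h1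
  rw [h1, norm_mul, norm_mul, norm_neg, norm_one, one_mul, Complex.norm_exp]

/-- A function with periods `1` and `τ` off the lattice has all lattice points as periods. -/
lemma apply_add_latticePoint {α : Type*} {τ : ℂ} {G : ℂ → α}
    (h1 : ∀ z, (∀ q, z ≠ latticePoint τ q) → G (z + 1) = G z)
    (h2 : ∀ z, (∀ q, z ≠ latticePoint τ q) → G (z + τ) = G z) {z : ℂ}
    (hz : ∀ q, z ≠ latticePoint τ q) (q : ℤ × ℤ) : G (z + latticePoint τ q) = G z := by
  let S : AddSubgroup (ℤ × ℤ) :=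
    { carrier := {r | ∀ z, (∀ q, z ≠ latticePoint τ q) → G (z + latticePoint τ r) = G z}
      zero_mem' := fun z _ ↦ by simp [latticePoint]
      add_mem' := fun {r s} hr hs z hz ↦ by
        rw [latticePoint_add, ← add_assoc, hs _ (add_latticePoint_ne hz r), hr z hz]
      neg_mem' := fun {r} hr z hz ↦ by
        rw [← hr _ (add_latticePoint_ne hz (-r)), latticePoint_neg, neg_add_cancel_right] }
  have h10 : ((1, 0) : ℤ × ℤ) ∈ S := fun z hz ↦ by rw [latticePoint_one_zero, h1 z hz]
  have h01 : ((0, 1) : ℤ × ℤ) ∈ S := fun z hz ↦ by rw [latticePoint_zero_one, h2 z hz]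
  have hq := S.add_mem (S.zsmul_mem h10 q.1) (S.zsmul_mem h01 q.2)
  simp only [Prod.smul_mk, smul_eq_mul, mul_one, mul_zero, Prod.mk_add_mk, add_zero,
    zero_add] at hq
  exact hq z hz

/-- The closed period parallelogram of the lattice `ℤ + ℤτ` centred at the origin. -/
def periodParallelogram (τ : ℂ) : Set ℂ :=
  (fun p : ℝ × ℝ ↦ (p.1 : ℂ) + p.2 * τ) '' (Icc (-(1 / 2)) (1 / 2) ×ˢ Icc (-(1 / 2)) (1 / 2))

lemma isCompact_periodParallelogram (τ : ℂ) : IsCompact (periodParallelogram τ) :=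
  (isCompact_Icc.prod isCompact_Icc).image (by fun_prop)

lemma exists_sub_latticePoint_mem {τ : ℂ} (hτ : 0 < τ.im) (z : ℂ) :
    ∃ q, z - latticePoint τ q ∈ periodParallelogram τ := by
  let y := z.im / τ.im
  let x := z.re - y * τ.re
  have hz : z = x + y * τ := by
    apply Complex.ext
    · simp [x]
    · simp [y, hτ.ne']
  refine ⟨(round x, round y), (x - round x, y - round y),
    ⟨abs_le.mp (abs_sub_round x), abs_le.mp (abs_sub_round y)⟩, ?_⟩
  conv_rhs => rw [hz]
  simp only [latticePoint]
  push_cast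
  ring

lemma exists_mul_norm_le_norm_sub_latticePoint {τ : ℂ} (hτ : 0 < τ.im) :
    ∃ c : ℝ, 0 < c ∧ ∀ z ∈ periodParallelogram τ, ∀ q : ℤ × ℤ, q ≠ (0, 0) →
      c * ‖latticePoint τ q‖ ≤ ‖z - latticePoint τ q‖ := by
  obtain ⟨K, hK, h⟩ := exists_coord_le_norm hτ
  have hτ1 : 0 < 1 + ‖τ‖ := by positivity
  refine ⟨(2 * K * (1 + ‖τ‖))⁻¹, by positivity, ?_⟩
  rintro _ ⟨⟨x, y⟩, ⟨hx, hy⟩, rfl⟩ ⟨m, n⟩ hq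
  have hcoord := h (x - m) (y - n)
  have e : ((x - m : ℝ) : ℂ) + ((y - n : ℝ) : ℂ) * τ =
      (x : ℂ) + y * τ - latticePoint τ (m, n) := by
    simp only [latticePoint]
    push_cast
    ring
  rw [e] at hcoord
  obtain ⟨hm, hn⟩ := hcoord
  have key : ∀ (t : ℝ) (k : ℤ), |t| ≤ 1 / 2 → |(k : ℝ)| ≤ 2 * |t - k| := fun t k ht ↦ by
    rcases eq_or_ne k 0 with rfl | hk
    · simp
    have hk1 : (1 : ℝ) ≤ |(k : ℝ)| := by exact_mod_cast Int.one_le_abs hk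
    have := abs_sub_abs_le_abs_sub (k : ℝ) t
    rw [abs_sub_comm] at this
    linarith
  have hm' := key x m (abs_le.mpr hx)
  have hn' := key y n (abs_le.mpr hy)
  have hw : ‖latticePoint τ (m, n)‖ ≤ |(m : ℝ)| + |(n : ℝ)| * ‖τ‖ := by
    refine (norm_add_le _ _).trans ?_
    rw [norm_mul, Complex.norm_intCast, Complex.norm_intCast]
  rw [inv_mul_le_iff₀ (by positivity)]
  set d := ‖(x : ℂ) + y * τ - latticePoint τ (m, n)‖
  calc ‖latticePoint τ (m, n)‖ ≤ |(m : ℝ)| + |(n : ℝ)| * ‖τ‖ := hw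
    _ ≤ 2 * (K * d) + 2 * (K * d) * ‖τ‖ := by gcongr <;> linarith
    _ = _ := by ring

lemma exists_norm_zetaSum_sub_inv_le {τ : ℂ} (hτ : 0 < τ.im) :
    ∃ M : ℝ, ∀ z ∈ periodParallelogram τ, ‖zetaSum τ z - 1 / z‖ ≤ M := by
  obtain ⟨c, hc, h⟩ := exists_mul_norm_le_norm_sub_latticePoint hτ
  obtain ⟨D, hD⟩ := (isCompact_periodParallelogram τ).isBounded.exists_norm_le
  have hs : Summable fun q : {q : ℤ × ℤ // q ≠ (0, 0)} ↦
      D ^ 2 / c * (‖latticePoint τ q.1‖ ^ 3)⁻¹ :=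
    ((summable_inv_norm_latticePoint_cube hτ).mul_left _).subtype _
  refine ⟨∑' q : {q : ℤ × ℤ // q ≠ (0, 0)}, D ^ 2 / c * (‖latticePoint τ q.1‖ ^ 3)⁻¹,
    fun z hz ↦ ?_⟩
  rw [zetaSum_eq hτ, add_sub_cancel_left]
  refine tsum_of_norm_bounded hs.hasSum fun q ↦ ?_
  refine (norm_zetaTerm_le hc (latticePoint_ne_zero hτ q.2) (h z hz q.1 q.2)).trans ?_
  gcongr
  exact hD z hz

lemma exists_abs_log_norm_sigmaProd_le {τ : ℂ} (hτ : 0 < τ.im) :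
    ∃ M : ℝ, ∀ z ∈ periodParallelogram τ, |Real.log ‖sigmaProd τ z‖| ≤ M := by
  obtain ⟨c, hc, h⟩ := exists_mul_norm_le_norm_sub_latticePoint hτ
  refine (isCompact_periodParallelogram τ).exists_bound_of_continuousOn
    (f := fun z ↦ Real.log ‖sigmaProd τ z‖) ?_
  refine (differentiable_sigmaProd hτ).continuous.norm.continuousOn.log fun z hz ↦ ?_
  refine norm_ne_zero_iff.mpr (sigmaProd_ne_zero hτ fun q hq heq ↦ ?_)
  have h1 := h z hz q hq
  rw [heq, sub_self, norm_zero] at h1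
  exact absurd h1 (not_le.mpr (mul_pos hc (norm_pos_iff.mpr (latticePoint_ne_zero hτ hq))))

/-- The quadratic approximation of `log ‖σ‖`. -/
noncomputable def sigmaPotential (τ z : ℂ) : ℝ :=
  (Real.pi / (2 * τ.im)) * ‖z‖ ^ 2 +
    ((wEta1 τ / 2 - ((Real.pi / (2 * τ.im) : ℝ) : ℂ)) * z ^ 2).re

/-- The real-linear approximation of ζ. -/
noncomputable def zetaLinear (τ z : ℂ) : ℂ :=
  wEta1 τ * z - (2 * (Real.pi : ℂ) * Complex.I / (τ.im : ℂ)) * (z.im : ℂ)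

lemma sigmaPotential_add_one (τ z : ℂ) :
    sigmaPotential τ (z + 1) = sigmaPotential τ z + (wEta1 τ * (z + 1 / 2)).re := by
  rw [sigmaPotential, sigmaPotential]
  generalize Real.pi / (2 * τ.im) = a
  simp only [Complex.sq_norm, Complex.normSq_apply]
  simp [pow_two]
  ring

lemma sigmaPotential_add_tau {τ : ℂ} (hτ : 0 < τ.im) (z : ℂ) :
    sigmaPotential τ (z + τ) = sigmaPotential τ z +
      ((τ * wEta1 τ - 2 * Real.pi * Complex.I) * (z + τ / 2)).re := by
  obtain ⟨a, ha⟩ : ∃ a, a = Real.pi / (2 * τ.im) := ⟨_, rfl⟩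
  have hpi : Real.pi = 2 * τ.im * a := by
    rw [ha]
    field_simp
  rw [sigmaPotential, sigmaPotential, ← ha, hpi]
  simp only [Complex.sq_norm, Complex.normSq_apply]
  simp [pow_two]
  ring

lemma log_norm_wSigma_sub_sigmaPotential_add {τ : ℂ} (hτ : 0 < τ.im) {z : ℂ}
    (hz : ∀ q, z ≠ latticePoint τ q) (q : ℤ × ℤ) :
    Real.log ‖wSigma τ (z + latticePoint τ q)‖ - sigmaPotential τ (z + latticePoint τ q) =
      Real.log ‖wSigma τ z‖ - sigmaPotential τ z := by
  refine apply_add_latticePoint (G := fun z ↦ Real.log ‖wSigma τ z‖ - sigmaPotential τ z)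
    (fun u hu ↦ ?_) (fun u hu ↦ ?_) hz q
  · rw [norm_wSigma_add hτ (fun _ ↦ add_one_ne_latticePoint) (half_ne_latticePoint hτ)
      (fun _ ↦ zetaSum_add_one hτ) hu, Real.log_mul (Real.exp_ne_zero _)
      (norm_ne_zero_iff.mpr (wSigma_ne_zero hτ hu)), Real.log_exp, sigmaPotential_add_one]
    ring
  · rw [norm_wSigma_add hτ (fun _ ↦ add_tau_ne_latticePoint) (half_tau_ne_latticePoint hτ)
      (fun _ ↦ zetaSum_add_tau hτ) hu, Real.log_mul (Real.exp_ne_zero _)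
      (norm_ne_zero_iff.mpr (wSigma_ne_zero hτ hu)), Real.log_exp, sigmaPotential_add_tau hτ]
    ring

lemma zetaSum_sub_zetaLinear_add {τ : ℂ} (hτ : 0 < τ.im) {z : ℂ}
    (hz : ∀ q, z ≠ latticePoint τ q) (q : ℤ × ℤ) :
    zetaSum τ (z + latticePoint τ q) - zetaLinear τ (z + latticePoint τ q) =
      zetaSum τ z - zetaLinear τ z := by
  have him : (τ.im : ℂ) ≠ 0 := by exact_mod_cast hτ.ne'
  refine apply_add_latticePoint (G := fun z ↦ zetaSum τ z - zetaLinear τ z)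
    (fun u hu ↦ ?_) (fun u hu ↦ ?_) hz q
  · simp only [zetaSum_add_one hτ hu, zetaLinear, Complex.add_im, Complex.one_im, add_zero]
    ring
  · simp only [zetaSum_add_tau hτ hu, zetaLinear, Complex.add_im, Complex.ofReal_add]
    field_simp
    ring

/-- The deviations of `log ‖σ‖` and ζ from their approximations, in terms of the distance to a
nearby lattice point. -/
lemma exists_deviation_le {τ : ℂ} (hτ : 0 < τ.im) :
    ∃ D M : ℝ, 0 ≤ D ∧ 0 ≤ M ∧ ∀ z, (∀ q, z ≠ latticePoint τ q) → ∃ q,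
      ‖z - latticePoint τ q‖ ≤ D ∧
      |Real.log ‖wSigma τ z‖ - sigmaPotential τ z| ≤ |Real.log ‖z - latticePoint τ q‖| + M ∧
      ‖wZeta τ z - zetaLinear τ z‖ ≤ ‖z - latticePoint τ q‖⁻¹ + M := by
  have hK := isCompact_periodParallelogram τ
  obtain ⟨D, hD⟩ := hK.isBounded.exists_norm_le
  obtain ⟨M₁, hM₁⟩ := exists_abs_log_norm_sigmaProd_le hτ
  obtain ⟨M₂, hM₂⟩ := hK.exists_bound_of_continuousOn (f := sigmaPotential τ)
    (by unfold sigmaPotential; fun_prop)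
  obtain ⟨M₃, hM₃⟩ := exists_norm_zetaSum_sub_inv_le hτ
  obtain ⟨M₄, hM₄⟩ := hK.exists_bound_of_continuousOn (f := zetaLinear τ)
    (by unfold zetaLinear; fun_prop)
  have h0 : (0 : ℂ) ∈ periodParallelogram τ := ⟨(0, 0), by simp, by simp⟩
  have hM₁0 := (abs_nonneg _).trans (hM₁ 0 h0)
  have hM₂0 := (norm_nonneg _).trans (hM₂ 0 h0)
  have hM₃0 := (norm_nonneg _).trans (hM₃ 0 h0)
  have hM₄0 := (norm_nonneg _).trans (hM₄ 0 h0)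
  refine ⟨D, M₁ + M₂ + M₃ + M₄, (norm_nonneg _).trans (hD 0 h0), by positivity, fun z hz ↦ ?_⟩
  obtain ⟨q, hq⟩ := exists_sub_latticePoint_mem hτ z
  refine ⟨q, hD _ hq, ?_, ?_⟩
  all_goals
    have hu : ∀ r, z - latticePoint τ q ≠ latticePoint τ r := fun r ↦ by
      simpa only [latticePoint_neg, sub_eq_add_neg] using add_latticePoint_ne hz (-q) r
    have hzu : z - latticePoint τ q + latticePoint τ q = z := sub_add_cancel _ _
  · have h := log_norm_wSigma_sub_sigmaPotential_add hτ hu q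
    rw [hzu] at h
    rw [h, wSigma_eq, norm_mul, Real.log_mul
      (norm_ne_zero_iff.mpr (ne_zero_of_forall_ne_latticePoint hu))
      (norm_ne_zero_iff.mpr (sigmaProd_ne_zero hτ fun r _ ↦ hu r))]
    have h1 := hM₁ _ hq
    have h2 := hM₂ _ hq
    rw [Real.norm_eq_abs] at h2
    refine (abs_sub _ _).trans ?_
    have := abs_add_le (Real.log ‖z - latticePoint τ q‖)
      (Real.log ‖sigmaProd τ (z - latticePoint τ q)‖)
    linarith
  · have h := zetaSum_sub_zetaLinear_add hτ hu q
    rw [hzu] at h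
    rw [wZeta_eq_zetaSum hτ hz, h]
    set u := z - latticePoint τ q
    have h3 := hM₃ _ hq
    rw [one_div] at h3
    have h4 := hM₄ _ hq
    calc ‖zetaSum τ u - zetaLinear τ u‖ = ‖u⁻¹ + (zetaSum τ u - u⁻¹) - zetaLinear τ u‖ := by
          congr 1; ring
      _ ≤ ‖u⁻¹‖ + ‖zetaSum τ u - u⁻¹‖ + ‖zetaLinear τ u‖ :=
          (norm_sub_le _ _).trans (add_le_add_left (norm_add_le _ _) _)
      _ ≤ ‖u‖⁻¹ + (M₁ + M₂ + M₃ + M₄) := by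
          rw [norm_inv]
          linarith

lemma forall_ne_latticePoint_of_notMem_iUnion_ball {τ z : ℂ} {ρ : ℤ × ℤ → ℝ} (hz : z ≠ 0)
    (hρ : ∀ q, q ≠ (0, 0) → 0 < ρ q)
    (h : z ∉ ⋃ (q : ℤ × ℤ) (_ : q ≠ (0, 0)), ball (latticePoint τ q) (ρ q)) (q : ℤ × ℤ) :
    z ≠ latticePoint τ q := by
  rintro rfl
  have hq : q ≠ (0, 0) := fun h0 ↦ hz (by simp [h0, latticePoint])
  exact h (mem_iUnion₂.mpr ⟨q, hq, mem_ball_self (hρ q hq)⟩)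

lemma le_norm_sub_of_notMem_iUnion_ball {τ z : ℂ} {ρ : ℤ × ℤ → ℝ}
    (h : z ∉ ⋃ (q : ℤ × ℤ) (_ : q ≠ (0, 0)), ball (latticePoint τ q) (ρ q)) {q : ℤ × ℤ}
    (hq : q ≠ (0, 0)) : ρ q ≤ ‖z - latticePoint τ q‖ := by
  by_contra! hlt
  exact h (mem_iUnion₂.mpr ⟨q, hq, by rwa [mem_ball_iff_norm]⟩)

theorem weierstrass_sigma_zeta_asymptotics (τ : ℂ) (hτ : 0 < τ.im) :
    ∃ C : ℝ, 0 < C ∧ ∃ R : ℝ, 0 < R ∧ ∀ z : ℂ, R ≤ ‖z‖ →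
      ((z ∉ ⋃ (q : ℤ × ℤ) (_ : q ≠ (0, 0)),
          ball (latticePoint τ q) (Real.exp (-‖latticePoint τ q‖)) →
        |Real.log ‖wSigma τ z‖ -
            ((Real.pi / (2 * τ.im)) * ‖z‖ ^ 2 +
              ((wEta1 τ / 2 - ((Real.pi / (2 * τ.im) : ℝ) : ℂ)) * z ^ 2).re)| ≤ C * ‖z‖) ∧
       (z ∉ ⋃ (q : ℤ × ℤ) (_ : q ≠ (0, 0)),
          ball (latticePoint τ q) ((Real.sqrt ‖latticePoint τ q‖)⁻¹) →
        ‖wZeta τ z - (wEta1 τ * z -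
            (2 * (Real.pi : ℂ) * Complex.I / (τ.im : ℂ)) * (z.im : ℂ))‖ ≤
          C * Real.sqrt ‖z‖)) := by
  obtain ⟨D, M, hD, hM, h⟩ := exists_deviation_le hτ
  refine ⟨2 + M, by positivity, D + 1, by positivity, fun z hz ↦ ?_⟩
  have hz1 : 1 ≤ ‖z‖ := by linarith
  have hz0 : z ≠ 0 := norm_pos_iff.mp (by linarith)
  have hMz : M ≤ M * ‖z‖ := le_mul_of_one_le_right hM hz1
  have hindex : ∀ q, ‖z - latticePoint τ q‖ ≤ D → q ≠ (0, 0) ∧ ‖latticePoint τ q‖ ≤ 2 * ‖z‖ := by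
    refine fun q hq ↦ ⟨fun h0 ↦ ?_, ?_⟩
    · simp only [h0, latticePoint, Int.cast_zero, zero_mul, add_zero, sub_zero] at hq
      linarith
    · have := norm_sub_norm_le (latticePoint τ q) z
      rw [norm_sub_rev] at this
      linarith
  constructor
  · intro hE
    obtain ⟨q, hq, hσ, -⟩ := h z (forall_ne_latticePoint_of_notMem_iUnion_ball hz0
      (ρ := fun q ↦ Real.exp (-‖latticePoint τ q‖)) (fun q _ ↦ Real.exp_pos _) hE)
    obtain ⟨hq0, hqz⟩ := hindex q hq
    have hlow := le_norm_sub_of_notMem_iUnion_ball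
      (ρ := fun q ↦ Real.exp (-‖latticePoint τ q‖)) hE hq0
    have hpos : 0 < ‖z - latticePoint τ q‖ := (Real.exp_pos _).trans_le hlow
    have hlog : |Real.log ‖z - latticePoint τ q‖| ≤ 2 * ‖z‖ := by
      rw [abs_le]
      constructor
      · have := (Real.le_log_iff_exp_le hpos).mpr hlow
        linarith
      · linarith [Real.log_le_self hpos.le]
    refine hσ.trans ?_
    linarith
  · intro hF
    have hρ : ∀ q, q ≠ (0, 0) → 0 < (Real.sqrt ‖latticePoint τ q‖)⁻¹ := fun q hq ↦
      inv_pos.mpr (Real.sqrt_pos.mpr (norm_pos_iff.mpr (latticePoint_ne_zero hτ hq)))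
    obtain ⟨q, hq, -, hζ⟩ := h z (forall_ne_latticePoint_of_notMem_iUnion_ball hz0
      (ρ := fun q ↦ (Real.sqrt ‖latticePoint τ q‖)⁻¹) hρ hF)
    obtain ⟨hq0, hqz⟩ := hindex q hq
    have hlow := le_norm_sub_of_notMem_iUnion_ball
      (ρ := fun q ↦ (Real.sqrt ‖latticePoint τ q‖)⁻¹) hF hq0
    have hinv : ‖z - latticePoint τ q‖⁻¹ ≤ 2 * Real.sqrt ‖z‖ := calc
      ‖z - latticePoint τ q‖⁻¹ ≤ Real.sqrt ‖latticePoint τ q‖ :=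
        inv_le_of_inv_le₀ (inv_pos.mp (hρ q hq0)) hlow
      _ ≤ Real.sqrt (2 ^ 2 * ‖z‖) := Real.sqrt_le_sqrt (by linarith)
      _ = 2 * Real.sqrt ‖z‖ := by rw [Real.sqrt_mul (by norm_num), Real.sqrt_sq (by norm_num)]
    have hMs : M ≤ M * Real.sqrt ‖z‖ := le_mul_of_one_le_right hM (Real.one_le_sqrt.mpr hz1)
    refine hζ.trans ?_
    linarith
end
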